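/- arXiv:1503.00225 — 2 statements merged into one kernel-verified Lean document; each statement's English description precedes it below -/
import Mathlib

section
/- For every L > 0 and every λ > 0 there exists a C³ function k : T → ℝ on the triangle T = {(x,y) : 0 ≤ x ≤ L, x ≤ y ≤ L} satisfying k_{xxx} + k_{yyy} + k_x + k_y = −λ k in T, k(x,L) = 0 for all x ∈ [0,L], k(x,x) = 0 for all x ∈ [0,L], and k_x(x,x) = (λ/3)(L−x) for all x ∈ [0,L]. -/
open NormedSpace
open scoped BoundedContinuousFunction

/-- Bounded sequences carry a left shift `S`, a right inverse `J` of `S`, a functional `ε` vanishing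
on the range of `J` and a vector `e` with `S e = 0`, `ε e = 1`. For sequences of derivatives at
zero, `S` is differentiation, `J` integration from zero and `ε` evaluation at zero. -/
theorem exists_bounded_shift :
    ∃ (S J : (ℕ →ᵇ ℝ) →L[ℝ] (ℕ →ᵇ ℝ)) (ε : (ℕ →ᵇ ℝ) →L[ℝ] ℝ) (e : ℕ →ᵇ ℝ),
      (∀ c, S (J c) = c) ∧ (∀ c, ε (J c) = 0) ∧ S e = 0 ∧ ε e = 1 := by
  have bound (c : ℕ →ᵇ ℝ) (n : ℕ) :
      ‖(Nat.casesOn n 0 fun m => c m : ℝ)‖ ≤ ‖c‖ := by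
    cases n with
    | zero => simp
    | succ m => exact c.norm_coe_le_norm m
  let S : (ℕ →ᵇ ℝ) →L[ℝ] (ℕ →ᵇ ℝ) := LinearMap.mkContinuous
    { toFun := fun c => .ofNormedAddCommGroupDiscrete (fun n => c (n + 1)) ‖c‖
        fun n => c.norm_coe_le_norm _
      map_add' := fun c d => by ext; simp
      map_smul' := fun a c => by ext; simp } 1 fun c => by
        rw [one_mul]
        exact (BoundedContinuousFunction.norm_le (norm_nonneg c)).2
          fun n => c.norm_coe_le_norm (n + 1)
  let J : (ℕ →ᵇ ℝ) →L[ℝ] (ℕ →ᵇ ℝ) := LinearMap.mkContinuous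
    { toFun := fun c => .ofNormedAddCommGroupDiscrete (fun n => Nat.casesOn n 0 fun m => c m) ‖c‖
        (bound c)
      map_add' := fun c d => by ext n; cases n <;> simp
      map_smul' := fun a c => by ext n; cases n <;> simp } 1 fun c => by
        rw [one_mul]
        exact (BoundedContinuousFunction.norm_le (norm_nonneg c)).2 (bound c)
  let e : ℕ →ᵇ ℝ := .ofNormedAddCommGroupDiscrete (fun n => if n = 0 then 1 else 0) 1 fun n => by
    split_ifs <;> simp
  refine ⟨S, J, BoundedContinuousFunction.evalCLM ℝ 0, e, fun c => ?_, fun c => ?_, ?_, ?_⟩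
  · ext n; rfl
  · rfl
  · ext n; rfl
  · simp [e]

section Propagator

variable {E F : Type*} [NormedAddCommGroup E] [NormedSpace ℝ E]
  [NormedAddCommGroup F] [NormedSpace ℝ F]

/-- The matrix element `ε (exp (u S) (B (exp (t A) z)))` of two propagators. -/
noncomputable def propagatorPairing (S : E →L[ℝ] E) (A : F →L[ℝ] F) (ε : E →L[ℝ] ℝ) (z : F)
    (B : F →L[ℝ] E) (u t : ℝ) : ℝ :=
  ε (exp (u • S) (B (exp (t • A) z)))

variable (S : E →L[ℝ] E) (A : F →L[ℝ] F) (ε : E →L[ℝ] ℝ) (z : F) (B : F →L[ℝ] E)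

theorem propagatorPairing_add (B C : F →L[ℝ] E) (u t : ℝ) :
    propagatorPairing S A ε z (B + C) u t =
      propagatorPairing S A ε z B u t + propagatorPairing S A ε z C u t := by
  simp [propagatorPairing]

theorem propagatorPairing_smul (a : ℝ) (u t : ℝ) :
    propagatorPairing S A ε z (a • B) u t = a * propagatorPairing S A ε z B u t := by
  simp [propagatorPairing]

variable [CompleteSpace E] [CompleteSpace F]

theorem contDiff_exp_smul (S : E →L[ℝ] E) {n : WithTop ℕ∞} :
    ContDiff ℝ n fun u : ℝ => exp (u • S) := by
  have h : ContDiff ℝ n (exp : (E →L[ℝ] E) → (E →L[ℝ] E)) :=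
    contDiff_iff_contDiffAt.2 fun x => (exp_analytic (𝕂 := ℝ) x).contDiffAt
  exact h.comp (contDiff_id.smul contDiff_const)

theorem contDiff_propagatorPairing {n : WithTop ℕ∞} :
    ContDiff ℝ n (Function.uncurry (propagatorPairing S A ε z B)) := by
  have hS : ContDiff ℝ n fun q : ℝ × ℝ => exp (q.1 • S) :=
    (contDiff_exp_smul S).comp contDiff_fst
  have hA : ContDiff ℝ n fun q : ℝ × ℝ => exp (q.2 • A) :=
    (contDiff_exp_smul A).comp contDiff_snd
  exact ε.contDiff.comp (hS.clm_apply (B.contDiff.comp (hA.clm_apply contDiff_const)))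

theorem hasDerivAt_propagatorPairing_comp {p q : ℝ → ℝ} {p' q' s : ℝ}
    (hp : HasDerivAt p p' s) (hq : HasDerivAt q q' s) :
    HasDerivAt (fun r => propagatorPairing S A ε z B (p r) (q r))
      (propagatorPairing S A ε z (p' • S.comp B + q' • B.comp A) (p s) (q s)) s := by
  have hS := (hasDerivAt_exp_smul_const S (p s)).scomp s hp
  have hA := (hasDerivAt_exp_smul_const A (q s)).scomp s hq
  have hA' := hA.clm_apply (hasDerivAt_const s z)
  have h := ε.hasFDerivAt.comp_hasDerivAt s
    (hS.clm_apply (B.hasFDerivAt.comp_hasDerivAt s hA'))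
  have hcomm : exp (q s • A) * A = A * exp (q s • A) :=
    (((Commute.refl A).smul_right (q s)).exp_right).eq.symm
  rw [hcomm] at h
  refine h.congr_deriv ?_
  simp [propagatorPairing]

theorem deriv_propagatorPairing_left (L y : ℝ) :
    deriv (fun s => propagatorPairing S A ε z B (L - y) (y - s)) =
      fun s => propagatorPairing S A ε z (-B.comp A) (L - y) (y - s) := by
  funext s
  simpa using (hasDerivAt_propagatorPairing_comp S A ε z B (hasDerivAt_const s (L - y))
    ((hasDerivAt_id s).const_sub y)).deriv

theorem deriv_propagatorPairing_right (L x : ℝ) :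
    deriv (fun r => propagatorPairing S A ε z B (L - r) (r - x)) =
      fun r => propagatorPairing S A ε z (B.comp A - S.comp B) (L - r) (r - x) := by
  funext r
  simpa [sub_eq_add_neg, add_comm] using
    (hasDerivAt_propagatorPairing_comp S A ε z B ((hasDerivAt_id r).const_sub L)
      ((hasDerivAt_id r).sub_const x)).deriv

theorem exp_smul_apply_of_apply_eq_zero {e : E} (he : S e = 0) (u : ℝ) :
    exp (u • S) e = e := by
  have hd (s : ℝ) : HasDerivAt (fun r : ℝ => exp (r • S) e) 0 s := by
    simpa [he] using (hasDerivAt_exp_smul_const S s).clm_apply (hasDerivAt_const s e)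
  simpa using is_const_of_deriv_eq_zero (fun s => (hd s).differentiableAt)
    (fun s => (hd s).deriv) u 0

theorem exp_smul_apply_of_apply_apply_eq_zero {e : E} (he : S (S e) = 0) (u : ℝ) :
    exp (u • S) e = e + u • S e := by
  have hd (s : ℝ) : HasDerivAt (fun r : ℝ => exp (r • S) e - r • S e) 0 s := by
    have h := ((hasDerivAt_exp_smul_const S s).clm_apply (hasDerivAt_const s e)).fun_sub
      ((hasDerivAt_id s).smul_const (S e))
    simpa [exp_smul_apply_of_apply_eq_zero S he] using h
  have h := is_const_of_deriv_eq_zero (fun s => (hd s).differentiableAt)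
    (fun s => (hd s).deriv) u 0
  simp only [zero_smul, exp_zero, sub_zero, one_apply_eq_self] at h
  exact sub_eq_iff_eq_add.1 h

end Propagator

/-- Existence of the backstepping kernel for the state-feedback design: for every `L > 0` and
`λ > 0` there is a function `k`, of class `C³` on the triangle
`T = {(x,y) : 0 ≤ x ≤ L, x ≤ y ≤ L}`, satisfying
`k_xxx + k_yyy + k_x + k_y = -λ k` in `T`, `k(x,L) = 0`, `k(x,x) = 0`, and
`k_x(x,x) = (λ/3)(L-x)` for `x ∈ [0,L]`. -/
theorem exists_state_feedback_kernel (L lam : ℝ) (hL : 0 < L) (hlam : 0 < lam) :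
    ∃ k : ℝ → ℝ → ℝ,
      ContDiffOn ℝ 3 (Function.uncurry k)
        {q : ℝ × ℝ | 0 ≤ q.1 ∧ q.1 ≤ L ∧ q.1 ≤ q.2 ∧ q.2 ≤ L} ∧
      (∀ x y : ℝ, (x, y) ∈ {q : ℝ × ℝ | 0 ≤ q.1 ∧ q.1 ≤ L ∧ q.1 ≤ q.2 ∧ q.2 ≤ L} →
        iteratedDeriv 3 (fun s => k s y) x + iteratedDeriv 3 (fun r => k x r) y
          + deriv (fun s => k s y) x + deriv (fun r => k x r) y = -lam * k x y) ∧
      (∀ x ∈ Set.Icc (0:ℝ) L, k x L = 0) ∧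
      (∀ x ∈ Set.Icc (0:ℝ) L, k x x = 0) ∧
      (∀ x ∈ Set.Icc (0:ℝ) L, deriv (fun s => k s x) x = lam / 3 * (L - x)) := by
  obtain ⟨S, J, ε, e, hSJ, hεJ, hSe, hεe⟩ := exists_bounded_shift
  -- In the variables `u = L - y`, `t = y - x`, the function `f = g_u`, where `k(x,y) = g(u,t)`,
  -- solves `f_tt = ∂_u f_t - (1/3) ∂_u² f - (1/3) f + (λ/3) ∫₀ᵘ f`.
  let fst := ContinuousLinearMap.fst ℝ (ℕ →ᵇ ℝ) (ℕ →ᵇ ℝ)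
  let snd := ContinuousLinearMap.snd ℝ (ℕ →ᵇ ℝ) (ℕ →ᵇ ℝ)
  let A : (ℕ →ᵇ ℝ) × (ℕ →ᵇ ℝ) →L[ℝ] (ℕ →ᵇ ℝ) × (ℕ →ᵇ ℝ) :=
    snd.prod (S.comp snd - (1 / 3 : ℝ) • S.comp (S.comp fst) - (1 / 3 : ℝ) • fst
      + (lam / 3) • J.comp fst)
  let z : (ℕ →ᵇ ℝ) × (ℕ →ᵇ ℝ) := (0, -(lam / 3) • e)
  let B := J.comp fst
  refine ⟨fun x y => propagatorPairing S A ε z B (L - y) (y - x), ?_, ?_, ?_, ?_, ?_⟩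
  · have h := (contDiff_propagatorPairing S A ε z B (n := 3)).comp
      ((contDiff_const (c := L).sub contDiff_snd).prodMk (contDiff_snd.sub contDiff_fst))
    exact h.contDiffOn
  · intro x y _
    simp only [iteratedDeriv_succ, iteratedDeriv_zero, deriv_propagatorPairing_left,
      deriv_propagatorPairing_right, ← propagatorPairing_smul, ← propagatorPairing_add]
    refine congrArg (fun C => propagatorPairing S A ε z C (L - y) (y - x))
      (ContinuousLinearMap.ext fun w => ?_)
    simp only [B, A, fst, snd, add_apply, sub_apply,
      neg_apply, smul_apply,
      ContinuousLinearMap.comp_apply, ContinuousLinearMap.prod_apply,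
      ContinuousLinearMap.coe_fst', ContinuousLinearMap.coe_snd', map_add, map_sub, map_smul, hSJ]
    module
  · intro x _
    simp [propagatorPairing, B, hεJ]
  · intro x _
    simp [propagatorPairing, B, fst, z]
  · intro x _
    rw [deriv_propagatorPairing_left]
    have hJ := exp_smul_apply_of_apply_apply_eq_zero S (e := J e) (by rw [hSJ, hSe]) (L - x)
    rw [hSJ] at hJ
    simp [propagatorPairing, B, A, fst, snd, z, hJ, hεJ, hεe]
end

section
/- Let L > 0 and λ > 0. Suppose k : ℝ × ℝ → ℝ is a C³ function which on the triangle T = {(x,y) : 0 ≤ x ≤ L, x ≤ y ≤ L} satisfies the k-kernel system with parameter λ (k_{xxx} + k_{yyy} + k_x + k_y = −λ k in T, k(x,L) = 0, k(x,x) = 0, k_x(x,x) = (λ/3)(L−x) for x ∈ [0,L]), and p : ℝ × ℝ → ℝ is a C³ function which on T satisfies the p-kernel system with parameter λ (p_{xxx} + p_{yyy} + p_x + p_y = λ p in T, p(x,x) = 0, p_x(x,x) = (λ/3)·x for x ∈ [0,L], p(0,y) = 0 for y ∈ [0,L]); set p₁(x) := p(x,L). Then for every ε with 0 < ε < λ there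 exists a constant C > 0 such that for every pair of smooth (C^∞) functions u, û : ℝ × ℝ → ℝ satisfying, for all t ≥ 0 and x ∈ [0,L]: ∂_t u + ∂_x u + ∂_x^3 u = 0; ∂_t û + ∂_x û + ∂_x^3 û + p₁(x)·(∂_x² u(t,L) − ∂_x² û(t,L)) = 0; u(t,0) = û(t,0) = ∫₀ᴸ k(0,y) û(t,y) dy; u(t,L) = ∂_x u(t,L) = 0; û(t,L) = ∂_x û(t,L) = 0; and û(0,x) = 0 for all x ∈ [0,L]; one has, for all t ≥ 0, ( ∑_{j=0}^{3} ∫₀ᴸ (∂_x^j u(t,x))² dx )^{1/2} + ( ∫₀ᴸ û(t,x)² dx )^{1/2} ≤ C e^{−(λ−ε)t} ( ∑_{j=0}^{3} ∫₀ᴸ (∂_x^j u(0,x))² dx )^{1/2}. -/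
open MeasureTheory

/-- Partial derivative in the first variable. -/
noncomputable def pdFst (U : ℝ → ℝ → ℝ) : ℝ → ℝ → ℝ := fun t x => deriv (fun s => U s x) t

/-- Partial derivative in the second variable. -/
noncomputable def pdSnd (U : ℝ → ℝ → ℝ) : ℝ → ℝ → ℝ := fun t x => deriv (fun y => U t y) x

section PartialDerivatives

variable {U : ℝ → ℝ → ℝ} {n m : WithTop ℕ∞} {t x : ℝ}

lemma hasDerivAt_slice_fst (hU : DifferentiableAt ℝ (Function.uncurry U) (t, x)) :
    HasDerivAt (fun s => U s x) (fderiv ℝ (Function.uncurry U) (t, x) (1, 0)) t := by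
  have h1 : HasDerivAt (fun s : ℝ => (s, x)) ((1 : ℝ), (0 : ℝ)) t :=
    (hasDerivAt_id t).prodMk (hasDerivAt_const t x)
  exact hU.hasFDerivAt.comp_hasDerivAt t h1

lemma hasDerivAt_slice_snd (hU : DifferentiableAt ℝ (Function.uncurry U) (t, x)) :
    HasDerivAt (fun y => U t y) (fderiv ℝ (Function.uncurry U) (t, x) (0, 1)) x := by
  have h1 : HasDerivAt (fun s : ℝ => (t, s)) ((0 : ℝ), (1 : ℝ)) x :=
    (hasDerivAt_const x t).prodMk (hasDerivAt_id x)
  exact hU.hasFDerivAt.comp_hasDerivAt x h1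

lemma uncurry_pdFst (hU : Differentiable ℝ (Function.uncurry U)) :
    Function.uncurry (pdFst U) = fun q => fderiv ℝ (Function.uncurry U) q (1, 0) := by
  ext ⟨t, x⟩
  exact (hasDerivAt_slice_fst (hU (t, x))).deriv

lemma uncurry_pdSnd (hU : Differentiable ℝ (Function.uncurry U)) :
    Function.uncurry (pdSnd U) = fun q => fderiv ℝ (Function.uncurry U) q (0, 1) := by
  ext ⟨t, x⟩
  exact (hasDerivAt_slice_snd (hU (t, x))).deriv

lemma contDiff_pdFst (hU : ContDiff ℝ n (Function.uncurry U)) (hmn : m + 1 ≤ n) :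
    ContDiff ℝ m (Function.uncurry (pdFst U)) := by
  have h1 : (1 : WithTop ℕ∞) ≤ n := le_trans (by simp) hmn
  rw [uncurry_pdFst (hU.differentiable (by intro h; simp [h] at h1))]
  exact (hU.fderiv_right hmn).clm_apply contDiff_const

lemma contDiff_pdSnd (hU : ContDiff ℝ n (Function.uncurry U)) (hmn : m + 1 ≤ n) :
    ContDiff ℝ m (Function.uncurry (pdSnd U)) := by
  have h1 : (1 : WithTop ℕ∞) ≤ n := le_trans (by simp) hmn
  rw [uncurry_pdSnd (hU.differentiable (by intro h; simp [h] at h1))]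
  exact (hU.fderiv_right hmn).clm_apply contDiff_const

lemma hasDerivAt_pdFst (hU : ContDiff ℝ 1 (Function.uncurry U)) (t x : ℝ) :
    HasDerivAt (fun s => U s x) (pdFst U t x) t :=
  (hasDerivAt_slice_fst (hU.differentiable one_ne_zero (t, x))).differentiableAt.hasDerivAt

lemma hasDerivAt_pdSnd (hU : ContDiff ℝ 1 (Function.uncurry U)) (t x : ℝ) :
    HasDerivAt (fun y => U t y) (pdSnd U t x) x :=
  (hasDerivAt_slice_snd (hU.differentiable one_ne_zero (t, x))).differentiableAt.hasDerivAt

lemma hasDerivAt_diagonal (hU : ContDiff ℝ 1 (Function.uncurry U)) (x : ℝ) :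
    HasDerivAt (fun s => U s s) (pdFst U x x + pdSnd U x x) x := by
  have hd := hU.differentiable one_ne_zero
  have h1 : HasDerivAt (fun s : ℝ => (s, s)) ((1 : ℝ), (1 : ℝ)) x :=
    (hasDerivAt_id x).prodMk (hasDerivAt_id x)
  have h2 : HasDerivAt (fun s => U s s) (fderiv ℝ (Function.uncurry U) (x, x) (1, 1)) x :=
    HasFDerivAt.comp_hasDerivAt (f := fun s : ℝ => (s, s)) x (hd (x, x)).hasFDerivAt h1
  have e1 := congrFun (uncurry_pdFst hd) (x, x)
  have e2 := congrFun (uncurry_pdSnd hd) (x, x)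
  simp only [Function.uncurry] at e1 e2
  rw [e1, e2, ← map_add]
  simpa using h2

lemma pdFst_pdSnd_comm (hU : ContDiff ℝ 2 (Function.uncurry U)) :
    pdFst (pdSnd U) = pdSnd (pdFst U) := by
  have hd := hU.differentiable two_ne_zero
  have hd2 : Differentiable ℝ (fderiv ℝ (Function.uncurry U)) :=
    (hU.fderiv_right (m := 1) (by norm_num)).differentiable one_ne_zero
  have h1 : Differentiable ℝ (Function.uncurry (pdFst U)) :=
    (contDiff_pdFst (m := 1) hU (by norm_num)).differentiable one_ne_zero
  have h2 : Differentiable ℝ (Function.uncurry (pdSnd U)) :=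
    (contDiff_pdSnd (m := 1) hU (by norm_num)).differentiable one_ne_zero
  ext t x
  have e1 := congrFun (uncurry_pdFst h2) (t, x)
  have e2 := congrFun (uncurry_pdSnd h1) (t, x)
  rw [uncurry_pdSnd hd] at e1
  rw [uncurry_pdFst hd] at e2
  simp only [Function.uncurry] at e1 e2
  have hs : IsSymmSndFDerivAt ℝ (Function.uncurry U) (t, x) :=
    (hU.contDiffAt).isSymmSndFDerivAt (by simp)
  have k1 : ∀ v : ℝ × ℝ, fderiv ℝ (fun q => fderiv ℝ (Function.uncurry U) q v) (t, x)
      = (fderiv ℝ (fderiv ℝ (Function.uncurry U)) (t, x)).flip v := by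
    intro v
    rw [fderiv_clm_apply (hd2 _) (differentiableAt_const v)]
    simp
  have e1' : pdFst (pdSnd U) t x
      = fderiv ℝ (fderiv ℝ (Function.uncurry U)) (t, x) (1, 0) (0, 1) := by
    rw [e1]; exact congrArg (fun T => T (1, 0)) (k1 (0, 1))
  have e2' : pdSnd (pdFst U) t x
      = fderiv ℝ (fderiv ℝ (Function.uncurry U)) (t, x) (0, 1) (1, 0) := by
    rw [e2]; exact congrArg (fun T => T (0, 1)) (k1 (1, 0))
  rw [e1', e2']
  exact hs _ _

lemma iteratedDeriv_slice_snd (U : ℝ → ℝ → ℝ) (j : ℕ) (t x : ℝ) :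
    iteratedDeriv j (fun y => U t y) x = (pdSnd^[j] U) t x := by
  induction j generalizing U with
  | zero => rfl
  | succ j ih =>
    rw [iteratedDeriv_succ', Function.iterate_succ_apply]
    exact ih (pdSnd U)

lemma iteratedDeriv_slice_fst (U : ℝ → ℝ → ℝ) (j : ℕ) (t x : ℝ) :
    iteratedDeriv j (fun s => U s x) t = (pdFst^[j] U) t x := by
  induction j generalizing U with
  | zero => rfl
  | succ j ih =>
    rw [iteratedDeriv_succ', Function.iterate_succ_apply]
    exact ih (pdFst U)

end PartialDerivatives

/-- Infinitely differentiable functions of two real variables. -/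
def Smooth₂ (U : ℝ → ℝ → ℝ) : Prop := ContDiff ℝ (⊤ : ℕ∞) (Function.uncurry U)

namespace Smooth₂

variable {U W : ℝ → ℝ → ℝ}

lemma fst (h : Smooth₂ U) : Smooth₂ (pdFst U) := contDiff_pdFst h (by rfl)

lemma snd (h : Smooth₂ U) : Smooth₂ (pdSnd U) := contDiff_pdSnd h (by rfl)

lemma contDiff_nat (h : Smooth₂ U) (n : ℕ) : ContDiff ℝ n (Function.uncurry U) :=
  h.of_le (by exact_mod_cast le_top)

lemma hasDerivAt_fst (h : Smooth₂ U) (t x : ℝ) : HasDerivAt (fun s => U s x) (pdFst U t x) t :=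
  hasDerivAt_pdFst (h.contDiff_nat 1) t x

lemma hasDerivAt_snd (h : Smooth₂ U) (t x : ℝ) : HasDerivAt (U t) (pdSnd U t x) x :=
  hasDerivAt_pdSnd (h.contDiff_nat 1) t x

lemma comm (h : Smooth₂ U) : pdFst (pdSnd U) = pdSnd (pdFst U) :=
  pdFst_pdSnd_comm (h.contDiff_nat 2)

lemma continuous₂ (h : Smooth₂ U) : Continuous (Function.uncurry U) := ContDiff.continuous h

lemma continuous_snd (h : Smooth₂ U) (t : ℝ) : Continuous (U t) :=
  h.continuous₂.comp (by fun_prop : Continuous fun x : ℝ => (t, x))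

lemma continuous_fst (h : Smooth₂ U) (x : ℝ) : Continuous (fun t => U t x) :=
  h.continuous₂.comp (by fun_prop : Continuous fun t : ℝ => (t, x))

lemma add (h : Smooth₂ U) (h' : Smooth₂ W) : Smooth₂ (fun t x => U t x + W t x) :=
  ContDiff.add h h'

lemma sub (h : Smooth₂ U) (h' : Smooth₂ W) : Smooth₂ (fun t x => U t x - W t x) :=
  ContDiff.sub h h'

end Smooth₂

/-- The Volterra integral `∫ₓᴸ q(x,y) f(y) dy`. -/
noncomputable def volterra (L : ℝ) (q : ℝ → ℝ → ℝ) (f : ℝ → ℝ) (x : ℝ) : ℝ :=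
  ∫ y in x..L, q x y * f y

/-- The integral of the square over `[0,L]`. -/
noncomputable def sqInt (L : ℝ) (f : ℝ → ℝ) : ℝ := ∫ x in (0 : ℝ)..L, f x ^ 2

section Volterra

variable {L : ℝ} {q : ℝ → ℝ → ℝ} {f g : ℝ → ℝ}

lemma continuous_volterra (hq : Continuous (Function.uncurry q)) (hf : Continuous f) :
    Continuous (volterra L q f) := by
  have h : volterra L q f = fun x => -∫ y in L..x, q x y * f y := by
    ext x; exact intervalIntegral.integral_symm _ _
  rw [h]
  refine (intervalIntegral.continuous_parametric_intervalIntegral_of_continuous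
    (f := fun x y => q x y * f y) ?_ continuous_id).neg
  exact hq.mul (hf.comp continuous_snd)

lemma hasDerivAt_volterra (hq : ContDiff ℝ 1 (Function.uncurry q)) (hf : Continuous f) (x : ℝ) :
    HasDerivAt (volterra L q f) (volterra L (pdFst q) f x - q x x * f x) x := by
  have hq1 : Continuous (Function.uncurry (pdFst q)) :=
    (contDiff_pdFst (m := 0) hq (by norm_num)).continuous
  set r : ℝ → ℝ → ℝ := fun z y => ∫ θ in (0 : ℝ)..1, pdFst q (x + θ * (z - x)) y with hr
  have hrc : Continuous (Function.uncurry r) := by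
    refine intervalIntegral.continuous_parametric_intervalIntegral_of_continuous
      (f := fun (w : ℝ × ℝ) θ => pdFst q (x + θ * (w.1 - x)) w.2) ?_ continuous_const
    exact hq1.comp (by fun_prop :
      Continuous fun p : (ℝ × ℝ) × ℝ => (x + p.2 * (p.1.1 - x), p.1.2))
  have hqr : ∀ z y, q z y = q x y + (z - x) * r z y := by
    intro z y
    have h1 : ∀ θ ∈ Set.uIcc (0 : ℝ) 1, HasDerivAt (fun θ => q (x + θ * (z - x)) y)
        (pdFst q (x + θ * (z - x)) y * (z - x)) θ := by
      intro θ _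
      have h2 : HasDerivAt (fun θ : ℝ => x + θ * (z - x)) (z - x) θ := by
        simpa using ((hasDerivAt_id θ).mul_const (z - x)).const_add x
      exact (hasDerivAt_pdFst hq (x + θ * (z - x)) y).comp θ h2
    have h3 := intervalIntegral.integral_eq_sub_of_hasDerivAt h1
      (Continuous.intervalIntegrable (by
        exact (hq1.comp (by fun_prop : Continuous fun θ : ℝ => (x + θ * (z - x), y))).mul
          continuous_const) _ _)
    rw [intervalIntegral.integral_mul_const] at h3
    have h4 : r z y = ∫ θ in (0 : ℝ)..1, pdFst q (x + θ * (z - x)) y := rfl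
    rw [h4, mul_comm, h3]
    simp
  have hrx : r x = pdFst q x := by
    ext y; simp [hr]
  have hsplit : volterra L q f = fun z => (∫ y in z..L, q x y * f y) + (z - x) * volterra L r f z := by
    ext z
    have i1 : IntervalIntegrable (fun y => q x y * f y) volume z L :=
      Continuous.intervalIntegrable ((hq.continuous.comp (by fun_prop :
        Continuous fun y : ℝ => (x, y))).mul hf) _ _
    have i2 : IntervalIntegrable (fun y => r z y * f y) volume z L :=
      Continuous.intervalIntegrable ((hrc.comp (by fun_prop :
        Continuous fun y : ℝ => (z, y))).mul hf) _ _
    unfold volterra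
    rw [← intervalIntegral.integral_const_mul, ← intervalIntegral.integral_add i1 (i2.const_mul _)]
    refine intervalIntegral.integral_congr fun y _ => ?_
    simp only [hqr z y]
    ring
  rw [hsplit]
  have hc : Continuous fun y => q x y * f y :=
    (hq.continuous.comp (by fun_prop : Continuous fun y : ℝ => (x, y))).mul hf
  have d1 : HasDerivAt (fun z => ∫ y in z..L, q x y * f y) (-(q x x * f x)) x :=
    intervalIntegral.integral_hasDerivAt_left (hc.intervalIntegrable _ _)
      (hc.stronglyMeasurableAtFilter _ _) hc.continuousAt
  have d2 : HasDerivAt (fun z => (z - x) * volterra L r f z) (volterra L r f x) x := by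
    have hcont : ContinuousAt (volterra L r f) x := (continuous_volterra hrc hf).continuousAt
    rw [hasDerivAt_iff_tendsto_slope]
    have : Filter.Tendsto (volterra L r f) (nhdsWithin x {x}ᶜ) (nhds (volterra L r f x)) :=
      hcont.tendsto.mono_left nhdsWithin_le_nhds
    refine this.congr' ?_
    filter_upwards [self_mem_nhdsWithin] with z hz
    have hz' : z - x ≠ 0 := sub_ne_zero.mpr hz
    simp [slope_def_field]
    field_simp
  have h5 : volterra L r f x = volterra L (pdFst q) f x := by
    unfold volterra; rw [hrx]
  rw [h5] at d2
  exact (d1.add d2).congr_deriv (by ring)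

lemma volterra_congr (h : ∀ x ∈ Set.Icc 0 L, f x = g x) {x : ℝ} (hx : x ∈ Set.Icc 0 L) :
    volterra L q f x = volterra L q g x := by
  refine intervalIntegral.integral_congr fun y hy => ?_
  rw [Set.uIcc_of_le hx.2] at hy
  simp only [h y ⟨hx.1.trans hy.1, hy.2⟩]

lemma sqInt_nonneg (hL : 0 ≤ L) : 0 ≤ sqInt L f :=
  intervalIntegral.integral_nonneg hL fun _ _ => sq_nonneg _

lemma sqInt_congr (hL : 0 ≤ L) (h : ∀ x ∈ Set.Icc 0 L, f x = g x) : sqInt L f = sqInt L g := by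
  refine intervalIntegral.integral_congr fun y hy => ?_
  rw [Set.uIcc_of_le hL] at hy
  simp only [h y hy]

lemma sqInt_le_of_abs_le (hL : 0 ≤ L) (hf : Continuous f) {M : ℝ}
    (h : ∀ x ∈ Set.Icc 0 L, f x ^ 2 ≤ M) : sqInt L f ≤ L * M := by
  have := intervalIntegral.integral_mono_on (μ := volume) hL
    ((hf.pow 2).intervalIntegrable 0 L) (intervalIntegrable_const (c := M)) h
  simpa [sqInt] using this

lemma sqInt_mono (hL : 0 ≤ L) (hf : Continuous f) (hg : Continuous g)
    (h : ∀ x ∈ Set.Icc 0 L, f x ^ 2 ≤ g x ^ 2) : sqInt L f ≤ sqInt L g :=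
  intervalIntegral.integral_mono_on hL ((hf.pow 2).intervalIntegrable 0 L)
    ((hg.pow 2).intervalIntegrable 0 L) h

lemma sqInt_add_le (hL : 0 ≤ L) (hf : Continuous f) (hg : Continuous g) :
    sqInt L (fun x => f x + g x) ≤ 2 * sqInt L f + 2 * sqInt L g := by
  unfold sqInt
  have cf : Continuous fun x => f x ^ 2 := hf.pow 2
  have cg : Continuous fun x => g x ^ 2 := hg.pow 2
  rw [← intervalIntegral.integral_const_mul, ← intervalIntegral.integral_const_mul,
    ← intervalIntegral.integral_add ((cf.intervalIntegrable _ _).const_mul _)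
      ((cg.intervalIntegrable _ _).const_mul _)]
  refine intervalIntegral.integral_mono_on hL (((hf.add hg).pow 2).intervalIntegrable 0 L)
    (((cf.intervalIntegrable _ _).const_mul _).add ((cg.intervalIntegrable _ _).const_mul _)) ?_
  intro x _
  nlinarith [sq_nonneg (f x - g x)]

lemma sqInt_neg : sqInt L (fun x => -f x) = sqInt L f := by
  unfold sqInt; simp

lemma sqInt_sub_le (hL : 0 ≤ L) (hf : Continuous f) (hg : Continuous g) :
    sqInt L (fun x => f x - g x) ≤ 2 * sqInt L f + 2 * sqInt L g := by
  have h := sqInt_add_le hL hf (g := fun x => -g x) hg.neg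
  rw [sqInt_neg] at h
  simpa only [sub_eq_add_neg] using h

lemma sqInt_const_mul (c : ℝ) : sqInt L (fun x => c * f x) = c ^ 2 * sqInt L f := by
  unfold sqInt
  rw [← intervalIntegral.integral_const_mul]
  simp [mul_pow]

lemma sqInt_reflect : sqInt L (fun x => f (L - x)) = sqInt L f := by
  unfold sqInt
  have := intervalIntegral.integral_comp_sub_left (a := 0) (b := L) (fun x => f x ^ 2) L
  simpa using this

lemma exists_abs_le_Icc {a : ℝ → ℝ} (L : ℝ) (ha : Continuous a) :
    ∃ M : ℝ, 0 ≤ M ∧ ∀ x ∈ Set.Icc 0 L, |a x| ≤ M := by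
  obtain ⟨C, hC⟩ := (isCompact_Icc (a := (0 : ℝ)) (b := L)).exists_bound_of_continuousOn
    ha.continuousOn
  exact ⟨max C 0, le_max_right _ _, fun x hx => (hC x hx).trans (le_max_left _ _)⟩

lemma exists_abs_le_square (L : ℝ) (hq : Continuous (Function.uncurry q)) :
    ∃ M : ℝ, 0 ≤ M ∧ ∀ x ∈ Set.Icc 0 L, ∀ y ∈ Set.Icc 0 L, |q x y| ≤ M := by
  obtain ⟨C, hC⟩ := ((isCompact_Icc (a := (0 : ℝ)) (b := L)).prod
    (isCompact_Icc (a := (0 : ℝ)) (b := L))).exists_bound_of_continuousOn hq.continuousOn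
  exact ⟨max C 0, le_max_right _ _, fun x hx y hy =>
    (hC (x, y) ⟨hx, hy⟩).trans (le_max_left _ _)⟩

/-- Multiplication by a continuous function is bounded for the `L²` norm. -/
lemma exists_sqInt_mul_le {a : ℝ → ℝ} (hL : 0 ≤ L) (ha : Continuous a) :
    ∃ C : ℝ, 0 ≤ C ∧ ∀ f : ℝ → ℝ, Continuous f →
      sqInt L (fun x => a x * f x) ≤ C * sqInt L f := by
  obtain ⟨M, hM, h⟩ := exists_abs_le_Icc L ha
  refine ⟨M ^ 2, by positivity, fun f hf => ?_⟩
  rw [← sqInt_const_mul]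
  refine sqInt_mono hL (ha.mul hf) (continuous_const.mul hf) fun x hx => ?_
  have h1 : a x ^ 2 ≤ M ^ 2 := sq_le_sq' (by linarith [abs_le.mp (h x hx)]) (abs_le.mp (h x hx)).2
  have := mul_le_mul_of_nonneg_right h1 (sq_nonneg (f x))
  nlinarith

lemma sq_integral_le {a b : ℝ} (hab : a ≤ b) (hf : Continuous f) :
    (∫ x in a..b, f x) ^ 2 ≤ (b - a) * ∫ x in a..b, f x ^ 2 := by
  rcases hab.eq_or_lt with rfl | hlt
  · simp
  set m := (∫ x in a..b, f x) / (b - a) with hm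
  have hba : 0 < b - a := sub_pos.mpr hlt
  have h0 : 0 ≤ ∫ x in a..b, (f x - m) ^ 2 :=
    intervalIntegral.integral_nonneg hab fun _ _ => sq_nonneg _
  have h1 : ∫ x in a..b, (f x - m) ^ 2
      = (∫ x in a..b, f x ^ 2) - 2 * m * (∫ x in a..b, f x) + (b - a) * m ^ 2 := by
    have i1 : IntervalIntegrable (fun x => f x ^ 2) volume a b := (hf.pow 2).intervalIntegrable _ _
    have i2 : IntervalIntegrable (fun x => 2 * m * f x) volume a b :=
      (continuous_const.mul hf).intervalIntegrable _ _
    rw [← intervalIntegral.integral_const_mul, ← intervalIntegral.integral_sub i1 i2,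
      ← smul_eq_mul (b - a), ← intervalIntegral.integral_const,
      ← intervalIntegral.integral_add (i1.sub i2) intervalIntegrable_const]
    refine intervalIntegral.integral_congr fun x _ => ?_
    ring
  have h2 : ∫ x in a..b, f x = m * (b - a) := by rw [hm]; field_simp
  rw [h2] at h1 ⊢
  have h3 : (b - a) * (∫ x in a..b, f x ^ 2) - (m * (b - a)) ^ 2
      = (b - a) * ∫ x in a..b, (f x - m) ^ 2 := by rw [h1]; ring
  have := mul_nonneg hba.le h0
  linarith

/-- A Volterra integral is pointwise controlled by the `L²` norm. -/
lemma exists_volterra_sq_le (hL : 0 ≤ L) (hq : Continuous (Function.uncurry q)) :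
    ∃ C : ℝ, 0 ≤ C ∧ ∀ f : ℝ → ℝ, Continuous f → ∀ x ∈ Set.Icc 0 L,
      volterra L q f x ^ 2 ≤ C * sqInt L f := by
  obtain ⟨M, hM, h⟩ := exists_abs_le_square L hq
  refine ⟨L * M ^ 2, by positivity, fun f hf x hx => ?_⟩
  have hc : Continuous fun y => q x y * f y :=
    (hq.comp (by fun_prop : Continuous fun y : ℝ => (x, y))).mul hf
  have h1 := sq_integral_le hx.2 hc
  have h2 : ∫ y in x..L, (q x y * f y) ^ 2 ≤ ∫ y in x..L, M ^ 2 * f y ^ 2 := by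
    refine intervalIntegral.integral_mono_on hx.2 ((hc.pow 2).intervalIntegrable _ _)
      ((continuous_const.mul (hf.pow 2)).intervalIntegrable _ _) fun y hy => ?_
    have hb := abs_le.mp (h x hx y ⟨hx.1.trans hy.1, hy.2⟩)
    have h1 : q x y ^ 2 ≤ M ^ 2 := sq_le_sq' hb.1 hb.2
    have := mul_le_mul_of_nonneg_right h1 (sq_nonneg (f y))
    nlinarith
  have h3 : ∫ y in x..L, M ^ 2 * f y ^ 2 ≤ ∫ y in (0 : ℝ)..L, M ^ 2 * f y ^ 2 := by
    have hc2 : Continuous fun y => M ^ 2 * f y ^ 2 := continuous_const.mul (hf.pow 2)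
    rw [← intervalIntegral.integral_add_adjacent_intervals (hc2.intervalIntegrable 0 x)
      (hc2.intervalIntegrable x L)]
    have : 0 ≤ ∫ y in (0 : ℝ)..x, M ^ 2 * f y ^ 2 :=
      intervalIntegral.integral_nonneg hx.1 fun _ _ => by positivity
    linarith
  have h4 : 0 ≤ ∫ y in x..L, (q x y * f y) ^ 2 :=
    intervalIntegral.integral_nonneg hx.2 fun _ _ => sq_nonneg _
  have h5 : (L - x) * ∫ y in x..L, (q x y * f y) ^ 2 ≤ L * ∫ y in x..L, (q x y * f y) ^ 2 :=
    mul_le_mul_of_nonneg_right (by linarith [hx.1]) h4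
  have h6 := mul_le_mul_of_nonneg_left (h2.trans h3) hL
  calc volterra L q f x ^ 2 ≤ _ := h1
    _ ≤ _ := h5
    _ ≤ _ := h6
    _ = L * M ^ 2 * sqInt L f := by
      rw [intervalIntegral.integral_const_mul, mul_assoc]; rfl

lemma exists_sqInt_volterra_le (hL : 0 ≤ L) (hq : Continuous (Function.uncurry q)) :
    ∃ C : ℝ, 0 ≤ C ∧ ∀ f : ℝ → ℝ, Continuous f →
      sqInt L (volterra L q f) ≤ C * sqInt L f := by
  obtain ⟨C, hC, h⟩ := exists_volterra_sq_le hL hq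
  refine ⟨L * C, by positivity, fun f hf => ?_⟩
  rw [mul_assoc]
  exact sqInt_le_of_abs_le hL (continuous_volterra hq hf) (h f hf)

end Volterra

/-- `f₁, f₂, f₃` are the successive derivatives of `f₀` on `(0,L)`; all are continuous. -/
structure DerivChain (L : ℝ) (f₀ f₁ f₂ f₃ : ℝ → ℝ) : Prop where
  c₀ : Continuous f₀
  c₁ : Continuous f₁
  c₂ : Continuous f₂
  c₃ : Continuous f₃
  d₀ : ∀ x ∈ Set.Ioo 0 L, HasDerivAt f₀ (f₁ x) x
  d₁ : ∀ x ∈ Set.Ioo 0 L, HasDerivAt f₁ (f₂ x) x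
  d₂ : ∀ x ∈ Set.Ioo 0 L, HasDerivAt f₂ (f₃ x) x

lemma Smooth₂.derivChain {U : ℝ → ℝ → ℝ} (h : Smooth₂ U) (L t : ℝ) :
    DerivChain L (U t) (pdSnd U t) (pdSnd (pdSnd U) t) (pdSnd (pdSnd (pdSnd U)) t) where
  c₀ := h.continuous_snd t
  c₁ := h.snd.continuous_snd t
  c₂ := h.snd.snd.continuous_snd t
  c₃ := h.snd.snd.snd.continuous_snd t
  d₀ x _ := h.hasDerivAt_snd t x
  d₁ x _ := h.snd.hasDerivAt_snd t x
  d₂ x _ := h.snd.snd.hasDerivAt_snd t x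

lemma eq_on_Icc_of_eq_on_Ioo {L : ℝ} (hL : 0 < L) {F G : ℝ → ℝ} (hF : Continuous F)
    (hG : Continuous G) (h : ∀ x ∈ Set.Ioo 0 L, F x = G x) : ∀ x ∈ Set.Icc 0 L, F x = G x := by
  have h1 : Set.EqOn F G (closure (Set.Ioo 0 L)) :=
    Set.EqOn.closure h hF hG
  rw [closure_Ioo hL.ne] at h1
  exact h1

lemma hasDerivAt_eq_of_eq_on {L : ℝ} {F G : ℝ → ℝ} {a b x : ℝ} (hx : x ∈ Set.Ioo 0 L)
    (h : ∀ x ∈ Set.Icc 0 L, F x = G x) (hF : HasDerivAt F a x) (hG : HasDerivAt G b x) :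
    a = b := by
  have he : F =ᶠ[nhds x] G := by
    filter_upwards [Icc_mem_nhds hx.1 hx.2] with y hy using h y hy
  exact hF.unique (hG.congr_of_eventuallyEq he)

/-- The backstepping kernel equations on the triangle `0 ≤ x ≤ y ≤ L`. -/
structure BackstepKernel (L μ d : ℝ) (q : ℝ → ℝ → ℝ) : Prop where
  smooth : ContDiff ℝ 3 (Function.uncurry q)
  pde : ∀ x y, 0 ≤ x → x ≤ y → y ≤ L →
    pdFst (pdFst (pdFst q)) x y + pdSnd (pdSnd (pdSnd q)) x y + pdFst q x y + pdSnd q x y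
      = μ * q x y
  diag : ∀ x ∈ Set.Icc 0 L, q x x = 0
  slope : ∀ x ∈ Set.Icc 0 L, pdFst q x x = μ / 3 * x + d

/-- Second derivative of the Volterra integral with a backstepping kernel. -/
noncomputable def volterraD₂ (L μ d : ℝ) (q : ℝ → ℝ → ℝ) (f₀ : ℝ → ℝ) (x : ℝ) : ℝ :=
  volterra L (pdFst (pdFst q)) f₀ x - (μ / 3 * x + d) * f₀ x

/-- Third derivative of the Volterra integral with a backstepping kernel. -/
noncomputable def volterraD₃ (L μ d : ℝ) (q : ℝ → ℝ → ℝ) (f₀ f₁ : ℝ → ℝ) (x : ℝ) : ℝ :=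
  volterra L (pdFst (pdFst (pdFst q))) f₀ x - pdFst (pdFst q) x x * f₀ x
    - (μ / 3 * f₀ x + (μ / 3 * x + d) * f₁ x)

lemma volterra_deriv_eq {L : ℝ} {q : ℝ → ℝ → ℝ} {f f' : ℝ → ℝ}
    (hq : ContDiff ℝ 1 (Function.uncurry q)) (hf : Continuous f) (hf' : Continuous f')
    (hd : ∀ x ∈ Set.Ioo 0 L, HasDerivAt f (f' x) x) {x : ℝ} (hx : x ∈ Set.Icc 0 L) :
    volterra L q f' x = q x L * f L - q x x * f x - volterra L (pdSnd q) f x := by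
  have hc : Continuous fun y => q x y :=
    hq.continuous.comp (by fun_prop : Continuous fun y : ℝ => (x, y))
  have hc' : Continuous fun y => pdSnd q x y :=
    (contDiff_pdSnd (m := 0) hq (by norm_num)).continuous.comp
      (by fun_prop : Continuous fun y : ℝ => (x, y))
  refine intervalIntegral.integral_mul_deriv_eq_deriv_mul_of_hasDerivAt
    hc.continuousOn hf.continuousOn (fun y _ => hasDerivAt_pdSnd hq x y) (fun y hy => ?_)
    (hc'.intervalIntegrable _ _) (hf'.intervalIntegrable _ _)
  rw [min_eq_left hx.2, max_eq_right hx.2] at hy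
  exact hd y ⟨hx.1.trans_lt hy.1, hy.2⟩

namespace BackstepKernel

variable {L μ d : ℝ} {q : ℝ → ℝ → ℝ} {f₀ f₁ f₂ f₃ : ℝ → ℝ}

lemma smooth₁ (hq : BackstepKernel L μ d q) : ContDiff ℝ 2 (Function.uncurry (pdFst q)) :=
  contDiff_pdFst hq.smooth (by norm_num)

lemma smooth₁₁ (hq : BackstepKernel L μ d q) :
    ContDiff ℝ 1 (Function.uncurry (pdFst (pdFst q))) :=
  contDiff_pdFst hq.smooth₁ (by norm_num)

lemma continuous₁₁₁ (hq : BackstepKernel L μ d q) :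
    Continuous (Function.uncurry (pdFst (pdFst (pdFst q)))) :=
  (contDiff_pdFst (m := 0) hq.smooth₁₁ (by norm_num)).continuous

lemma smooth₂ (hq : BackstepKernel L μ d q) : ContDiff ℝ 2 (Function.uncurry (pdSnd q)) :=
  contDiff_pdSnd hq.smooth (by norm_num)

lemma smooth₂₂ (hq : BackstepKernel L μ d q) :
    ContDiff ℝ 1 (Function.uncurry (pdSnd (pdSnd q))) :=
  contDiff_pdSnd hq.smooth₂ (by norm_num)

lemma continuous₂₂₂ (hq : BackstepKernel L μ d q) :
    Continuous (Function.uncurry (pdSnd (pdSnd (pdSnd q)))) :=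
  (contDiff_pdSnd (m := 0) hq.smooth₂₂ (by norm_num)).continuous

lemma continuous_diag₁₁ (hq : BackstepKernel L μ d q) :
    Continuous fun x => pdFst (pdFst q) x x :=
  hq.smooth₁₁.continuous.comp (by fun_prop : Continuous fun x : ℝ => (x, x))

lemma continuous_volterraD₂ (hq : BackstepKernel L μ d q) (hf : Continuous f₀) :
    Continuous (volterraD₂ L μ d q f₀) :=
  (continuous_volterra hq.smooth₁₁.continuous hf).sub (by fun_prop)

lemma continuous_volterraD₃ (hq : BackstepKernel L μ d q) (hf : Continuous f₀)
    (hf₁ : Continuous f₁) : Continuous (volterraD₃ L μ d q f₀ f₁) :=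
  ((continuous_volterra hq.continuous₁₁₁ hf).sub (hq.continuous_diag₁₁.mul hf)).sub (by fun_prop)

/-- Derivatives of a Volterra integral with a backstepping kernel. -/
lemma derivChain_volterra (hq : BackstepKernel L μ d q) (c₀ : Continuous f₀) (c₁ : Continuous f₁)
    (d₀ : ∀ x ∈ Set.Ioo 0 L, HasDerivAt f₀ (f₁ x) x) :
    DerivChain L (volterra L q f₀) (volterra L (pdFst q) f₀) (volterraD₂ L μ d q f₀)
      (volterraD₃ L μ d q f₀ f₁) where
  c₀ := continuous_volterra hq.smooth.continuous c₀
  c₁ := continuous_volterra hq.smooth₁.continuous c₀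
  c₂ := hq.continuous_volterraD₂ c₀
  c₃ := hq.continuous_volterraD₃ c₀ c₁
  d₀ x hx := by
    have h := hasDerivAt_volterra (L := L) (hq.smooth.of_le (by norm_num)) c₀ x
    simpa [hq.diag x (Set.Ioo_subset_Icc_self hx)] using h
  d₁ x hx := by
    have h := hasDerivAt_volterra (L := L) (hq.smooth₁.of_le (by norm_num)) c₀ x
    rwa [hq.slope x (Set.Ioo_subset_Icc_self hx)] at h
  d₂ x hx := by
    have h := hasDerivAt_volterra (L := L) hq.smooth₁₁ c₀ x
    have h1 : HasDerivAt (fun x : ℝ => μ / 3 * x + d) (μ / 3) x := by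
      simpa using ((hasDerivAt_id x).const_mul (μ / 3)).add_const d
    exact h.sub (h1.mul (d₀ x hx))

lemma diag_first (hq : BackstepKernel L μ d q) {x : ℝ} (hx : x ∈ Set.Ioo 0 L) :
    pdFst q x x + pdSnd q x x = 0 :=
  hasDerivAt_eq_of_eq_on hx hq.diag (hasDerivAt_diagonal (hq.smooth.of_le (by norm_num)) x)
    (hasDerivAt_const x 0)

lemma diag_second (hq : BackstepKernel L μ d q) (hL : 0 < L) {x : ℝ} (hx : x ∈ Set.Ioo 0 L) :
    pdFst (pdFst q) x x - pdSnd (pdSnd q) x x = 2 * μ / 3 := by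
  have h1 : HasDerivAt (fun x : ℝ => μ / 3 * x + d) (μ / 3) x := by
    simpa using ((hasDerivAt_id x).const_mul (μ / 3)).add_const d
  have e1 := hasDerivAt_eq_of_eq_on hx hq.slope
    (hasDerivAt_diagonal (hq.smooth₁.of_le (by norm_num)) x) h1
  have hs : ∀ x ∈ Set.Icc 0 L, pdSnd q x x = -(μ / 3 * x + d) := by
    refine eq_on_Icc_of_eq_on_Ioo hL
      (hq.smooth₂.continuous.comp (by fun_prop : Continuous fun x : ℝ => (x, x)))
      (by fun_prop) fun y hy => ?_
    have := hq.diag_first hy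
    rw [hq.slope y (Set.Ioo_subset_Icc_self hy)] at this
    linarith
  have e2 := hasDerivAt_eq_of_eq_on hx hs
    (hasDerivAt_diagonal (hq.smooth₂.of_le (by norm_num)) x) h1.neg
  rw [pdFst_pdSnd_comm (hq.smooth.of_le (by norm_num))] at e2
  linarith

/-- The intertwining identity between a Volterra integral and `∂ₓ + ∂ₓ³`. -/
lemma intertwine (hq : BackstepKernel L μ d q) (hL : 0 < L) (hf : DerivChain L f₀ f₁ f₂ f₃) :
    ∀ x ∈ Set.Icc 0 L,
      volterra L q (fun y => f₁ y + f₃ y) x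
        = volterra L (pdFst q) f₀ x + volterraD₃ L μ d q f₀ f₁ x - μ * volterra L q f₀ x + μ * f₀ x
          + q x L * (f₀ L + f₂ L) - pdSnd q x L * f₁ L + pdSnd (pdSnd q) x L * f₀ L := by
  have hL1 : Continuous fun x : ℝ => (x, L) := by fun_prop
  have k0 : Continuous fun x => q x L := hq.smooth.continuous.comp hL1
  have k1 : Continuous fun x => pdSnd q x L := hq.smooth₂.continuous.comp hL1
  have k2 : Continuous fun x => pdSnd (pdSnd q) x L := hq.smooth₂₂.continuous.comp hL1
  refine eq_on_Icc_of_eq_on_Ioo hL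
    (continuous_volterra hq.smooth.continuous (hf.c₁.add hf.c₃)) ?_ fun x hx => ?_
  · have a1 := continuous_volterra (L := L) hq.smooth₁.continuous hf.c₀
    have a2 := hq.continuous_volterraD₃ hf.c₀ hf.c₁
    have a3 := continuous_volterra (L := L) hq.smooth.continuous hf.c₀
    have a4 := hf.c₀
    fun_prop
  have hx' := Set.Ioo_subset_Icc_self hx
  have hcint : ∀ {r : ℝ → ℝ → ℝ} {f : ℝ → ℝ}, Continuous (Function.uncurry r) → Continuous f →
      IntervalIntegrable (fun y => r x y * f y) volume x L := fun hr hf =>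
    Continuous.intervalIntegrable
      ((hr.comp (by fun_prop : Continuous fun y : ℝ => (x, y))).mul hf) _ _
  have s1 : volterra L q (fun y => f₁ y + f₃ y) x = volterra L q f₁ x + volterra L q f₃ x := by
    unfold volterra
    rw [← intervalIntegral.integral_add (hcint hq.smooth.continuous hf.c₁)
      (hcint hq.smooth.continuous hf.c₃)]
    exact intervalIntegral.integral_congr fun y _ => mul_add _ _ _
  have e1 := volterra_deriv_eq (hq.smooth.of_le (by norm_num)) hf.c₀ hf.c₁ hf.d₀ hx'
  have e2 := volterra_deriv_eq (hq.smooth.of_le (by norm_num)) hf.c₂ hf.c₃ hf.d₂ hx'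
  have e3 := volterra_deriv_eq (hq.smooth₂.of_le (by norm_num)) hf.c₁ hf.c₂ hf.d₁ hx'
  have e4 := volterra_deriv_eq hq.smooth₂₂ hf.c₀ hf.c₁ hf.d₀ hx'
  have e5 : volterra L (pdFst (pdFst (pdFst q))) f₀ x + volterra L (pdSnd (pdSnd (pdSnd q))) f₀ x
      + volterra L (pdFst q) f₀ x + volterra L (pdSnd q) f₀ x = μ * volterra L q f₀ x := by
    unfold volterra
    have i1 := hcint hq.continuous₁₁₁ hf.c₀
    have i2 := hcint hq.continuous₂₂₂ hf.c₀
    have i3 := hcint hq.smooth₁.continuous hf.c₀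
    have i4 := hcint hq.smooth₂.continuous hf.c₀
    rw [← intervalIntegral.integral_add i1 i2, ← intervalIntegral.integral_add (i1.add i2) i3,
      ← intervalIntegral.integral_add ((i1.add i2).add i3) i4,
      ← intervalIntegral.integral_const_mul]
    refine intervalIntegral.integral_congr fun y hy => ?_
    rw [Set.uIcc_of_le hx'.2] at hy
    have := hq.pde x y hx'.1 hy.1 hy.2
    linear_combination f₀ y * this
  have g1 := hq.diag_first hx
  have g2 := hq.diag_second hL hx
  have g3 := hq.slope x hx'
  rw [hq.diag x hx'] at e1 e2
  rw [s1, e1, e2, e3, e4]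
  unfold volterraD₃
  linear_combination (-1 : ℝ) * e5 + f₁ x * g1 + f₀ x * g2 - f₁ x * g3

end BackstepKernel

/-- Restriction of a continuous function to `[0,L]`. -/
def restrictIcc (L : ℝ) (f : ℝ → ℝ) (hf : Continuous f) : C(Set.Icc (0 : ℝ) L, ℝ) :=
  ⟨fun x => f x, hf.comp continuous_subtype_val⟩

/-- Extension of a continuous function on `[0,L]` by constants. -/
noncomputable def extendIcc {L : ℝ} (hL : 0 ≤ L) (f : C(Set.Icc (0 : ℝ) L, ℝ)) : ℝ → ℝ :=
  Set.IccExtend hL f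

section ContinuousFunctions

variable {L : ℝ} {q : ℝ → ℝ → ℝ}

lemma continuous_extendIcc (hL : 0 ≤ L) (f : C(Set.Icc (0 : ℝ) L, ℝ)) :
    Continuous (extendIcc hL f) :=
  f.continuous.Icc_extend'

lemma extendIcc_of_mem (hL : 0 ≤ L) (f : C(Set.Icc (0 : ℝ) L, ℝ)) {x : ℝ}
    (hx : x ∈ Set.Icc 0 L) : extendIcc hL f x = f ⟨x, hx⟩ :=
  Set.IccExtend_of_mem hL f hx

lemma extendIcc_restrictIcc (hL : 0 ≤ L) {f : ℝ → ℝ} (hf : Continuous f) {x : ℝ}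
    (hx : x ∈ Set.Icc 0 L) : extendIcc hL (restrictIcc L f hf) x = f x :=
  extendIcc_of_mem hL _ hx

lemma ext_extendIcc (hL : 0 ≤ L) {f g : C(Set.Icc (0 : ℝ) L, ℝ)}
    (h : ∀ x ∈ Set.Icc 0 L, extendIcc hL f x = extendIcc hL g x) : f = g := by
  ext ⟨x, hx⟩
  simpa only [extendIcc_of_mem hL _ hx] using h x hx

lemma extendIcc_add (hL : 0 ≤ L) (f g : C(Set.Icc (0 : ℝ) L, ℝ)) (x : ℝ) :
    extendIcc hL (f + g) x = extendIcc hL f x + extendIcc hL g x := rfl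

lemma extendIcc_sub (hL : 0 ≤ L) (f g : C(Set.Icc (0 : ℝ) L, ℝ)) (x : ℝ) :
    extendIcc hL (f - g) x = extendIcc hL f x - extendIcc hL g x := rfl

lemma extendIcc_smul (hL : 0 ≤ L) (c : ℝ) (f : C(Set.Icc (0 : ℝ) L, ℝ)) (x : ℝ) :
    extendIcc hL (c • f) x = c * extendIcc hL f x := rfl

lemma abs_extendIcc_le (hL : 0 ≤ L) (f : C(Set.Icc (0 : ℝ) L, ℝ)) (x : ℝ) :
    |extendIcc hL f x| ≤ ‖f‖ :=
  f.norm_coe_le_norm _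

/-- Integration against a continuous weight, as a continuous linear functional. -/
noncomputable def weightedIntegral (hL : 0 ≤ L) (w : ℝ → ℝ) (hw : Continuous w) :
    C(Set.Icc (0 : ℝ) L, ℝ) →L[ℝ] ℝ :=
  LinearMap.mkContinuousOfExistsBound
    { toFun := fun f => ∫ x in (0 : ℝ)..L, w x * extendIcc hL f x
      map_add' := fun f g => by
        have hi : ∀ f, IntervalIntegrable (fun x => w x * extendIcc hL f x) volume 0 L :=
          fun f => (hw.mul (continuous_extendIcc hL f)).intervalIntegrable _ _
        rw [← intervalIntegral.integral_add (hi f) (hi g)]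
        exact intervalIntegral.integral_congr fun x _ => by
          simp only [extendIcc_add, mul_add]
      map_smul' := fun c f => by
        rw [RingHom.id_apply, smul_eq_mul, ← intervalIntegral.integral_const_mul]
        exact intervalIntegral.integral_congr fun x _ => by
          simp only [extendIcc_smul]; ring }
    (by
      obtain ⟨M, hM, h⟩ := exists_abs_le_Icc L hw
      refine ⟨M * L, fun f => ?_⟩
      have := intervalIntegral.norm_integral_le_of_norm_le_const (a := (0 : ℝ)) (b := L)
        (f := fun x => w x * extendIcc hL f x) (C := M * ‖f‖) (fun x hx => by
          rw [Set.uIoc_of_le hL] at hx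
          rw [Real.norm_eq_abs, abs_mul]
          exact mul_le_mul (h x ⟨hx.1.le, hx.2⟩) (abs_extendIcc_le hL f x) (abs_nonneg _) hM)
      rw [sub_zero, abs_of_nonneg hL] at this
      exact this.trans_eq (by ring))

lemma weightedIntegral_apply (hL : 0 ≤ L) {w : ℝ → ℝ} (hw : Continuous w)
    (f : C(Set.Icc (0 : ℝ) L, ℝ)) :
    weightedIntegral hL w hw f = ∫ x in (0 : ℝ)..L, w x * extendIcc hL f x := rfl

/-- The Volterra operator on continuous functions. -/
noncomputable def volterraOp (hL : 0 ≤ L) (q : ℝ → ℝ → ℝ) (hq : Continuous (Function.uncurry q)) :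
    C(Set.Icc (0 : ℝ) L, ℝ) →L[ℝ] C(Set.Icc (0 : ℝ) L, ℝ) :=
  LinearMap.mkContinuousOfExistsBound
    { toFun := fun f => restrictIcc L (volterra L q (extendIcc hL f))
        (continuous_volterra hq (continuous_extendIcc hL f))
      map_add' := fun f g => by
        ext x
        have hc : Continuous fun y => q x y :=
          hq.comp (by fun_prop : Continuous fun y : ℝ => ((x : ℝ), y))
        change volterra L q _ x = volterra L q _ x + volterra L q _ x
        unfold volterra
        have hi : ∀ f, IntervalIntegrable (fun y => q x y * extendIcc hL f y) volume x L :=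
          fun f => (hc.mul (continuous_extendIcc hL f)).intervalIntegrable _ _
        rw [← intervalIntegral.integral_add (hi f) (hi g)]
        exact intervalIntegral.integral_congr fun x _ => by
          simp only [extendIcc_add, mul_add]
      map_smul' := fun c f => by
        ext x
        change volterra L q _ x = c * volterra L q _ x
        unfold volterra
        rw [← intervalIntegral.integral_const_mul]
        exact intervalIntegral.integral_congr fun x _ => by
          simp only [extendIcc_smul]; ring }
    (by
      obtain ⟨M, hM, h⟩ := exists_abs_le_square L hq
      refine ⟨M * L, fun f => ?_⟩
      rw [ContinuousMap.norm_le _ (by positivity)]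
      rintro ⟨x, hx⟩
      change |∫ y in x..L, q x y * extendIcc hL f y| ≤ M * L * ‖f‖
      have := intervalIntegral.norm_integral_le_of_norm_le_const (a := x) (b := L)
        (f := fun y => q x y * extendIcc hL f y) (C := M * ‖f‖) (fun y hy => by
          rw [Set.uIoc_of_le hx.2] at hy
          rw [Real.norm_eq_abs, abs_mul]
          exact mul_le_mul (h x hx y ⟨hx.1.trans hy.1.le, hy.2⟩) (abs_extendIcc_le hL f y)
            (abs_nonneg _) hM)
      rw [abs_of_nonneg (by linarith [hx.2])] at this
      refine this.trans ?_
      have h2 : M * ‖f‖ * (L - x) ≤ M * ‖f‖ * L :=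
        mul_le_mul_of_nonneg_left (by linarith [hx.1]) (by positivity)
      linarith)

lemma extendIcc_volterraOp (hL : 0 ≤ L) (hq : Continuous (Function.uncurry q))
    (f : C(Set.Icc (0 : ℝ) L, ℝ)) {x : ℝ} (hx : x ∈ Set.Icc 0 L) :
    extendIcc hL (volterraOp hL q hq f) x = volterra L q (extendIcc hL f) x :=
  extendIcc_of_mem hL _ hx

lemma abs_volterraOp_pow_le (hL : 0 ≤ L) (hq : Continuous (Function.uncurry q)) {M : ℝ}
    (hM : 0 ≤ M) (h : ∀ x ∈ Set.Icc 0 L, ∀ y ∈ Set.Icc 0 L, |q x y| ≤ M)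
    (f : C(Set.Icc (0 : ℝ) L, ℝ)) (n : ℕ) :
    ∀ x ∈ Set.Icc 0 L, |extendIcc hL ((volterraOp hL q hq ^ n) f) x|
      ≤ M ^ n * ‖f‖ * ((L - x) ^ n / n.factorial) := by
  induction n with
  | zero => intro x _; simpa using abs_extendIcc_le hL f x
  | succ n ih =>
    intro x hx
    rw [pow_succ', mul_apply_eq_comp, extendIcc_volterraOp hL hq _ hx]
    have h1 : |∫ y in x..L, q x y * extendIcc hL ((volterraOp hL q hq ^ n) f) y|
        ≤ ∫ y in x..L, M ^ (n + 1) * ‖f‖ / n.factorial * (L - y) ^ n := by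
      rw [← Real.norm_eq_abs]
      refine intervalIntegral.norm_integral_le_of_norm_le hx.2 ?_
        (Continuous.intervalIntegrable (by fun_prop) _ _)
      refine Filter.Eventually.of_forall fun y hy => ?_
      have hy' : y ∈ Set.Icc 0 L := ⟨hx.1.trans hy.1.le, hy.2⟩
      rw [Real.norm_eq_abs, abs_mul]
      calc _ ≤ M * (M ^ n * ‖f‖ * ((L - y) ^ n / n.factorial)) :=
            mul_le_mul (h x hx y hy') (ih y hy') (abs_nonneg _) hM
        _ = _ := by ring
    refine h1.trans_eq ?_
    rw [intervalIntegral.integral_const_mul,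
      intervalIntegral.integral_comp_sub_left (fun y => y ^ n) L, integral_pow,
      Nat.factorial_succ]
    push_cast
    have : (n.factorial : ℝ) ≠ 0 := by positivity
    field_simp
    simp

lemma norm_volterraOp_pow_le (hL : 0 ≤ L) (hq : Continuous (Function.uncurry q)) {M : ℝ}
    (hM : 0 ≤ M) (h : ∀ x ∈ Set.Icc 0 L, ∀ y ∈ Set.Icc 0 L, |q x y| ≤ M) (n : ℕ) :
    ‖volterraOp hL q hq ^ n‖ ≤ (M * L) ^ n / n.factorial := by
  have h0 : 0 ≤ (M * L) ^ n / n.factorial := by positivity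
  refine ContinuousLinearMap.opNorm_le_bound _ h0 fun f => ?_
  refine (ContinuousMap.norm_le _ (mul_nonneg h0 (norm_nonneg f))).2 ?_
  rintro ⟨x, hx⟩
  have h1 := abs_volterraOp_pow_le hL hq hM h f n x hx
  rw [extendIcc_of_mem hL _ hx] at h1
  refine h1.trans ?_
  have h2 : (L - x) ^ n ≤ L ^ n :=
    pow_le_pow_left₀ (by linarith [hx.2]) (by linarith [hx.1]) n
  calc M ^ n * ‖f‖ * ((L - x) ^ n / n.factorial) ≤ M ^ n * ‖f‖ * (L ^ n / n.factorial) := by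
        gcongr
    _ = _ := by rw [mul_pow]; ring

lemma exists_inverse_of_norm_pow_le {E : Type*} [NormedAddCommGroup E] [NormedSpace ℝ E]
    [CompleteSpace E] (Q : E →L[ℝ] E) {b : ℕ → ℝ} (hb : Summable b) (h : ∀ n, ‖Q ^ n‖ ≤ b n) :
    ∃ S : E →L[ℝ] E, ∀ f g, g - Q g = f ↔ g = S f := by
  have hs : Summable fun n => Q ^ n := Summable.of_norm_bounded hb h
  refine ⟨∑' n, Q ^ n, fun f g => ?_⟩
  have e : g - Q g = (1 - Q) g := rfl
  rw [e]
  constructor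
  · rintro rfl
    rw [← mul_apply_eq_comp, hs.tsum_pow_mul_one_sub]
    rfl
  · rintro rfl
    rw [← mul_apply_eq_comp, hs.one_sub_mul_tsum_pow]
    rfl

/-- Volterra equations of the second kind are uniquely solvable, with bounded solution operator. -/
lemma exists_resolvent (hL : 0 ≤ L) (hq : Continuous (Function.uncurry q)) :
    ∃ S : C(Set.Icc (0 : ℝ) L, ℝ) →L[ℝ] C(Set.Icc (0 : ℝ) L, ℝ), ∀ f g,
      (∀ x ∈ Set.Icc 0 L, extendIcc hL g x - volterra L q (extendIcc hL g) x = extendIcc hL f x)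
        ↔ g = S f := by
  obtain ⟨M, hM, h⟩ := exists_abs_le_square L hq
  obtain ⟨S, hS⟩ := exists_inverse_of_norm_pow_le (volterraOp hL q hq)
    (Real.summable_pow_div_factorial (M * L)) (norm_volterraOp_pow_le hL hq hM h)
  refine ⟨S, fun f g => ?_⟩
  rw [← hS f g]
  constructor
  · intro hx
    refine ext_extendIcc hL fun x hx' => ?_
    rw [← hx x hx', ← extendIcc_volterraOp hL hq g hx']
    rfl
  · rintro rfl x hx'
    rw [← extendIcc_volterraOp hL hq g hx']
    rfl

/-- `L²` estimate for a Volterra equation of the second kind. -/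
lemma exists_sqInt_le_of_volterra (hL : 0 ≤ L) (hq : Continuous (Function.uncurry q)) :
    ∃ C : ℝ, 0 ≤ C ∧ ∀ f g : ℝ → ℝ, Continuous f → Continuous g →
      (∀ x ∈ Set.Icc 0 L, g x - volterra L q g x = f x) → sqInt L g ≤ C * sqInt L f := by
  obtain ⟨S, hS⟩ := exists_resolvent hL hq
  obtain ⟨C, hC, hb⟩ := exists_volterra_sq_le hL hq
  refine ⟨2 + 2 * (L * (‖S‖ ^ 2 * C)), by positivity, fun f g hf hg h => ?_⟩
  set r := restrictIcc L (volterra L q f) (continuous_volterra hq hf) with hr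
  have hgf : Continuous fun x => g x - f x := hg.sub hf
  have h1 : restrictIcc L (fun x => g x - f x) hgf = S r := by
    rw [← hS]
    intro x hx
    rw [extendIcc_restrictIcc hL _ hx, extendIcc_restrictIcc hL _ hx,
      volterra_congr (fun y hy => extendIcc_restrictIcc hL hgf hy) hx]
    have h2 : volterra L q (fun x => g x - f x) x = volterra L q g x - volterra L q f x := by
      have hc : Continuous fun y => q x y :=
        hq.comp (by fun_prop : Continuous fun y : ℝ => ((x : ℝ), y))
      have hi : ∀ f, Continuous f → IntervalIntegrable (fun y => q x y * f y) volume x L :=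
        fun f hf => (hc.mul hf).intervalIntegrable _ _
      unfold volterra
      rw [← intervalIntegral.integral_sub (hi g hg) (hi f hf)]
      exact intervalIntegral.integral_congr fun y _ => mul_sub _ _ _
    rw [h2]
    linarith [h x hx]
  have h2 : ‖r‖ ^ 2 ≤ C * sqInt L f := by
    have h0 : 0 ≤ C * sqInt L f := mul_nonneg hC (sqInt_nonneg hL)
    have h3 : ‖r‖ ≤ Real.sqrt (C * sqInt L f) := by
      rw [ContinuousMap.norm_le _ (Real.sqrt_nonneg _)]
      rintro ⟨x, hx⟩
      exact Real.abs_le_sqrt (hb f hf x hx)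
    calc ‖r‖ ^ 2 ≤ Real.sqrt (C * sqInt L f) ^ 2 := by gcongr
      _ = _ := Real.sq_sqrt h0
  have h3 : sqInt L (fun x => g x - f x) ≤ L * (‖S‖ ^ 2 * (C * sqInt L f)) := by
    refine sqInt_le_of_abs_le hL hgf fun x hx => ?_
    have h4 := abs_extendIcc_le hL (S r) x
    rw [← h1, extendIcc_restrictIcc hL _ hx, h1] at h4
    have h5 := h4.trans (S.le_opNorm r)
    calc (g x - f x) ^ 2 = |g x - f x| ^ 2 := (sq_abs _).symm
      _ ≤ (‖S‖ * ‖r‖) ^ 2 := by gcongr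
      _ = ‖S‖ ^ 2 * ‖r‖ ^ 2 := by ring
      _ ≤ _ := by gcongr
  have h6 := sqInt_add_le hL hf hgf
  have h7 : (fun x => f x + (g x - f x)) = g := by ext x; ring
  rw [h7] at h6
  linarith

/-- The curve in `C([0,L])` traced by a smooth function of two variables. -/
def Smooth₂.curve {U : ℝ → ℝ → ℝ} (h : Smooth₂ U) (L t : ℝ) : C(Set.Icc (0 : ℝ) L, ℝ) :=
  restrictIcc L (U t) (h.continuous_snd t)

lemma Smooth₂.continuous_curve {U : ℝ → ℝ → ℝ} (h : Smooth₂ U) (L : ℝ) :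
    Continuous (h.curve L) := by
  have hc : Continuous fun p : ℝ × Set.Icc (0 : ℝ) L => U p.1 p.2 :=
    h.continuous₂.comp (by fun_prop : Continuous fun p : ℝ × Set.Icc (0 : ℝ) L => (p.1, (p.2 : ℝ)))
  exact (ContinuousMap.curry ⟨_, hc⟩).continuous

lemma Smooth₂.hasDerivAt_curve {U : ℝ → ℝ → ℝ} (h : Smooth₂ U) (L t : ℝ) :
    HasDerivAt (h.curve L) (h.fst.curve L t) t := by
  have hc := h.fst.continuous_curve L
  have e : h.curve L = fun t => h.curve L 0 + ∫ s in (0 : ℝ)..t, h.fst.curve L s := by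
    ext t x
    have h1 := (ContinuousMap.evalCLM ℝ x).intervalIntegral_comp_comm
      (hc.intervalIntegrable (μ := volume) 0 t)
    have h2 : ∫ s in (0 : ℝ)..t, pdFst U s x = U t x - U 0 x :=
      intervalIntegral.integral_eq_sub_of_hasDerivAt (fun s _ => h.hasDerivAt_fst s x)
        ((h.fst.continuous_fst x).intervalIntegrable _ _)
    have h3 : (∫ s in (0 : ℝ)..t, h.fst.curve L s) x = U t x - U 0 x := by
      rw [← h2]; exact h1.symm
    rw [ContinuousMap.add_apply, h3]
    change U t x = U 0 x + (U t x - U 0 x)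
    ring
  rw [e]
  exact (intervalIntegral.integral_hasDerivAt_right (hc.intervalIntegrable _ _)
    (hc.stronglyMeasurableAtFilter _ _) hc.continuousAt).const_add _

lemma Smooth₂.extendIcc_curve {U : ℝ → ℝ → ℝ} (h : Smooth₂ U) (hL : 0 ≤ L) (t : ℝ) {x : ℝ}
    (hx : x ∈ Set.Icc 0 L) : extendIcc hL (h.curve L t) x = U t x :=
  extendIcc_of_mem hL _ hx

/-- Time derivative of a weighted energy. -/
lemma hasDerivAt_energy (hL : 0 ≤ L) {w : ℝ → ℝ} (hw : Continuous w)
    {φ : ℝ → C(Set.Icc (0 : ℝ) L, ℝ)} {φ' : C(Set.Icc (0 : ℝ) L, ℝ)} {t : ℝ}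
    (h : HasDerivAt φ φ' t) :
    HasDerivAt (fun t => ∫ x in (0 : ℝ)..L, w x * extendIcc hL (φ t) x ^ 2)
      (∫ x in (0 : ℝ)..L, 2 * (w x * extendIcc hL (φ t) x * extendIcc hL φ' x)) t := by
  have h1 := (weightedIntegral hL w hw).hasFDerivAt.comp_hasDerivAt t (h.mul h)
  simp only [Function.comp_def, weightedIntegral_apply] at h1
  refine (h1.congr_deriv ?_).congr_of_eventuallyEq (Filter.Eventually.of_forall fun s => ?_)
  · refine intervalIntegral.integral_congr fun x _ => ?_
    change w x * (extendIcc hL φ' x * extendIcc hL (φ t) x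
      + extendIcc hL (φ t) x * extendIcc hL φ' x) = _
    ring
  · refine intervalIntegral.integral_congr fun x _ => ?_
    change _ = w x * (extendIcc hL (φ s) x * extendIcc hL (φ s) x)
    ring

end ContinuousFunctions

/-- The squared `H³(0,L)` norm of a function with derivatives `f₁, f₂, f₃`. -/
noncomputable def chainSq (L : ℝ) (f₀ f₁ f₂ f₃ : ℝ → ℝ) : ℝ :=
  sqInt L f₀ + sqInt L f₁ + sqInt L f₂ + sqInt L f₃

section Estimates

variable {L : ℝ} {f₀ f₁ f₂ f₃ : ℝ → ℝ}

lemma chainSq_nonneg (hL : 0 ≤ L) : 0 ≤ chainSq L f₀ f₁ f₂ f₃ := by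
  have h₀ := sqInt_nonneg (f := f₀) hL
  have h₁ := sqInt_nonneg (f := f₁) hL
  have h₂ := sqInt_nonneg (f := f₂) hL
  have h₃ := sqInt_nonneg (f := f₃) hL
  unfold chainSq
  positivity

lemma sqInt_le_chainSq (hL : 0 ≤ L) :
    sqInt L f₀ ≤ chainSq L f₀ f₁ f₂ f₃ ∧ sqInt L f₁ ≤ chainSq L f₀ f₁ f₂ f₃
      ∧ sqInt L f₂ ≤ chainSq L f₀ f₁ f₂ f₃ ∧ sqInt L f₃ ≤ chainSq L f₀ f₁ f₂ f₃ := by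
  have h₀ := sqInt_nonneg (f := f₀) hL
  have h₁ := sqInt_nonneg (f := f₁) hL
  have h₂ := sqInt_nonneg (f := f₂) hL
  have h₃ := sqInt_nonneg (f := f₃) hL
  unfold chainSq
  refine ⟨?_, ?_, ?_, ?_⟩ <;> linarith

lemma chainSq_congr (hL : 0 ≤ L) {g₀ g₁ g₂ g₃ : ℝ → ℝ}
    (h₀ : ∀ x ∈ Set.Icc 0 L, f₀ x = g₀ x) (h₁ : ∀ x ∈ Set.Icc 0 L, f₁ x = g₁ x)
    (h₂ : ∀ x ∈ Set.Icc 0 L, f₂ x = g₂ x) (h₃ : ∀ x ∈ Set.Icc 0 L, f₃ x = g₃ x) :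
    chainSq L f₀ f₁ f₂ f₃ = chainSq L g₀ g₁ g₂ g₃ := by
  unfold chainSq
  rw [sqInt_congr hL h₀, sqInt_congr hL h₁, sqInt_congr hL h₂, sqInt_congr hL h₃]

namespace DerivChain

lemma add {g₀ g₁ g₂ g₃ : ℝ → ℝ} (hf : DerivChain L f₀ f₁ f₂ f₃) (hg : DerivChain L g₀ g₁ g₂ g₃) :
    DerivChain L (fun x => f₀ x + g₀ x) (fun x => f₁ x + g₁ x) (fun x => f₂ x + g₂ x)
      (fun x => f₃ x + g₃ x) where
  c₀ := hf.c₀.add hg.c₀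
  c₁ := hf.c₁.add hg.c₁
  c₂ := hf.c₂.add hg.c₂
  c₃ := hf.c₃.add hg.c₃
  d₀ x hx := (hf.d₀ x hx).add (hg.d₀ x hx)
  d₁ x hx := (hf.d₁ x hx).add (hg.d₁ x hx)
  d₂ x hx := (hf.d₂ x hx).add (hg.d₂ x hx)

lemma sub {g₀ g₁ g₂ g₃ : ℝ → ℝ} (hf : DerivChain L f₀ f₁ f₂ f₃) (hg : DerivChain L g₀ g₁ g₂ g₃) :
    DerivChain L (fun x => f₀ x - g₀ x) (fun x => f₁ x - g₁ x) (fun x => f₂ x - g₂ x)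
      (fun x => f₃ x - g₃ x) where
  c₀ := hf.c₀.sub hg.c₀
  c₁ := hf.c₁.sub hg.c₁
  c₂ := hf.c₂.sub hg.c₂
  c₃ := hf.c₃.sub hg.c₃
  d₀ x hx := (hf.d₀ x hx).sub (hg.d₀ x hx)
  d₁ x hx := (hf.d₁ x hx).sub (hg.d₁ x hx)
  d₂ x hx := (hf.d₂ x hx).sub (hg.d₂ x hx)

lemma chainSq_add_le {g₀ g₁ g₂ g₃ : ℝ → ℝ} (hL : 0 ≤ L) (hf : DerivChain L f₀ f₁ f₂ f₃)
    (hg : DerivChain L g₀ g₁ g₂ g₃) :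
    chainSq L (fun x => f₀ x + g₀ x) (fun x => f₁ x + g₁ x) (fun x => f₂ x + g₂ x)
      (fun x => f₃ x + g₃ x) ≤ 2 * chainSq L f₀ f₁ f₂ f₃ + 2 * chainSq L g₀ g₁ g₂ g₃ := by
  unfold chainSq
  linarith [sqInt_add_le hL hf.c₀ hg.c₀, sqInt_add_le hL hf.c₁ hg.c₁,
    sqInt_add_le hL hf.c₂ hg.c₂, sqInt_add_le hL hf.c₃ hg.c₃]

/-- Weighted energy identity for `∂ₓ + ∂ₓ³`. -/
lemma weighted_identity (hL : 0 ≤ L) (hf : DerivChain L f₀ f₁ f₂ f₃) (h0 : f₀ 0 = 0)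
    (h1 : f₀ L = 0) (δ : ℝ) :
    ∫ x in (0 : ℝ)..L, 2 * ((1 + δ * x) * f₀ x * (f₁ x + f₃ x))
      = -δ * sqInt L f₀ + 3 * δ * sqInt L f₁ + f₁ 0 ^ 2 - (1 + δ * L) * f₁ L ^ 2 := by
  have c₀ := hf.c₀
  have c₁ := hf.c₁
  have c₂ := hf.c₂
  have c₃ := hf.c₃
  have i1 : Continuous fun x => 2 * ((1 + δ * x) * f₀ x * (f₁ x + f₃ x)) := by fun_prop
  have i2 : Continuous fun x => δ * f₀ x ^ 2 := by fun_prop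
  have i3 : Continuous fun x => 3 * δ * f₁ x ^ 2 := by fun_prop
  have i4 : Continuous fun x =>
    2 * ((1 + δ * x) * f₀ x * (f₁ x + f₃ x)) + δ * f₀ x ^ 2 := by fun_prop
  have key := intervalIntegral.integral_eq_sub_of_hasDerivAt_of_le hL
    (f := fun x => (1 + δ * x) * f₀ x ^ 2 + 2 * ((1 + δ * x) * (f₀ x * f₂ x))
      - (1 + δ * x) * f₁ x ^ 2 - 2 * δ * (f₀ x * f₁ x))
    (f' := fun x => 2 * ((1 + δ * x) * f₀ x * (f₁ x + f₃ x)) + δ * f₀ x ^ 2 - 3 * δ * f₁ x ^ 2)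
    (Continuous.continuousOn (by fun_prop)) (fun x hx => by
      have hr : HasDerivAt (fun x : ℝ => 1 + δ * x) δ x := by
        simpa using ((hasDerivAt_id x).const_mul δ).const_add 1
      have k0 := hf.d₀ x hx
      have k1 := hf.d₁ x hx
      have k2 := hf.d₂ x hx
      refine ((((hr.mul (k0.pow 2)).add ((hr.mul (k0.mul k2)).const_mul 2)).sub
        (hr.mul (k1.pow 2))).sub ((k0.mul k1).const_mul (2 * δ))).congr_deriv ?_
      simp only [Pi.mul_apply, Pi.pow_apply]
      push_cast
      ring)
    (Continuous.intervalIntegrable (by fun_prop) _ _)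
  rw [intervalIntegral.integral_sub (i4.intervalIntegrable _ _) (i3.intervalIntegrable _ _),
    intervalIntegral.integral_add (i1.intervalIntegrable _ _) (i2.intervalIntegrable _ _),
    h0, h1] at key
  simp only [intervalIntegral.integral_const_mul] at key ⊢
  unfold sqInt
  linarith

lemma moment_identity (hL : 0 ≤ L) (hf : DerivChain L f₀ f₁ f₂ f₃) :
    ∫ x in (0 : ℝ)..L, x ^ 2 / 2 * f₃ x = L ^ 2 / 2 * f₂ L - L * f₁ L + f₀ L - f₀ 0 := by
  have c₀ := hf.c₀
  have c₁ := hf.c₁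
  have c₂ := hf.c₂
  have c₃ := hf.c₃
  have key := intervalIntegral.integral_eq_sub_of_hasDerivAt_of_le hL
    (f := fun x => x ^ 2 / 2 * f₂ x - x * f₁ x + f₀ x) (f' := fun x => x ^ 2 / 2 * f₃ x)
    (Continuous.continuousOn (by fun_prop)) (fun x hx => by
      have k0 := hf.d₀ x hx
      have k1 := hf.d₁ x hx
      have k2 := hf.d₂ x hx
      refine ((((((hasDerivAt_id x).pow 2).div_const 2).mul k2).sub
        ((hasDerivAt_id x).mul k1)).add k0).congr_deriv ?_
      simp only [Pi.pow_apply, id]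
      push_cast
      ring)
    (Continuous.intervalIntegrable (by fun_prop) _ _)
  rw [key]
  ring

lemma first_moment_identity (hL : 0 ≤ L) (hf : DerivChain L f₀ f₁ f₂ f₃) :
    ∫ x in (0 : ℝ)..L, f₂ x + x * f₃ x = L * f₂ L := by
  have c₂ := hf.c₂
  have c₃ := hf.c₃
  have key := intervalIntegral.integral_eq_sub_of_hasDerivAt_of_le hL
    (f := fun x => x * f₂ x) (f' := fun x => f₂ x + x * f₃ x)
    (Continuous.continuousOn (by fun_prop)) (fun x hx => by
      exact ((hasDerivAt_id x).mul (hf.d₂ x hx)).congr_deriv (by simp))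
    (Continuous.intervalIntegrable (by fun_prop) _ _)
  rw [key]
  ring

end DerivChain

/-- Trace estimate for the second derivative. -/
lemma exists_trace_sq_le (hL : 0 < L) :
    ∃ C : ℝ, 0 ≤ C ∧ ∀ f₀ f₁ f₂ f₃ : ℝ → ℝ, DerivChain L f₀ f₁ f₂ f₃ →
      f₂ L ^ 2 ≤ C * chainSq L f₀ f₁ f₂ f₃ := by
  obtain ⟨C, hC, h⟩ := exists_sqInt_mul_le hL.le continuous_id
  refine ⟨L * (2 + 2 * C) / L ^ 2, by positivity, fun f₀ f₁ f₂ f₃ hf => ?_⟩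
  have c₂ := hf.c₂
  have c₃ := hf.c₃
  have h1 := sq_integral_le hL.le (by fun_prop : Continuous fun x => f₂ x + x * f₃ x)
  rw [hf.first_moment_identity hL.le] at h1
  have h2 := sqInt_add_le hL.le c₂ (by fun_prop : Continuous fun x => x * f₃ x)
  have h3 := h f₃ c₃
  simp only [id] at h3
  obtain ⟨-, -, b2, b3⟩ := sqInt_le_chainSq (f₀ := f₀) (f₁ := f₁) (f₂ := f₂) (f₃ := f₃) hL.le
  have h4 : sqInt L (fun x => f₂ x + x * f₃ x) ≤ (2 + 2 * C) * chainSq L f₀ f₁ f₂ f₃ := by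
    nlinarith [mul_le_mul_of_nonneg_left b3 hC]
  unfold sqInt at h4
  rw [sub_zero] at h1
  have h5 : L ^ 2 * f₂ L ^ 2 ≤ L * ((2 + 2 * C) * chainSq L f₀ f₁ f₂ f₃) := by
    calc L ^ 2 * f₂ L ^ 2 = (L * f₂ L) ^ 2 := by ring
      _ ≤ _ := h1.trans (mul_le_mul_of_nonneg_left h4 hL.le)
  rw [div_mul_eq_mul_div, le_div_iff₀ (by positivity)]
  linarith

lemma exists_elliptic_energy_le (hL : 0 < L) {lam : ℝ} (hlam : 0 < lam) :
    ∃ K : ℝ, 0 ≤ K ∧ ∀ f₀ f₁ f₂ f₃ h : ℝ → ℝ, DerivChain L f₀ f₁ f₂ f₃ → Continuous h →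
      f₀ 0 = 0 → f₀ L = 0 → f₁ L = 0 →
      (∀ x ∈ Set.Icc 0 L, f₁ x + f₃ x + lam * f₀ x = h x) →
      sqInt L f₀ + sqInt L f₁ ≤ K * sqInt L h := by
  set R := 1 + lam * L with hR
  refine ⟨2 * R ^ 2 / lam * (2 / lam), by positivity, fun f₀ f₁ f₂ f₃ h hf hh h0 h1 h2 he => ?_⟩
  have c₀ := hf.c₀
  have c₁ := hf.c₁
  have c₃ := hf.c₃
  have n₁ := sqInt_nonneg (f := f₁) hL.le
  have key := hf.weighted_identity hL.le h0 h1 lam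
  have i5 : Continuous fun x => lam * f₀ x ^ 2 := by fun_prop
  have i6 : Continuous fun x => lam / 2 * f₀ x ^ 2 := by fun_prop
  have i7 : Continuous fun x => 2 * R ^ 2 / lam * h x ^ 2 := by fun_prop
  have up : ∫ x in (0 : ℝ)..L, 2 * ((1 + lam * x) * f₀ x * (f₁ x + f₃ x))
      ≤ ∫ x in (0 : ℝ)..L, (2 * R ^ 2 / lam * h x ^ 2 + lam / 2 * f₀ x ^ 2)
        - 2 * (lam * f₀ x ^ 2) := by
    refine intervalIntegral.integral_mono_on hL.le
      (Continuous.intervalIntegrable (by fun_prop) _ _)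
      (Continuous.intervalIntegrable (by fun_prop) _ _) fun x hx => ?_
    have e : f₁ x + f₃ x = h x - lam * f₀ x := by linarith [he x hx]
    rw [e]
    have r1 : 1 ≤ 1 + lam * x := by nlinarith [hx.1]
    have r2 : 1 + lam * x ≤ R := by rw [hR]; nlinarith [hx.2]
    have r3 : (1 + lam * x) ^ 2 * h x ^ 2 ≤ R ^ 2 * h x ^ 2 := by gcongr
    have s1 : 2 * ((1 + lam * x) * f₀ x * h x)
        ≤ 2 * R ^ 2 / lam * h x ^ 2 + lam / 2 * f₀ x ^ 2 := by
      have s2 : 2 / lam * ((1 + lam * x) ^ 2 * h x ^ 2) ≤ 2 / lam * (R ^ 2 * h x ^ 2) := by gcongr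
      have s3 : 0 ≤ lam / 2 * (f₀ x - 2 / lam * ((1 + lam * x) * h x)) ^ 2 := by positivity
      have s4 : lam / 2 * (f₀ x - 2 / lam * ((1 + lam * x) * h x)) ^ 2
          = lam / 2 * f₀ x ^ 2 - 2 * ((1 + lam * x) * f₀ x * h x)
            + 2 / lam * ((1 + lam * x) ^ 2 * h x ^ 2) := by
        field_simp; ring
      have s5 : 2 / lam * (R ^ 2 * h x ^ 2) = 2 * R ^ 2 / lam * h x ^ 2 := by ring
      linarith
    have s6 : lam * f₀ x ^ 2 ≤ lam * ((1 + lam * x) * f₀ x ^ 2) := by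
      have := mul_le_mul_of_nonneg_right r1 (sq_nonneg (f₀ x))
      nlinarith
    nlinarith
  have i8 : Continuous fun x => 2 * R ^ 2 / lam * h x ^ 2 + lam / 2 * f₀ x ^ 2 := by fun_prop
  have i9 : Continuous fun x => 2 * (lam * f₀ x ^ 2) := by fun_prop
  rw [intervalIntegral.integral_sub (i8.intervalIntegrable _ _) (i9.intervalIntegrable _ _),
    intervalIntegral.integral_add (i7.intervalIntegrable _ _) (i6.intervalIntegrable _ _)] at up
  simp only [intervalIntegral.integral_const_mul] at up key
  rw [key, h2] at up
  have b : lam / 2 * sqInt L f₀ + lam / 2 * sqInt L f₁ ≤ 2 * R ^ 2 / lam * sqInt L h := by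
    unfold sqInt at *
    nlinarith [sq_nonneg (f₁ 0), mul_nonneg hlam.le n₁]
  have := mul_le_mul_of_nonneg_left b (by positivity : 0 ≤ 2 / lam)
  have e1 : 2 / lam * (lam / 2 * sqInt L f₀ + lam / 2 * sqInt L f₁)
      = sqInt L f₀ + sqInt L f₁ := by field_simp
  linarith

/-- Elliptic regularity for `f' + f''' + lam f = h`. -/
lemma exists_elliptic_le (hL : 0 < L) {lam : ℝ} (hlam : 0 < lam) :
    ∃ C : ℝ, 0 ≤ C ∧ ∀ f₀ f₁ f₂ f₃ h : ℝ → ℝ, DerivChain L f₀ f₁ f₂ f₃ → Continuous h →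
      f₀ 0 = 0 → f₀ L = 0 → f₁ L = 0 →
      (∀ x ∈ Set.Icc 0 L, f₁ x + f₃ x + lam * f₀ x = h x) →
      chainSq L f₀ f₁ f₂ f₃ ≤ C * sqInt L h := by
  obtain ⟨C, hC, hm⟩ := exists_sqInt_mul_le hL.le (by fun_prop : Continuous fun x : ℝ => x ^ 2 / 2)
  obtain ⟨C', hC', hv⟩ := exists_sqInt_volterra_le (q := fun _ _ => 1) hL.le
    (by unfold Function.uncurry; fun_prop)
  obtain ⟨K, hK0, hE⟩ := exists_elliptic_energy_le hL hlam
  set K₃ := 2 + 4 * K + 4 * lam ^ 2 * K with hK3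
  have hK30 : 0 ≤ K₃ := by positivity
  set Kt := 4 / L ^ 4 * (L * C) with hKt
  have hKt0 : 0 ≤ Kt := by positivity
  refine ⟨K + K + 2 * (L * (Kt * K₃)) + 2 * C' * K₃ + K₃, by positivity,
    fun f₀ f₁ f₂ f₃ h hf hh h0 h1 h2 he => ?_⟩
  have c₀ := hf.c₀
  have c₁ := hf.c₁
  have c₂ := hf.c₂
  have c₃ := hf.c₃
  have n₀ := sqInt_nonneg (f := f₀) hL.le
  have n₁ := sqInt_nonneg (f := f₁) hL.le
  have n₃ := sqInt_nonneg (f := f₃) hL.le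
  have nh := sqInt_nonneg (f := h) hL.le
  have b' := hE f₀ f₁ f₂ f₃ h hf hh h0 h1 h2 he
  have b₀ : sqInt L f₀ ≤ K * sqInt L h := by linarith
  have b₁ : sqInt L f₁ ≤ K * sqInt L h := by linarith
  have b₃ : sqInt L f₃ ≤ K₃ * sqInt L h := by
    have e : sqInt L f₃ = sqInt L (fun x => h x - (f₁ x + lam * f₀ x)) :=
      sqInt_congr hL.le fun x hx => by linarith [he x hx]
    have t1 := sqInt_sub_le hL.le hh (by fun_prop : Continuous fun x => f₁ x + lam * f₀ x)
    have t2 := sqInt_add_le hL.le c₁ (by fun_prop : Continuous fun x => lam * f₀ x)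
    rw [sqInt_const_mul] at t2
    rw [e, hK3]
    have t3 := mul_le_mul_of_nonneg_left b₀ (sq_nonneg lam)
    linarith
  have bt : f₂ L ^ 2 ≤ Kt * (K₃ * sqInt L h) := by
    have t1 := sq_integral_le hL.le (by fun_prop : Continuous fun x => x ^ 2 / 2 * f₃ x)
    rw [hf.moment_identity hL.le, h0, h1, h2, sub_zero L] at t1
    have t2 := hm f₃ c₃
    unfold sqInt at t2
    have t3 : L ^ 4 / 4 * f₂ L ^ 2 ≤ L * (C * sqInt L f₃) := by
      calc L ^ 4 / 4 * f₂ L ^ 2 = (L ^ 2 / 2 * f₂ L - L * 0 + 0 - 0) ^ 2 := by ring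
        _ ≤ _ := t1.trans (mul_le_mul_of_nonneg_left t2 hL.le)
    have t4 : f₂ L ^ 2 = 4 / L ^ 4 * (L ^ 4 / 4 * f₂ L ^ 2) := by field_simp
    rw [t4]
    calc _ ≤ 4 / L ^ 4 * (L * (C * sqInt L f₃)) := by gcongr
      _ = Kt * sqInt L f₃ := by rw [hKt]; ring
      _ ≤ _ := by gcongr
  have b₂ : sqInt L f₂ ≤ 2 * (L * (Kt * (K₃ * sqInt L h))) + 2 * (C' * (K₃ * sqInt L h)) := by
    have e : sqInt L f₂ = sqInt L (fun x => f₂ L - volterra L (fun _ _ => 1) f₃ x) := by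
      refine sqInt_congr hL.le fun x hx => ?_
      have := intervalIntegral.integral_eq_sub_of_hasDerivAt_of_le hx.2 (f := f₂) (f' := f₃)
        c₂.continuousOn (fun y hy => hf.d₂ y ⟨hx.1.trans_lt hy.1, hy.2⟩)
        (c₃.intervalIntegrable _ _)
      simp only [volterra, one_mul, this]
      ring
    have t1 := sqInt_sub_le (f := fun _ => f₂ L) hL.le continuous_const
      (continuous_volterra (L := L) (q := fun _ _ => 1)
        (by unfold Function.uncurry; fun_prop) c₃)
    have t2 := sqInt_le_of_abs_le (f := fun _ => f₂ L) hL.le continuous_const (fun x _ => bt)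
    have t3 := (hv f₃ c₃).trans (mul_le_mul_of_nonneg_left b₃ hC')
    rw [e]
    linarith
  unfold chainSq
  linarith

namespace BackstepKernel

variable {μ d : ℝ} {q : ℝ → ℝ → ℝ}

lemma exists_sqInt_derivs_le (hq : BackstepKernel L μ d q) (hL : 0 ≤ L) :
    ∃ C : ℝ, 0 ≤ C ∧ ∀ f₀ f₁ : ℝ → ℝ, Continuous f₀ → Continuous f₁ →
      sqInt L (volterra L q f₀) ≤ C * sqInt L f₀
        ∧ sqInt L (volterra L (pdFst q) f₀) ≤ C * sqInt L f₀
        ∧ sqInt L (volterraD₂ L μ d q f₀) ≤ C * sqInt L f₀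
        ∧ sqInt L (volterraD₃ L μ d q f₀ f₁) ≤ C * (sqInt L f₀ + sqInt L f₁) := by
  obtain ⟨C₀, n₀, h₀⟩ := exists_sqInt_volterra_le hL hq.smooth.continuous
  obtain ⟨C₁, n₁, h₁⟩ := exists_sqInt_volterra_le hL hq.smooth₁.continuous
  obtain ⟨C₂, n₂, h₂⟩ := exists_sqInt_volterra_le hL hq.smooth₁₁.continuous
  obtain ⟨C₃, n₃, h₃⟩ := exists_sqInt_volterra_le hL hq.continuous₁₁₁
  obtain ⟨C₄, n₄, h₄⟩ := exists_sqInt_mul_le hL (by fun_prop : Continuous fun x => μ / 3 * x + d)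
  obtain ⟨C₅, n₅, h₅⟩ := exists_sqInt_mul_le hL hq.continuous_diag₁₁
  refine ⟨C₀ + C₁ + (2 * C₂ + 2 * C₄) + (4 * C₃ + 4 * C₅ + 4 * (μ / 3) ^ 2 + 4 * C₄),
    by positivity, fun f₀ f₁ c₀ c₁ => ?_⟩
  have k₀ := sqInt_nonneg (f := f₀) hL
  have k₁ := sqInt_nonneg (f := f₁) hL
  have v₀ := h₀ f₀ c₀
  have v₁ := h₁ f₀ c₀
  have m₀ : Continuous fun x => (μ / 3 * x + d) * f₀ x := by fun_prop
  have m₁ : Continuous fun x => (μ / 3 * x + d) * f₁ x := by fun_prop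
  have m₂ : Continuous fun x => μ / 3 * f₀ x := by fun_prop
  have m₃ : Continuous fun x => pdFst (pdFst q) x x * f₀ x := hq.continuous_diag₁₁.mul c₀
  have w₂ := sqInt_sub_le hL (continuous_volterra (L := L) hq.smooth₁₁.continuous c₀) m₀
  have u₃ : Continuous (volterra L (pdFst (pdFst (pdFst q))) f₀) :=
    continuous_volterra (L := L) hq.continuous₁₁₁ c₀
  have w₃ := sqInt_sub_le hL (u₃.sub m₃) (m₂.add m₁)
  have w₄ := sqInt_sub_le hL u₃ m₃
  have w₅ := sqInt_add_le hL m₂ m₁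
  have z := sqInt_const_mul (L := L) (f := f₀) (μ / 3)
  have e₂ := h₂ f₀ c₀
  have e₃ := h₃ f₀ c₀
  have e₄ := h₄ f₀ c₀
  have e₄' := h₄ f₁ c₁
  have e₅ := h₅ f₀ c₀
  have p₀ := mul_nonneg n₀ k₀
  have p₁ := mul_nonneg n₁ k₀
  have p₂ := mul_nonneg n₂ k₀
  have p₃ := mul_nonneg n₃ k₀
  have p₄ := mul_nonneg n₄ k₀
  have p₅ := mul_nonneg n₅ k₀
  have p₆ := mul_nonneg (sq_nonneg (μ / 3)) k₀
  have r₀ := mul_nonneg n₀ k₁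
  have r₁ := mul_nonneg n₁ k₁
  have r₂ := mul_nonneg n₂ k₁
  have r₃ := mul_nonneg n₃ k₁
  have r₄ := mul_nonneg n₄ k₁
  have r₅ := mul_nonneg n₅ k₁
  have r₆ := mul_nonneg (sq_nonneg (μ / 3)) k₁
  refine ⟨by linarith, by linarith, ?_, ?_⟩
  · change sqInt L (volterraD₂ L μ d q f₀) ≤ _ at w₂
    linarith
  · change sqInt L (volterraD₃ L μ d q f₀ f₁) ≤ 2 * sqInt L (fun x =>
      volterra L (pdFst (pdFst (pdFst q))) f₀ x - pdFst (pdFst q) x x * f₀ x)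
      + 2 * sqInt L (fun x => μ / 3 * f₀ x + (μ / 3 * x + d) * f₁ x) at w₃
    linarith

/-- `I - Q` is bounded and boundedly invertible on `H³(0,L)`. -/
lemma exists_chainSq_equiv (hq : BackstepKernel L μ d q) (hL : 0 ≤ L) :
    ∃ C : ℝ, 0 ≤ C ∧ ∀ f₀ f₁ f₂ f₃ g₀ g₁ g₂ g₃ : ℝ → ℝ, DerivChain L f₀ f₁ f₂ f₃ →
      DerivChain L g₀ g₁ g₂ g₃ →
      (∀ x ∈ Set.Icc 0 L, f₀ x - volterra L q f₀ x = g₀ x) →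
      (∀ x ∈ Set.Icc 0 L, f₁ x - volterra L (pdFst q) f₀ x = g₁ x) →
      (∀ x ∈ Set.Icc 0 L, f₂ x - volterraD₂ L μ d q f₀ x = g₂ x) →
      (∀ x ∈ Set.Icc 0 L, f₃ x - volterraD₃ L μ d q f₀ f₁ x = g₃ x) →
      chainSq L g₀ g₁ g₂ g₃ ≤ C * chainSq L f₀ f₁ f₂ f₃
        ∧ chainSq L f₀ f₁ f₂ f₃ ≤ C * chainSq L g₀ g₁ g₂ g₃ := by
  obtain ⟨C, hC, h⟩ := hq.exists_sqInt_derivs_le hL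
  obtain ⟨K, hK, hv⟩ := exists_sqInt_le_of_volterra hL hq.smooth.continuous
  refine ⟨2 + 10 * C + (K + 2 + 2 * C * K + 2 + 2 * C * K + 2 + 2 * C * (K + 2 + 2 * C * K)),
    by positivity, fun f₀ f₁ f₂ f₃ g₀ g₁ g₂ g₃ hf hg e₀ e₁ e₂ e₃ => ?_⟩
  obtain ⟨v₀, v₁, v₂, v₃⟩ := h f₀ f₁ hf.c₀ hf.c₁
  have cv := hq.derivChain_volterra hf.c₀ hf.c₁ hf.d₀
  have kf₀ := sqInt_nonneg (f := f₀) hL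
  have kf₁ := sqInt_nonneg (f := f₁) hL
  have kf₂ := sqInt_nonneg (f := f₂) hL
  have kf₃ := sqInt_nonneg (f := f₃) hL
  have kg₀ := sqInt_nonneg (f := g₀) hL
  have kg₁ := sqInt_nonneg (f := g₁) hL
  have kg₂ := sqInt_nonneg (f := g₂) hL
  have kg₃ := sqInt_nonneg (f := g₃) hL
  have p (a b : ℝ) (ha : 0 ≤ a) : 0 ≤ C * a := mul_nonneg hC ha
  constructor
  · have s₀ := sqInt_sub_le hL hf.c₀ cv.c₀
    have s₁ := sqInt_sub_le hL hf.c₁ cv.c₁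
    have s₂ := sqInt_sub_le hL hf.c₂ cv.c₂
    have s₃ := sqInt_sub_le hL hf.c₃ cv.c₃
    rw [sqInt_congr hL e₀] at s₀
    rw [sqInt_congr hL e₁] at s₁
    rw [sqInt_congr hL e₂] at s₂
    rw [sqInt_congr hL e₃] at s₃
    have hsum : chainSq L g₀ g₁ g₂ g₃ ≤ (2 + 10 * C) * chainSq L f₀ f₁ f₂ f₃ := by
      unfold chainSq
      nlinarith [mul_nonneg hC kf₀, mul_nonneg hC kf₁, mul_nonneg hC kf₂, mul_nonneg hC kf₃]
    refine hsum.trans (mul_le_mul_of_nonneg_right ?_ (chainSq_nonneg hL))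
    have : 0 ≤ K + 2 + 2 * C * K + 2 + 2 * C * K + 2 + 2 * C * (K + 2 + 2 * C * K) := by
      positivity
    linarith
  · have b₀ : sqInt L f₀ ≤ K * sqInt L g₀ := hv g₀ f₀ hg.c₀ hf.c₀ e₀
    have t₀ := mul_le_mul_of_nonneg_left b₀ hC
    have s₁ := sqInt_add_le hL hg.c₁ cv.c₁
    have s₂ := sqInt_add_le hL hg.c₂ cv.c₂
    have s₃ := sqInt_add_le hL hg.c₃ cv.c₃
    rw [sqInt_congr hL (g := f₁) fun x hx => by linarith [e₁ x hx]] at s₁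
    rw [sqInt_congr hL (g := f₂) fun x hx => by linarith [e₂ x hx]] at s₂
    rw [sqInt_congr hL (g := f₃) fun x hx => by linarith [e₃ x hx]] at s₃
    obtain ⟨G₀, G₁, G₂, G₃⟩ :=
      sqInt_le_chainSq (f₀ := g₀) (f₁ := g₁) (f₂ := g₂) (f₃ := g₃) hL
    set G := chainSq L g₀ g₁ g₂ g₃ with hG
    have nG : 0 ≤ G := kg₀.trans G₀
    have B₀ : sqInt L f₀ ≤ K * G := b₀.trans (by gcongr)
    have B₁ : sqInt L f₁ ≤ (2 + 2 * C * K) * G := by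
      nlinarith [mul_le_mul_of_nonneg_left B₀ hC]
    have B₂ : sqInt L f₂ ≤ (2 + 2 * C * K) * G := by
      nlinarith [mul_le_mul_of_nonneg_left B₀ hC]
    have B₀₁ : sqInt L f₀ + sqInt L f₁ ≤ (K + 2 + 2 * C * K) * G := by linarith
    have B₃ : sqInt L f₃ ≤ (2 + 2 * C * (K + 2 + 2 * C * K)) * G := by
      have := mul_le_mul_of_nonneg_left B₀₁ hC
      linarith
    have hs : chainSq L f₀ f₁ f₂ f₃
        ≤ (K + 2 + 2 * C * K + 2 + 2 * C * K + 2 + 2 * C * (K + 2 + 2 * C * K)) * G := by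
      unfold chainSq
      linarith
    refine hs.trans (mul_le_mul_of_nonneg_right ?_ nG)
    linarith

end BackstepKernel

end Estimates

section Transforms

variable {L lam ε : ℝ} {f₀ f₁ f₂ f₃ : ℝ → ℝ}

/-- Dissipation of the weighted energy for `∂ₜ f + ∂ₓ f + ∂ₓ³ f + lam f = a + ∂ₓ h`. -/
lemma exists_dissipation (hL : 0 < L) (hε : 0 < ε) (lam : ℝ) :
    ∃ C : ℝ, 0 ≤ C ∧ ∀ f₀ f₁ f₂ f₃ a h h' d : ℝ → ℝ, DerivChain L f₀ f₁ f₂ f₃ →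
      Continuous a → Continuous h → Continuous h' → Continuous d →
      (∀ x ∈ Set.Ioo 0 L, HasDerivAt h (h' x) x) → f₀ 0 = 0 → f₀ L = 0 →
      (∀ x ∈ Set.Icc 0 L, d x = -(f₁ x + f₃ x + lam * f₀ x) + a x + h' x) →
      ∫ x in (0 : ℝ)..L, 2 * ((1 + ε * x) * f₀ x * d x)
        ≤ -(2 * (lam - ε)) * (∫ x in (0 : ℝ)..L, (1 + ε * x) * f₀ x ^ 2)
          - ε / 2 * (sqInt L f₀ + sqInt L f₁)
          + C * (f₁ L ^ 2 + sqInt L a + sqInt L h) := by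
  set R := 1 + ε * L with hR
  have hR0 : 0 < R := by positivity
  refine ⟨R + 4 / ε * R + (4 * ε + R ^ 2 / ε), by positivity,
    fun f₀ f₁ f₂ f₃ a h h' d hf ca ch ch' cd hd h0 h1 he => ?_⟩
  have c₀ := hf.c₀
  have c₁ := hf.c₁
  have c₃ := hf.c₃
  have n₁ := sqInt_nonneg (f := f₁) hL.le
  have na := sqInt_nonneg (f := a) hL.le
  have nh := sqInt_nonneg (f := h) hL.le
  have key := hf.weighted_identity hL.le h0 h1 ε
  have parts := intervalIntegral.integral_eq_sub_of_hasDerivAt_of_le hL.le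
    (f := fun x => 2 * ((1 + ε * x) * f₀ x * h x))
    (f' := fun x => 2 * ((ε * f₀ x + (1 + ε * x) * f₁ x) * h x + (1 + ε * x) * f₀ x * h' x))
    (Continuous.continuousOn (by fun_prop)) (fun x hx => by
      have hr : HasDerivAt (fun x : ℝ => 1 + ε * x) ε x := by
        simpa using ((hasDerivAt_id x).const_mul ε).const_add 1
      exact ((hr.mul (hf.d₀ x hx)).mul (hd x hx)).const_mul 2)
    (Continuous.intervalIntegrable (by fun_prop) _ _)
  simp only [h0, h1, mul_zero, zero_mul, sub_zero] at parts
  have i1 : Continuous fun x => 2 * ((1 + ε * x) * f₀ x * (f₁ x + f₃ x)) := by fun_prop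
  have i2 : Continuous fun x =>
    2 * ((ε * f₀ x + (1 + ε * x) * f₁ x) * h x + (1 + ε * x) * f₀ x * h' x) := by fun_prop
  have i3 : Continuous fun x => (ε / 4 - 2 * lam) * ((1 + ε * x) * f₀ x ^ 2) := by fun_prop
  have i4 : Continuous fun x => ε / 4 * f₀ x ^ 2 := by fun_prop
  have i5 : Continuous fun x => ε * f₁ x ^ 2 := by fun_prop
  have i6 : Continuous fun x => 4 / ε * R * a x ^ 2 := by fun_prop
  have i7 : Continuous fun x => (4 * ε + R ^ 2 / ε) * h x ^ 2 := by fun_prop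
  have up : ∫ x in (0 : ℝ)..L, 2 * ((1 + ε * x) * f₀ x * d x)
      ≤ ∫ x in (0 : ℝ)..L, ((ε / 4 - 2 * lam) * ((1 + ε * x) * f₀ x ^ 2) + (ε / 4 * f₀ x ^ 2
        + (ε * f₁ x ^ 2 + (4 / ε * R * a x ^ 2 + (4 * ε + R ^ 2 / ε) * h x ^ 2))))
        + (2 * ((ε * f₀ x + (1 + ε * x) * f₁ x) * h x + (1 + ε * x) * f₀ x * h' x)
        - 2 * ((1 + ε * x) * f₀ x * (f₁ x + f₃ x))) := by
    refine intervalIntegral.integral_mono_on hL.le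
      (Continuous.intervalIntegrable (by fun_prop) _ _)
      (Continuous.intervalIntegrable (by fun_prop) _ _) fun x hx => ?_
    rw [he x hx]
    have r1 : 1 ≤ 1 + ε * x := by nlinarith [hx.1]
    have r2 : 1 + ε * x ≤ R := by rw [hR]; nlinarith [hx.2]
    set ρ := 1 + ε * x with hρ
    have hρ0 : 0 < ρ := by linarith
    have s1 : 2 * (ρ * f₀ x * a x) ≤ ε / 4 * (ρ * f₀ x ^ 2) + 4 / ε * R * a x ^ 2 := by
      have t1 : 0 ≤ ε / 4 * ρ * (f₀ x - 4 / ε * a x) ^ 2 := by positivity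
      have t2 : ε / 4 * ρ * (f₀ x - 4 / ε * a x) ^ 2
          = ε / 4 * (ρ * f₀ x ^ 2) - 2 * (ρ * f₀ x * a x) + 4 / ε * ρ * a x ^ 2 := by
        field_simp; ring
      have t3 : 4 / ε * ρ * a x ^ 2 ≤ 4 / ε * R * a x ^ 2 := by gcongr
      linarith
    have s2 : -(2 * (ε * f₀ x * h x)) ≤ ε / 4 * f₀ x ^ 2 + 4 * ε * h x ^ 2 := by
      have t1 : 0 ≤ ε / 4 * (f₀ x + 4 * h x) ^ 2 := by positivity
      linarith
    have s3 : -(2 * (ρ * f₁ x * h x)) ≤ ε * f₁ x ^ 2 + R ^ 2 / ε * h x ^ 2 := by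
      have t1 : 0 ≤ ε * (f₁ x + ρ / ε * h x) ^ 2 := by positivity
      have t2 : ε * (f₁ x + ρ / ε * h x) ^ 2
          = ε * f₁ x ^ 2 + 2 * (ρ * f₁ x * h x) + ρ ^ 2 / ε * h x ^ 2 := by
        field_simp; ring
      have t3 : ρ ^ 2 / ε * h x ^ 2 ≤ R ^ 2 / ε * h x ^ 2 := by gcongr
      linarith
    linarith
  have lower : sqInt L f₀ ≤ ∫ x in (0 : ℝ)..L, (1 + ε * x) * f₀ x ^ 2 := by
    refine intervalIntegral.integral_mono_on hL.le
      (Continuous.intervalIntegrable (by fun_prop) _ _)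
      (Continuous.intervalIntegrable (by fun_prop) _ _) fun x hx => ?_
    have r1 : 1 ≤ 1 + ε * x := by nlinarith [hx.1]
    exact le_mul_of_one_le_left (sq_nonneg _) r1
  have j (g : ℝ → ℝ) (hg : Continuous g) : IntervalIntegrable g volume 0 L :=
    hg.intervalIntegrable _ _
  rw [intervalIntegral.integral_add (j _ (by fun_prop)) (j _ (by fun_prop)),
    intervalIntegral.integral_sub (j _ i2) (j _ i1), parts, key,
    intervalIntegral.integral_add (j _ i3) (j _ (by fun_prop)),
    intervalIntegral.integral_add (j _ i4) (j _ (by fun_prop)),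
    intervalIntegral.integral_add (j _ i5) (j _ (by fun_prop)),
    intervalIntegral.integral_add (j _ i6) (j _ i7),
    intervalIntegral.integral_const_mul (ε / 4 - 2 * lam),
    intervalIntegral.integral_const_mul (ε / 4), intervalIntegral.integral_const_mul ε,
    intervalIntegral.integral_const_mul (4 / ε * R),
    intervalIntegral.integral_const_mul (4 * ε + R ^ 2 / ε)] at up
  refine up.trans ?_
  change (ε / 4 - 2 * lam) * (∫ x in (0 : ℝ)..L, (1 + ε * x) * f₀ x ^ 2)
    + (ε / 4 * sqInt L f₀ + (ε * sqInt L f₁ + (4 / ε * R * sqInt L a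
    + (4 * ε + R ^ 2 / ε) * sqInt L h))) + (0 - (-ε * sqInt L f₀ + 3 * ε * sqInt L f₁ + f₁ 0 ^ 2
    - R * f₁ L ^ 2)) ≤ _
  have q1 := mul_le_mul_of_nonneg_left lower hε.le
  have q2 : 0 ≤ 4 / ε * R := by positivity
  have q3 : 0 ≤ 4 * ε + R ^ 2 / ε := by positivity
  have q4 := sq_nonneg (f₁ L)
  have q5 := sq_nonneg (f₁ 0)
  have q6 := mul_nonneg hε.le n₁
  generalize 4 / ε * R = A at *
  generalize 4 * ε + R ^ 2 / ε = B at *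
  have m1 := mul_nonneg hR0.le na
  have m2 := mul_nonneg hR0.le nh
  have m3 := mul_nonneg q2 q4
  have m4 := mul_nonneg q2 nh
  have m5 := mul_nonneg q3 q4
  have m6 := mul_nonneg q3 na
  linarith

lemma eq_of_volterra_eq {q : ℝ → ℝ → ℝ} (hL : 0 ≤ L) (hq : Continuous (Function.uncurry q))
    {f g g' : ℝ → ℝ} (hf : Continuous f) (hg : Continuous g) (hg' : Continuous g')
    (h : ∀ x ∈ Set.Icc 0 L, g x - volterra L q g x = f x)
    (h' : ∀ x ∈ Set.Icc 0 L, g' x - volterra L q g' x = f x) :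
    ∀ x ∈ Set.Icc 0 L, g x = g' x := by
  obtain ⟨S, hS⟩ := exists_resolvent hL hq
  have key : ∀ {g : ℝ → ℝ} (hg : Continuous g),
      (∀ x ∈ Set.Icc 0 L, g x - volterra L q g x = f x) →
      restrictIcc L g hg = S (restrictIcc L f hf) := by
    intro g hg h
    rw [← hS]
    intro x hx
    rw [extendIcc_restrictIcc hL _ hx, extendIcc_restrictIcc hL _ hx,
      volterra_congr (fun y hy => extendIcc_restrictIcc hL hg hy) hx, h x hx]
  intro x hx
  rw [← extendIcc_restrictIcc hL hg hx, key hg h, ← key hg' h', extendIcc_restrictIcc hL hg' hx]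

lemma volterra_const_mul {q : ℝ → ℝ → ℝ} (c : ℝ) (f : ℝ → ℝ) (x : ℝ) :
    volterra L q (fun y => c * f y) x = c * volterra L q f x := by
  unfold volterra
  rw [← intervalIntegral.integral_const_mul]
  exact intervalIntegral.integral_congr fun y _ => by ring

lemma volterra_add {q : ℝ → ℝ → ℝ} (hq : Continuous (Function.uncurry q)) {f g : ℝ → ℝ}
    (hf : Continuous f) (hg : Continuous g) (x : ℝ) :
    volterra L q (fun y => f y + g y) x = volterra L q f x + volterra L q g x := by
  have hc : Continuous fun y => q x y := hq.comp (by fun_prop : Continuous fun y : ℝ => (x, y))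
  have i1 : Continuous fun y => q x y * f y := hc.mul hf
  have i2 : Continuous fun y => q x y * g y := hc.mul hg
  unfold volterra
  rw [← intervalIntegral.integral_add (i1.intervalIntegrable _ _) (i2.intervalIntegrable _ _)]
  exact intervalIntegral.integral_congr fun y _ => mul_add _ _ _

lemma volterra_self {q : ℝ → ℝ → ℝ} (f : ℝ → ℝ) : volterra L q f L = 0 :=
  intervalIntegral.integral_same

/-- The inverse backstepping transform maps the observer error equation to the target equation. -/
lemma BackstepKernel.inverse_transform {p : ℝ → ℝ → ℝ} (hp : BackstepKernel L lam 0 p)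
    (hp0 : ∀ y ∈ Set.Icc 0 L, p 0 y = 0) (hL : 0 < L) {d w₀ r : ℝ → ℝ}
    (hf : DerivChain L f₀ f₁ f₂ f₃) (hd : Continuous d) (hw : Continuous w₀) (hr : Continuous r)
    (hwf : ∀ x ∈ Set.Icc 0 L, w₀ x - volterra L p w₀ x = f₀ x)
    (hrd : ∀ x ∈ Set.Icc 0 L, r x - volterra L p r x = d x)
    (he : ∀ x ∈ Set.Icc 0 L, d x = -(f₁ x + f₃ x) + p x L * f₂ L)
    (h0 : f₀ 0 = 0) (h1 : f₀ L = 0) (h2 : f₁ L = 0) :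
    ∃ w₁ w₂ w₃ : ℝ → ℝ, DerivChain L w₀ w₁ w₂ w₃ ∧ w₀ 0 = 0 ∧ w₀ L = 0 ∧ w₁ L = 0
      ∧ (∀ x ∈ Set.Icc 0 L, w₁ x - volterra L (pdFst p) w₀ x = f₁ x)
      ∧ (∀ x ∈ Set.Icc 0 L, w₂ x - volterraD₂ L lam 0 p w₀ x = f₂ x)
      ∧ (∀ x ∈ Set.Icc 0 L, w₃ x - volterraD₃ L lam 0 p w₀ w₁ x = f₃ x)
      ∧ ∀ x ∈ Set.Icc 0 L, r x = -(w₁ x + w₃ x + lam * w₀ x) := by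
  set w₁ : ℝ → ℝ := fun x => f₁ x + volterra L (pdFst p) w₀ x with hw₁
  set w₂ : ℝ → ℝ := fun x => f₂ x + volterraD₂ L lam 0 p w₀ x with hw₂
  set w₃ : ℝ → ℝ := fun x => f₃ x + volterraD₃ L lam 0 p w₀ w₁ x with hw₃
  have c₁ : Continuous w₁ := hf.c₁.add (continuous_volterra hp.smooth₁.continuous hw)
  have d₀ : ∀ x ∈ Set.Ioo 0 L, HasDerivAt w₀ (w₁ x) x := by
    intro x hx
    have hv := hasDerivAt_volterra (L := L) (hp.smooth.of_le (by norm_num)) hw x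
    rw [hp.diag x (Set.Ioo_subset_Icc_self hx), zero_mul, sub_zero] at hv
    refine ((hf.d₀ x hx).add hv).congr_of_eventuallyEq ?_
    filter_upwards [Icc_mem_nhds hx.1 hx.2] with y hy
    have := hwf y hy
    simp only [Pi.add_apply]
    linarith
  have hv := hp.derivChain_volterra hw c₁ d₀
  have hc : DerivChain L w₀ w₁ w₂ w₃ :=
    ⟨hw, c₁, hf.c₂.add hv.c₂, hf.c₃.add hv.c₃, d₀,
      fun x hx => (hf.d₁ x hx).add (hv.d₁ x hx), fun x hx => (hf.d₂ x hx).add (hv.d₂ x hx)⟩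
  have mem0 : (0 : ℝ) ∈ Set.Icc 0 L := ⟨le_rfl, hL.le⟩
  have memL : L ∈ Set.Icc 0 L := ⟨hL.le, le_rfl⟩
  have b0 : w₀ 0 = 0 := by
    have h3 : volterra L p w₀ 0 = 0 := by
      unfold volterra
      rw [intervalIntegral.integral_congr (g := fun _ => (0 : ℝ)) fun y hy => ?_,
        intervalIntegral.integral_zero]
      rw [Set.uIcc_of_le hL.le] at hy
      simp only [hp0 y hy, zero_mul]
    have := hwf 0 mem0
    linarith
  have bL : w₀ L = 0 := by
    have := hwf L memL
    rw [volterra_self] at this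
    linarith
  have bL1 : w₁ L = 0 := by simp only [hw₁, volterra_self, h2, add_zero]
  have bL2 : w₂ L = f₂ L := by simp only [hw₂, volterraD₂, volterra_self, bL]; ring
  refine ⟨w₁, w₂, w₃, hc, b0, bL, bL1, fun x _ => by simp only [hw₁]; ring,
    fun x _ => by simp only [hw₂]; ring, fun x _ => by simp only [hw₃]; ring, ?_⟩
  have k1 := hc.c₁
  have k3 := hc.c₃
  have ks : Continuous fun x => w₁ x + w₃ x := by fun_prop
  have kr : Continuous fun x => -(w₁ x + w₃ x + lam * w₀ x) := by fun_prop
  refine eq_of_volterra_eq hL.le hp.smooth.continuous hd hr kr hrd fun x hx => ?_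
  have e1 := hp.intertwine hL hc x hx
  have e2 : volterra L p (fun x => -(w₁ x + w₃ x + lam * w₀ x)) x
      = -(volterra L p (fun x => w₁ x + w₃ x) x + lam * volterra L p w₀ x) := by
    have e3 : (fun x => -(w₁ x + w₃ x + lam * w₀ x))
        = fun x => -1 * ((w₁ x + w₃ x) + lam * w₀ x) := by
      ext y; ring
    rw [e3, volterra_const_mul, volterra_add hp.smooth.continuous ks (by fun_prop),
      volterra_const_mul]
    ring
  rw [e2, e1, he x hx, bL, bL1, bL2]
  have e4 : w₁ x = f₁ x + volterra L (pdFst p) w₀ x := rfl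
  have e5 : w₃ x = f₃ x + volterraD₃ L lam 0 p w₀ w₁ x := rfl
  linear_combination -e4 - e5

/-- The direct backstepping transform intertwines `∂ₓ + ∂ₓ³` and `∂ₓ + ∂ₓ³ - μ`. -/
lemma BackstepKernel.direct_transform {μ d : ℝ} {k : ℝ → ℝ → ℝ} (hk : BackstepKernel L μ d k)
    (hkL : ∀ x ∈ Set.Icc 0 L, k x L = 0) (hL : 0 < L) (hf : DerivChain L f₀ f₁ f₂ f₃)
    (h1 : f₀ L = 0) :
    ∀ x ∈ Set.Icc 0 L,
      f₁ x + f₃ x - volterra L k (fun y => f₁ y + f₃ y) x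
        = (f₁ x - volterra L (pdFst k) f₀ x) + (f₃ x - volterraD₃ L μ d k f₀ f₁ x)
          - μ * (f₀ x - volterra L k f₀ x) + pdSnd k x L * f₁ L := by
  intro x hx
  rw [hk.intertwine hL hf x hx, hkL x hx, h1]
  ring

/-- `H³` control of the observer state by the transformed `∂ₓ + ∂ₓ³`. -/
lemma BackstepKernel.exists_chainSq_le {d : ℝ} {k : ℝ → ℝ → ℝ}
    (hk : BackstepKernel L (-lam) d k) (hkL : ∀ x ∈ Set.Icc 0 L, k x L = 0) (hL : 0 < L)
    (hlam : 0 < lam) :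
    ∃ C : ℝ, 0 ≤ C ∧ ∀ f₀ f₁ f₂ f₃ : ℝ → ℝ, DerivChain L f₀ f₁ f₂ f₃ →
      f₀ 0 = volterra L k f₀ 0 → f₀ L = 0 → f₁ L = 0 →
      chainSq L f₀ f₁ f₂ f₃
        ≤ C * sqInt L (fun x => f₁ x + f₃ x - volterra L k (fun y => f₁ y + f₃ y) x) := by
  obtain ⟨C, hC, h⟩ := exists_elliptic_le hL hlam
  obtain ⟨K, hK, hv⟩ := hk.exists_chainSq_equiv hL.le
  refine ⟨K * C, by positivity, fun f₀ f₁ f₂ f₃ hf h0 h1 h2 => ?_⟩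
  have hw := hf.sub (hk.derivChain_volterra hf.c₀ hf.c₁ hf.d₀)
  have hn : Continuous fun x => f₁ x + f₃ x := hf.c₁.add hf.c₃
  have e1 := (hv _ _ _ _ _ _ _ _ hf hw (fun _ _ => rfl) (fun _ _ => rfl) (fun _ _ => rfl)
    fun _ _ => rfl).2
  have e2 := h _ _ _ _ _ hw (hn.sub (continuous_volterra (L := L) hk.smooth.continuous hn))
    (by rw [← h0, sub_self]) (by rw [volterra_self, h1, sub_zero])
    (by rw [volterra_self, h2, sub_zero]) fun x hx => by
      have := hk.direct_transform hkL hL hf h1 x hx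
      rw [h2] at this
      simp only [Pi.sub_apply]
      linarith
  calc _ ≤ _ := e1
    _ ≤ K * (C * _) := mul_le_mul_of_nonneg_left e2 hK
    _ = _ := by rw [mul_assoc]; rfl

/-- Exponential decay from a differential inequality. -/
lemma le_exp_mul_of_deriv_le {V V' : ℝ → ℝ} {c : ℝ} (hV : ContinuousOn V (Set.Ici 0))
    (hd : ∀ t > 0, HasDerivAt V (V' t) t) (h : ∀ t > 0, V' t ≤ -c * V t) :
    ∀ t ≥ 0, V t ≤ Real.exp (-c * t) * V 0 := by
  have he : ∀ t, HasDerivAt (fun t => Real.exp (c * t)) (Real.exp (c * t) * c) t := fun t => by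
    simpa using ((hasDerivAt_id t).const_mul c).exp
  have ha : AntitoneOn (fun t => Real.exp (c * t) * V t) (Set.Ici 0) := by
    refine antitoneOn_of_deriv_nonpos (convex_Ici 0)
      ((Continuous.continuousOn (by fun_prop)).mul hV) ?_ ?_
    · rw [interior_Ici]
      exact fun t ht => ((he t).mul (hd t ht)).differentiableAt.differentiableWithinAt
    · rw [interior_Ici]
      intro t ht
      have hder := ((he t).mul (hd t ht)).deriv
      change deriv (fun t => Real.exp (c * t) * V t) t = _ at hder
      rw [hder]
      have h1 := mul_le_mul_of_nonneg_left (h t ht) (Real.exp_pos (c * t)).le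
      linarith
  intro t ht
  have h1 : Real.exp (c * t) * V t ≤ Real.exp (c * 0) * V 0 := ha Set.self_mem_Ici ht ht
  rw [mul_zero, Real.exp_zero, one_mul] at h1
  calc V t = Real.exp (-c * t) * (Real.exp (c * t) * V t) := by
        rw [← mul_assoc, ← Real.exp_add]; simp
    _ ≤ _ := mul_le_mul_of_nonneg_left h1 (Real.exp_pos _).le

end Transforms

lemma eq_of_eq_nonneg {f g : ℝ → ℝ} {a b t : ℝ} (ht : 0 < t) (h : ∀ s ≥ 0, f s = g s)
    (hf : HasDerivAt f a t) (hg : HasDerivAt g b t) : a = b := by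
  refine hf.unique (hg.congr_of_eventuallyEq ?_)
  filter_upwards [Ici_mem_nhds ht] with s hs using h s hs

namespace DerivChain

variable {L : ℝ} {f₀ f₁ f₂ f₃ g₀ g₁ g₂ g₃ : ℝ → ℝ}

lemma eq_of_eq (hL : 0 < L) (hf : DerivChain L f₀ f₁ f₂ f₃) (hg : DerivChain L g₀ g₁ g₂ g₃)
    (h : ∀ x ∈ Set.Icc 0 L, f₀ x = g₀ x) :
    (∀ x ∈ Set.Icc 0 L, f₁ x = g₁ x) ∧ (∀ x ∈ Set.Icc 0 L, f₂ x = g₂ x)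
      ∧ ∀ x ∈ Set.Icc 0 L, f₃ x = g₃ x := by
  have h1 := eq_on_Icc_of_eq_on_Ioo hL hf.c₁ hg.c₁ fun x hx =>
    hasDerivAt_eq_of_eq_on hx h (hf.d₀ x hx) (hg.d₀ x hx)
  have h2 := eq_on_Icc_of_eq_on_Ioo hL hf.c₂ hg.c₂ fun x hx =>
    hasDerivAt_eq_of_eq_on hx h1 (hf.d₁ x hx) (hg.d₁ x hx)
  exact ⟨h1, h2, eq_on_Icc_of_eq_on_Ioo hL hf.c₃ hg.c₃ fun x hx =>
    hasDerivAt_eq_of_eq_on hx h2 (hf.d₂ x hx) (hg.d₂ x hx)⟩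

lemma const_mul (hf : DerivChain L f₀ f₁ f₂ f₃) (c : ℝ) :
    DerivChain L (fun x => c * f₀ x) (fun x => c * f₁ x) (fun x => c * f₂ x)
      (fun x => c * f₃ x) where
  c₀ := continuous_const.mul hf.c₀
  c₁ := continuous_const.mul hf.c₁
  c₂ := continuous_const.mul hf.c₂
  c₃ := continuous_const.mul hf.c₃
  d₀ x hx := (hf.d₀ x hx).const_mul c
  d₁ x hx := (hf.d₁ x hx).const_mul c
  d₂ x hx := (hf.d₂ x hx).const_mul c

lemma reflect (hf : DerivChain L f₀ f₁ f₂ f₃) :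
    DerivChain L (fun x => f₀ (L - x)) (fun x => -f₁ (L - x)) (fun x => f₂ (L - x))
      (fun x => -f₃ (L - x)) := by
  have c₀ := hf.c₀
  have c₁ := hf.c₁
  have c₂ := hf.c₂
  have c₃ := hf.c₃
  have mem : ∀ x ∈ Set.Ioo 0 L, L - x ∈ Set.Ioo 0 L := fun x hx =>
    ⟨by linarith [hx.2], by linarith [hx.1]⟩
  refine ⟨by fun_prop, by fun_prop, by fun_prop, by fun_prop, fun x hx => ?_, fun x hx => ?_,
    fun x hx => ?_⟩
  · exact (hf.d₀ _ (mem x hx)).comp_const_sub L x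
  · exact ((hf.d₁ _ (mem x hx)).comp_const_sub L x).neg.congr_deriv (neg_neg _)
  · exact (hf.d₂ _ (mem x hx)).comp_const_sub L x

end DerivChain

lemma BackstepKernel.derivChain_slice {L μ d : ℝ} {q : ℝ → ℝ → ℝ} (hq : BackstepKernel L μ d q)
    (y : ℝ) :
    DerivChain L (fun x => q x y) (fun x => pdFst q x y) (fun x => pdFst (pdFst q) x y)
      (fun x => pdFst (pdFst (pdFst q)) x y) := by
  have hy : Continuous fun x : ℝ => (x, y) := by fun_prop
  exact ⟨hq.smooth.continuous.comp hy, hq.smooth₁.continuous.comp hy,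
    hq.smooth₁₁.continuous.comp hy, hq.continuous₁₁₁.comp hy,
    fun x _ => hasDerivAt_pdFst (hq.smooth.of_le (by norm_num)) x y,
    fun x _ => hasDerivAt_pdFst (hq.smooth₁.of_le (by norm_num)) x y,
    fun x _ => hasDerivAt_pdFst hq.smooth₁₁ x y⟩

/-- Space derivatives of a forced linear KdV equation. -/
lemma Smooth₂.kdv_derivs {L μ d c t : ℝ} {q U : ℝ → ℝ → ℝ} (hq : BackstepKernel L μ d q)
    (hL : 0 < L) (h : Smooth₂ U)
    (he : ∀ x ∈ Set.Icc 0 L,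
      pdFst U t x = -(pdSnd U t x + pdSnd (pdSnd (pdSnd U)) t x) + c * q x L) :
    (∀ x ∈ Set.Icc 0 L, pdSnd (pdFst U) t x
      = -(pdSnd (pdSnd U) t x + pdSnd (pdSnd (pdSnd (pdSnd U))) t x) + c * pdFst q x L)
    ∧ ∀ x ∈ Set.Icc 0 L, pdSnd (pdSnd (pdSnd (pdFst U))) t x
      = -(pdSnd (pdSnd (pdSnd (pdSnd U))) t x
          + pdSnd (pdSnd (pdSnd (pdSnd (pdSnd (pdSnd U))))) t x)
        + c * pdFst (pdFst (pdFst q)) x L := by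
  have hn := ((h.snd.derivChain L t).add (h.snd.snd.snd.derivChain L t)).const_mul (-1)
  obtain ⟨h1, -, h3⟩ := (h.fst.derivChain L t).eq_of_eq hL
    (hn.add ((hq.derivChain_slice L).const_mul c)) fun x hx => by rw [he x hx, neg_one_mul]
  exact ⟨fun x hx => by rw [h1 x hx, neg_one_mul], fun x hx => by rw [h3 x hx, neg_one_mul]⟩

/-- The observer error system. -/
structure ErrorSystem (L : ℝ) (p e : ℝ → ℝ → ℝ) : Prop where
  smooth : Smooth₂ e
  kdv : ∀ t ≥ 0, ∀ x ∈ Set.Icc 0 L,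
    pdFst e t x = -(pdSnd e t x + pdSnd (pdSnd (pdSnd e)) t x) + pdSnd (pdSnd e) t L * p x L
  left : ∀ t ≥ 0, e t 0 = 0
  right : ∀ t ≥ 0, e t L = 0
  right' : ∀ t ≥ 0, pdSnd e t L = 0

/-- The observer, driven by the output error `e`, with kernel feedback. -/
structure ObserverSystem (L : ℝ) (k p e v : ℝ → ℝ → ℝ) : Prop where
  smooth : Smooth₂ v
  kdv : ∀ t ≥ 0, ∀ x ∈ Set.Icc 0 L,
    pdFst v t x = -(pdSnd v t x + pdSnd (pdSnd (pdSnd v)) t x) + -pdSnd (pdSnd e) t L * p x L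
  left : ∀ t ≥ 0, v t 0 = volterra L k (v t) 0
  right : ∀ t ≥ 0, v t L = 0
  right' : ∀ t ≥ 0, pdSnd v t L = 0

/-- A bounded operator inverting `I - Q` for the Volterra operator `Q` with kernel `q`. -/
def IsResolvent {L : ℝ} (hL : 0 ≤ L) (q : ℝ → ℝ → ℝ)
    (S : C(Set.Icc (0 : ℝ) L, ℝ) →L[ℝ] C(Set.Icc (0 : ℝ) L, ℝ)) : Prop :=
  ∀ f g, (∀ x ∈ Set.Icc 0 L,
    extendIcc hL g x - volterra L q (extendIcc hL g) x = extendIcc hL f x) ↔ g = S f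

namespace ErrorSystem

variable {L lam : ℝ} {p e : ℝ → ℝ → ℝ}
  {S : C(Set.Icc (0 : ℝ) L, ℝ) →L[ℝ] C(Set.Icc (0 : ℝ) L, ℝ)}

lemma resolvent_curve (hL : 0 ≤ L) (hS : IsResolvent hL p S) {U : ℝ → ℝ → ℝ} (h : Smooth₂ U)
    (t : ℝ) : ∀ x ∈ Set.Icc 0 L, extendIcc hL (S (h.curve L t)) x
      - volterra L p (extendIcc hL (S (h.curve L t))) x = U t x := by
  intro x hx
  rw [(hS _ _).2 rfl x hx, h.extendIcc_curve hL t hx]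

/-- The error state is controlled in `H³` by its transformed time derivative. -/
lemma exists_chainSq_le (hp : BackstepKernel L lam 0 p) (hp0 : ∀ y ∈ Set.Icc 0 L, p 0 y = 0)
    (hL : 0 < L) (hlam : 0 < lam) (hS : IsResolvent hL.le p S) :
    ∃ C : ℝ, 0 ≤ C ∧ ∀ e (h : ErrorSystem L p e), ∀ t ≥ 0,
      chainSq L (e t) (pdSnd e t) (pdSnd (pdSnd e) t) (pdSnd (pdSnd (pdSnd e)) t)
          ≤ C * sqInt L (extendIcc hL.le (S (h.smooth.fst.curve L t)))
        ∧ pdSnd (pdSnd e) t L ^ 2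
          ≤ C * sqInt L (extendIcc hL.le (S (h.smooth.fst.curve L t))) := by
  obtain ⟨C₁, n₁, h₁⟩ := exists_elliptic_le hL hlam
  obtain ⟨C₂, n₂, h₂⟩ := hp.exists_chainSq_equiv hL.le
  obtain ⟨C₃, n₃, h₃⟩ := exists_trace_sq_le hL
  refine ⟨C₂ * C₁ + C₃ * (C₂ * C₁), by positivity, fun e h t ht => ?_⟩
  have hc := h.smooth.derivChain L t
  have hz := continuous_extendIcc hL.le (S (h.smooth.fst.curve L t))
  obtain ⟨w₁, w₂, w₃, hw, b0, bL, bL1, e₁, e₂, e₃, er⟩ := hp.inverse_transform hp0 hL hc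
    (h.smooth.fst.continuous_snd t) (continuous_extendIcc hL.le (S (h.smooth.curve L t))) hz
    (resolvent_curve hL.le hS h.smooth t) (resolvent_curve hL.le hS h.smooth.fst t)
    (fun x hx => by rw [h.kdv t ht x hx, mul_comm (p x L)])
    (h.left t ht) (h.right t ht) (h.right' t ht)
  have a₁ := h₁ _ _ _ _ _ hw hz.neg b0 bL bL1 fun x hx => by
    rw [Pi.neg_apply, er x hx, neg_neg]
  have a₂ := (h₂ _ _ _ _ _ _ _ _ hw hc (resolvent_curve hL.le hS h.smooth t) e₁ e₂ e₃).1
  have a₃ := h₃ _ _ _ _ hc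
  have en := sqInt_neg (L := L) (f := extendIcc hL.le (S (h.smooth.fst.curve L t)))
  change sqInt L (-extendIcc hL.le (S (h.smooth.fst.curve L t))) = _ at en
  rw [en] at a₁
  set N := sqInt L (extendIcc hL.le (S (h.smooth.fst.curve L t))) with hN
  have nN : 0 ≤ N := sqInt_nonneg hL.le
  have a₄ := a₂.trans (mul_le_mul_of_nonneg_left a₁ n₂)
  have a₅ := a₃.trans (mul_le_mul_of_nonneg_left a₄ n₃)
  have m₁ : 0 ≤ C₂ * C₁ * N := by positivity
  have m₂ : 0 ≤ C₃ * (C₂ * C₁) * N := by positivity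
  exact ⟨by linarith, by linarith⟩

/-- The transformed time derivative of the error solves the target equation. -/
lemma target (hp : BackstepKernel L lam 0 p) (hp0 : ∀ y ∈ Set.Icc 0 L, p 0 y = 0)
    (hL : 0 < L) (hS : IsResolvent hL.le p S) (h : ErrorSystem L p e) {t : ℝ} (ht : 0 < t) :
    ∃ z₁ z₂ z₃ : ℝ → ℝ,
      DerivChain L (extendIcc hL.le (S (h.smooth.fst.curve L t))) z₁ z₂ z₃
      ∧ extendIcc hL.le (S (h.smooth.fst.curve L t)) 0 = 0
      ∧ extendIcc hL.le (S (h.smooth.fst.curve L t)) L = 0 ∧ z₁ L = 0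
      ∧ (∀ x ∈ Set.Icc 0 L, z₁ x
          - volterra L (pdFst p) (extendIcc hL.le (S (h.smooth.fst.curve L t))) x
          = pdSnd (pdFst e) t x)
      ∧ ∀ x ∈ Set.Icc 0 L, extendIcc hL.le (S (h.smooth.fst.fst.curve L t)) x
          = -(z₁ x + z₃ x + lam * extendIcc hL.le (S (h.smooth.fst.curve L t)) x) := by
  have hs := h.smooth
  have b0 := eq_of_eq_nonneg ht h.left (hs.hasDerivAt_fst t 0) (hasDerivAt_const t 0)
  have bL := eq_of_eq_nonneg ht h.right (hs.hasDerivAt_fst t L) (hasDerivAt_const t 0)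
  have bL1 := eq_of_eq_nonneg ht h.right' (hs.snd.hasDerivAt_fst t L) (hasDerivAt_const t 0)
  rw [hs.comm] at bL1
  have he : ∀ x ∈ Set.Icc 0 L, pdFst (pdFst e) t x
      = -(pdSnd (pdFst e) t x + pdSnd (pdSnd (pdSnd (pdFst e))) t x)
        + p x L * pdSnd (pdSnd (pdFst e)) t L := by
    intro x hx
    have := eq_of_eq_nonneg ht (fun s hs => h.kdv s hs x hx) (hs.fst.hasDerivAt_fst t x)
      (((hs.snd.hasDerivAt_fst t x).add (hs.snd.snd.snd.hasDerivAt_fst t x)).neg.add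
        ((hs.snd.snd.hasDerivAt_fst t L).mul_const (p x L)))
    rw [this, hs.snd.snd.comm, hs.snd.comm, hs.comm]
    ring
  obtain ⟨z₁, z₂, z₃, hz, c0, cL, cL1, e₁, -, -, er⟩ := hp.inverse_transform hp0 hL
    (hs.fst.derivChain L t) (hs.fst.fst.continuous_snd t)
    (continuous_extendIcc hL.le (S (hs.fst.curve L t)))
    (continuous_extendIcc hL.le (S (hs.fst.fst.curve L t)))
    (resolvent_curve hL.le hS hs.fst t) (resolvent_curve hL.le hS hs.fst.fst t) he b0 bL bL1
  exact ⟨z₁, z₂, z₃, hz, c0, cL, cL1, e₁, er⟩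

end ErrorSystem

lemma exists_sqInt_comb_le {L : ℝ} {a b c d : ℝ → ℝ} (hL : 0 ≤ L) (ha : Continuous a)
    (hb : Continuous b) (hc : Continuous c) (hd : Continuous d) :
    ∃ C : ℝ, 0 ≤ C ∧ ∀ f g h l : ℝ → ℝ, Continuous f → Continuous g → Continuous h →
      Continuous l → sqInt L (fun x => a x * f x + b x * g x + (c x * h x + d x * l x))
        ≤ C * (sqInt L f + sqInt L g + sqInt L h + sqInt L l) := by
  obtain ⟨A₁, m₁, h₁⟩ := exists_sqInt_mul_le hL ha
  obtain ⟨A₂, m₂, h₂⟩ := exists_sqInt_mul_le hL hb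
  obtain ⟨A₃, m₃, h₃⟩ := exists_sqInt_mul_le hL hc
  obtain ⟨A₄, m₄, h₄⟩ := exists_sqInt_mul_le hL hd
  refine ⟨4 * (A₁ + A₂ + A₃ + A₄), by positivity, fun f g h l hf hg hh hl => ?_⟩
  have s := sqInt_add_le hL ((ha.mul hf).add (hb.mul hg)) ((hc.mul hh).add (hd.mul hl))
  have s₁ := sqInt_add_le hL (ha.mul hf) (hb.mul hg)
  have s₂ := sqInt_add_le hL (hc.mul hh) (hd.mul hl)
  have e₁ := h₁ f hf
  have e₂ := h₂ g hg
  have e₃ := h₃ h hh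
  have e₄ := h₄ l hl
  have n₁ := sqInt_nonneg (f := f) hL
  have n₂ := sqInt_nonneg (f := g) hL
  have n₃ := sqInt_nonneg (f := h) hL
  have n₄ := sqInt_nonneg (f := l) hL
  change sqInt L (fun x => a x * f x + b x * g x + (c x * h x + d x * l x)) ≤
    2 * sqInt L (fun x => a x * f x + b x * g x)
      + 2 * sqInt L (fun x => c x * h x + d x * l x) at s
  change sqInt L (fun x => a x * f x + b x * g x) ≤
    2 * sqInt L (fun x => a x * f x) + 2 * sqInt L (fun x => b x * g x) at s₁
  change sqInt L (fun x => c x * h x + d x * l x) ≤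
    2 * sqInt L (fun x => c x * h x) + 2 * sqInt L (fun x => d x * l x) at s₂
  calc _ ≤ 4 * (A₁ * sqInt L f + A₂ * sqInt L g + A₃ * sqInt L h + A₄ * sqInt L l) := by linarith
    _ ≤ 4 * ((A₁ + A₂ + A₃ + A₄) * sqInt L f + (A₁ + A₂ + A₃ + A₄) * sqInt L g
        + (A₁ + A₂ + A₃ + A₄) * sqInt L h + (A₁ + A₂ + A₃ + A₄) * sqInt L l) := by
      gcongr <;> linarith
    _ = _ := by ring

/-- A function whose second derivative is supported at the right end, where it carries the trace
of `∂ₓ²e`. -/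
noncomputable def corrector (L : ℝ) (e : ℝ → ℝ → ℝ) : ℝ → ℝ → ℝ :=
  fun t s => s ^ 3 / L ^ 3 * e t s

/-- The potential of the residual of the corrector in the target equation. -/
noncomputable def correctorPotential (L lam : ℝ) (e : ℝ → ℝ → ℝ) : ℝ → ℝ → ℝ := fun t s =>
  pdSnd (pdSnd (corrector L e)) t s + pdSnd (pdSnd (pdSnd (pdSnd (corrector L e)))) t s
    - lam * pdSnd (corrector L e) t s - pdFst (pdSnd (corrector L e)) t s

namespace Smooth₂

variable {L : ℝ} {e : ℝ → ℝ → ℝ}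

lemma corrector (h : Smooth₂ e) : Smooth₂ (corrector L e) := by
  have h2 : ContDiff ℝ (⊤ : ℕ∞) fun q : ℝ × ℝ => q.2 ^ 3 / L ^ 3 := by fun_prop
  exact h2.mul h

lemma pdSnd_corrector (h : Smooth₂ e) : pdSnd (_root_.corrector L e) = fun t s =>
    (3 * s ^ 2 * e t s + s ^ 3 * pdSnd e t s) / L ^ 3 := by
  funext t s
  refine HasDerivAt.deriv ?_
  refine ((((hasDerivAt_id s).pow 3).div_const (L ^ 3)).mul (h.hasDerivAt_snd t s)).congr_deriv ?_
  simp
  ring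

lemma pdSnd₂_corrector (h : Smooth₂ e) : pdSnd (pdSnd (_root_.corrector L e)) = fun t s =>
    (6 * s * e t s + 6 * s ^ 2 * pdSnd e t s + s ^ 3 * pdSnd (pdSnd e) t s) / L ^ 3 := by
  funext t s
  rw [h.pdSnd_corrector]
  refine HasDerivAt.deriv ?_
  refine ((((((hasDerivAt_id s).pow 2).const_mul 3).mul (h.hasDerivAt_snd t s)).add
    (((hasDerivAt_id s).pow 3).mul (h.snd.hasDerivAt_snd t s))).div_const (L ^ 3)).congr_deriv ?_
  simp
  ring

lemma pdSnd₃_corrector (h : Smooth₂ e) : pdSnd (pdSnd (pdSnd (_root_.corrector L e))) = fun t s =>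
    (6 * e t s + 18 * s * pdSnd e t s + 9 * s ^ 2 * pdSnd (pdSnd e) t s
      + s ^ 3 * pdSnd (pdSnd (pdSnd e)) t s) / L ^ 3 := by
  funext t s
  rw [h.pdSnd₂_corrector]
  refine HasDerivAt.deriv ?_
  refine ((((((hasDerivAt_id s).const_mul 6).mul (h.hasDerivAt_snd t s)).add
    ((((hasDerivAt_id s).pow 2).const_mul 6).mul (h.snd.hasDerivAt_snd t s))).add
    (((hasDerivAt_id s).pow 3).mul (h.snd.snd.hasDerivAt_snd t s))).div_const (L ^ 3)).congr_deriv ?_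
  simp
  ring

lemma pdSnd₄_corrector (h : Smooth₂ e) :
    pdSnd (pdSnd (pdSnd (pdSnd (_root_.corrector L e)))) = fun t s =>
    (24 * pdSnd e t s + 36 * s * pdSnd (pdSnd e) t s + 12 * s ^ 2 * pdSnd (pdSnd (pdSnd e)) t s
      + s ^ 3 * pdSnd (pdSnd (pdSnd (pdSnd e))) t s) / L ^ 3 := by
  funext t s
  rw [h.pdSnd₃_corrector]
  refine HasDerivAt.deriv ?_
  refine (((((((h.hasDerivAt_snd t s).const_mul 6).add
    (((hasDerivAt_id s).const_mul 18).mul (h.snd.hasDerivAt_snd t s))).add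
    ((((hasDerivAt_id s).pow 2).const_mul 9).mul (h.snd.snd.hasDerivAt_snd t s))).add
    (((hasDerivAt_id s).pow 3).mul (h.snd.snd.snd.hasDerivAt_snd t s))).div_const
      (L ^ 3))).congr_deriv ?_
  simp
  ring

lemma pdFst_pdSnd_corrector (h : Smooth₂ e) : pdFst (pdSnd (_root_.corrector L e)) = fun t s =>
    (3 * s ^ 2 * pdFst e t s + s ^ 3 * pdSnd (pdFst e) t s) / L ^ 3 := by
  funext t s
  rw [h.pdSnd_corrector, ← h.comm]
  refine HasDerivAt.deriv ?_
  exact ((((h.hasDerivAt_fst t s).const_mul (3 * s ^ 2)).add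
    ((h.snd.hasDerivAt_fst t s).const_mul (s ^ 3))).div_const (L ^ 3))

lemma continuous_correctorPotential (h : Smooth₂ e) (lam t : ℝ) :
    Continuous (correctorPotential L lam e t) := by
  have hB := h.corrector (L := L)
  exact (((hB.snd.snd.continuous_snd t).add (hB.snd.snd.snd.snd.continuous_snd t)).sub
    (continuous_const.mul (hB.snd.continuous_snd t))).sub (hB.snd.fst.continuous_snd t)

lemma hasDerivAt_correctorPotential (h : Smooth₂ e) (lam t s : ℝ) :
    HasDerivAt (correctorPotential L lam e t)
      (pdSnd (pdSnd (pdSnd (_root_.corrector L e))) t s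
        + pdSnd (pdSnd (pdSnd (pdSnd (pdSnd (_root_.corrector L e))))) t s
        - lam * pdSnd (pdSnd (_root_.corrector L e)) t s
        - pdFst (pdSnd (pdSnd (_root_.corrector L e))) t s) s := by
  have hB := h.corrector (L := L)
  rw [hB.snd.comm]
  exact (((hB.snd.snd.hasDerivAt_snd t s).add (hB.snd.snd.snd.snd.hasDerivAt_snd t s)).sub
    ((hB.snd.hasDerivAt_snd t s).const_mul lam)).sub (hB.snd.fst.hasDerivAt_snd t s)

end Smooth₂

lemma exists_sqInt_corrector_le {L : ℝ} (hL : 0 < L) :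
    ∃ C : ℝ, 0 ≤ C ∧ ∀ e, Smooth₂ e → ∀ t,
      sqInt L (pdSnd (pdSnd (corrector L e)) t) ≤
        C * chainSq L (e t) (pdSnd e t) (pdSnd (pdSnd e) t) (pdSnd (pdSnd (pdSnd e)) t) := by
  obtain ⟨C, hC, h⟩ := exists_sqInt_comb_le (a := fun s => 6 * s / L ^ 3)
    (b := fun s => 6 * s ^ 2 / L ^ 3) (c := fun s => s ^ 3 / L ^ 3) (d := fun _ => 0) hL.le
    (by fun_prop) (by fun_prop) (by fun_prop) (by fun_prop)
  refine ⟨C, hC, fun e he t => ?_⟩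
  refine le_trans (le_of_eq ?_) (h _ _ _ _ (he.continuous_snd t) (he.snd.continuous_snd t)
    (he.snd.snd.continuous_snd t) (he.snd.snd.snd.continuous_snd t))
  refine sqInt_congr hL.le fun x _ => ?_
  rw [he.pdSnd₂_corrector]
  ring

namespace ErrorSystem

variable {L lam : ℝ} {p e : ℝ → ℝ → ℝ}

lemma exists_sqInt_correctorPotential_le (hp : BackstepKernel L lam 0 p) (hL : 0 < L) :
    ∃ C : ℝ, 0 ≤ C ∧ ∀ e, ErrorSystem L p e → ∀ t ≥ 0,
      sqInt L (correctorPotential L lam e t) ≤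
        C * (chainSq L (e t) (pdSnd e t) (pdSnd (pdSnd e) t) (pdSnd (pdSnd (pdSnd e)) t)
          + sqInt L (pdFst e t) + sqInt L (pdSnd (pdFst e) t) + pdSnd (pdSnd e) t L ^ 2) := by
  obtain ⟨C₁, m₁, h₁⟩ := exists_sqInt_comb_le
    (a := fun s => (6 * s - lam * (3 * s ^ 2)) / L ^ 3)
    (b := fun s => (24 + 6 * s ^ 2 - lam * s ^ 3) / L ^ 3) (c := fun s => 36 * s / L ^ 3)
    (d := fun s => 12 * s ^ 2 / L ^ 3) hL.le
    (by fun_prop) (by fun_prop) (by fun_prop) (by fun_prop)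
  have hc := (hp.derivChain_slice L).c₁
  obtain ⟨C₂, m₂, h₂⟩ := exists_sqInt_comb_le
    (a := fun s => -(3 * s ^ 2) / L ^ 3) (b := fun s => -2 * s ^ 3 / L ^ 3)
    (c := fun s => s ^ 3 * pdFst p s L / L ^ 3) (d := fun _ => 0) hL.le
    (by fun_prop) (by fun_prop) (by fun_prop) (by fun_prop)
  refine ⟨2 * C₁ + 2 * C₂ * (1 + 2 * L), by positivity, fun e h t ht => ?_⟩
  have he := h.smooth
  obtain ⟨e₄, -⟩ := he.kdv_derivs hp hL (h.kdv t ht)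
  have c0 := he.continuous_snd t
  have c1 := he.snd.continuous_snd t
  have c2 := he.snd.snd.continuous_snd t
  have c3 := he.snd.snd.snd.continuous_snd t
  have ct := he.fst.continuous_snd t
  have ctx := he.fst.snd.continuous_snd t
  have cg : Continuous fun _ : ℝ => pdSnd (pdSnd e) t L := continuous_const
  have i₁ := h₁ _ _ _ _ c0 c1 c2 c3
  have i₂ := h₂ _ _ _ _ ct ctx cg cg
  have eg : sqInt L (fun _ : ℝ => pdSnd (pdSnd e) t L) = L * pdSnd (pdSnd e) t L ^ 2 := by
    simp [sqInt]
  have eH : ∀ x ∈ Set.Icc 0 L, correctorPotential L lam e t x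
      = (((6 * x - lam * (3 * x ^ 2)) / L ^ 3 * e t x
        + (24 + 6 * x ^ 2 - lam * x ^ 3) / L ^ 3 * pdSnd e t x)
        + (36 * x / L ^ 3 * pdSnd (pdSnd e) t x
          + 12 * x ^ 2 / L ^ 3 * pdSnd (pdSnd (pdSnd e)) t x))
      + ((-(3 * x ^ 2) / L ^ 3 * pdFst e t x + -2 * x ^ 3 / L ^ 3 * pdSnd (pdFst e) t x)
        + (x ^ 3 * pdFst p x L / L ^ 3 * pdSnd (pdSnd e) t L + 0 * pdSnd (pdSnd e) t L)) := by
    intro x hx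
    have e' : pdSnd (pdSnd (pdSnd (pdSnd e))) t x = -pdSnd (pdFst e) t x - pdSnd (pdSnd e) t x
        + pdSnd (pdSnd e) t L * pdFst p x L := by linarith [e₄ x hx]
    rw [correctorPotential, he.pdSnd₄_corrector, he.pdSnd₂_corrector,
      he.pdFst_pdSnd_corrector, he.pdSnd_corrector]
    beta_reduce
    rw [e']
    ring
  have i₃ : sqInt L (correctorPotential L lam e t) ≤ _ := (sqInt_congr hL.le eH).trans_le
    (sqInt_add_le hL.le (by fun_prop) (by fun_prop))
  rw [eg] at i₂
  have := sqInt_nonneg (f := pdFst e t) hL.le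
  have := sqInt_nonneg (f := pdSnd (pdFst e) t) hL.le
  have := chainSq_nonneg (f₀ := e t) (f₁ := pdSnd e t) (f₂ := pdSnd (pdSnd e) t)
    (f₃ := pdSnd (pdSnd (pdSnd e)) t) hL.le
  set N := chainSq L (e t) (pdSnd e t) (pdSnd (pdSnd e) t) (pdSnd (pdSnd (pdSnd e)) t) with hN
  rw [chainSq] at hN
  rw [← hN] at i₁
  have m : 0 ≤ C₁ * (sqInt L (pdFst e t) + sqInt L (pdSnd (pdFst e) t)
      + pdSnd (pdSnd e) t L ^ 2) := by positivity
  have m' : 0 ≤ C₂ * (1 + 2 * L) * N + 2 * C₂ * L * (sqInt L (pdFst e t) + sqInt L (pdSnd (pdFst e) t))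
      + C₂ * pdSnd (pdSnd e) t L ^ 2 := by positivity
  nlinarith

end ErrorSystem

/-- The spatial part of the linear KdV operator. -/
noncomputable def kdvOp (v : ℝ → ℝ → ℝ) : ℝ → ℝ → ℝ :=
  fun t x => pdSnd v t x + pdSnd (pdSnd (pdSnd v)) t x

namespace Smooth₂

variable {L : ℝ} {U V : ℝ → ℝ → ℝ}

lemma kdvOp (h : Smooth₂ U) : Smooth₂ (kdvOp U) := h.snd.add h.snd.snd.snd

lemma pdSnd_add (h : Smooth₂ U) (h' : Smooth₂ V) :
    pdSnd (fun t x => U t x + V t x) = fun t x => pdSnd U t x + pdSnd V t x := by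
  funext t x
  exact ((h.hasDerivAt_snd t x).add (h'.hasDerivAt_snd t x)).deriv

lemma pdFst_add (h : Smooth₂ U) (h' : Smooth₂ V) :
    pdFst (fun t x => U t x + V t x) = fun t x => pdFst U t x + pdFst V t x := by
  funext t x
  exact ((h.hasDerivAt_fst t x).add (h'.hasDerivAt_fst t x)).deriv

lemma pdSnd_kdvOp (h : Smooth₂ U) : pdSnd (_root_.kdvOp U) = _root_.kdvOp (pdSnd U) :=
  h.snd.pdSnd_add h.snd.snd.snd

lemma pdFst_kdvOp (h : Smooth₂ U) : pdFst (_root_.kdvOp U) = _root_.kdvOp (pdFst U) := by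
  have e := h.snd.pdFst_add h.snd.snd.snd
  rw [h.comm, h.snd.snd.comm, h.snd.comm, h.comm] at e
  exact e

lemma reflect_snd (h : Smooth₂ U) : Smooth₂ fun t x => U t (L - x) := by
  have h2 : ContDiff ℝ (⊤ : ℕ∞) fun q : ℝ × ℝ => (q.1, L - q.2) := by fun_prop
  exact ContDiff.comp h h2

lemma hasDerivAt_volterra_zero (h : Smooth₂ U) (hL : 0 ≤ L) {k : ℝ → ℝ → ℝ}
    (hk : Continuous (Function.uncurry k)) (t : ℝ) :
    HasDerivAt (fun s => volterra L k (U s) 0) (volterra L k (pdFst U t) 0) t := by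
  have h0 : (0 : ℝ) ∈ Set.Icc 0 L := ⟨le_rfl, hL⟩
  have hw : Continuous (k 0) := hk.comp (by fun_prop : Continuous fun y : ℝ => ((0 : ℝ), y))
  have e : ∀ {V : ℝ → ℝ → ℝ} (hV : Smooth₂ V) (s : ℝ),
      volterra L k (V s) 0 = weightedIntegral hL (k 0) hw (hV.curve L s) := by
    intro V hV s
    rw [weightedIntegral_apply]
    exact volterra_congr (fun x hx => (hV.extendIcc_curve hL s hx).symm) h0
  rw [e h.fst, funext (e h)]
  exact (weightedIntegral hL (k 0) hw).hasFDerivAt.comp_hasDerivAt t (h.hasDerivAt_curve L t)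

lemma hasDerivAt_energy_volterra (hU : Smooth₂ U) (hV : Smooth₂ V) (hL : 0 ≤ L)
    {k : ℝ → ℝ → ℝ} (hk : Continuous (Function.uncurry k)) {w : ℝ → ℝ} (hw : Continuous w)
    (c t : ℝ) :
    HasDerivAt (fun s => ∫ x in (0 : ℝ)..L,
        w x * (U s x - volterra L k (U s) x - c * V s x) ^ 2)
      (∫ x in (0 : ℝ)..L, 2 * (w x * (U t x - volterra L k (U t) x - c * V t x)
        * (pdFst U t x - volterra L k (pdFst U t) x - c * pdFst V t x))) t := by
  have e : ∀ {U V : ℝ → ℝ → ℝ} (hU : Smooth₂ U) (hV : Smooth₂ V) (s : ℝ),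
      ∀ x ∈ Set.Icc 0 L, extendIcc hL (hU.curve L s - volterraOp hL k hk (hU.curve L s)
        - c • hV.curve L s) x = U s x - volterra L k (U s) x - c * V s x := by
    intro U V hU hV s x hx
    rw [extendIcc_sub, extendIcc_sub, extendIcc_smul, extendIcc_volterraOp hL hk _ hx,
      hU.extendIcc_curve hL s hx, hV.extendIcc_curve hL s hx,
      volterra_congr (fun y hy => hU.extendIcc_curve hL s hy) hx]
  have hd := hasDerivAt_energy hL hw
    (((hU.hasDerivAt_curve L t).sub ((volterraOp hL k hk).hasFDerivAt.comp_hasDerivAt t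
      (hU.hasDerivAt_curve L t))).sub ((hV.hasDerivAt_curve L t).const_smul c))
  have hI : ∀ x ∈ Set.uIcc 0 L, x ∈ Set.Icc 0 L := fun x hx => by rwa [Set.uIcc_of_le hL] at hx
  convert hd using 1
  · funext s
    refine intervalIntegral.integral_congr fun x hx => ?_
    exact congrArg (fun r => w x * r ^ 2) (e hU hV s x (hI x hx)).symm
  · refine intervalIntegral.integral_congr fun x hx => ?_
    exact congrArg₂ (fun r r' => 2 * (w x * r * r')) (e hU hV t x (hI x hx)).symm
      (e hU.fst hV.fst t x (hI x hx)).symm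

end Smooth₂

lemma volterra_neg_add {L : ℝ} {q : ℝ → ℝ → ℝ} (hq : Continuous (Function.uncurry q))
    {f g : ℝ → ℝ} (hf : Continuous f) (hg : Continuous g) (c x : ℝ) :
    volterra L q (fun y => -f y + c * g y) x = -volterra L q f x + c * volterra L q g x := by
  have h := volterra_add (L := L) hq (f := fun y => -1 * f y) (g := fun y => c * g y)
    (by fun_prop) (by fun_prop) x
  rw [volterra_const_mul, volterra_const_mul] at h
  simpa only [neg_one_mul] using h

namespace ObserverSystem

variable {L lam : ℝ} {k p e v : ℝ → ℝ → ℝ}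

lemma boundary (hp : BackstepKernel L lam 0 p) (hk : Continuous (Function.uncurry k)) (hL : 0 < L)
    (hp0 : ∀ y ∈ Set.Icc 0 L, p 0 y = 0) (h : ObserverSystem L k p e v) {t : ℝ} (ht : 0 < t) :
    kdvOp v t L = 0 ∧ pdSnd (kdvOp v) t L = -(pdFst p L L * pdSnd (pdSnd e) t L)
      ∧ kdvOp v t 0 - volterra L k (kdvOp v t) 0
        = volterra L k (fun y => p y L) 0 * pdSnd (pdSnd e) t L
      ∧ ∀ x ∈ Set.Icc 0 L, pdFst (kdvOp v) t x
        = -(pdSnd (kdvOp v) t x + pdSnd (pdSnd (pdSnd (kdvOp v))) t x)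
          - pdSnd (pdSnd e) t L * (pdFst p x L + pdFst (pdFst (pdFst p)) x L) := by
  have hs := h.smooth
  have h0 : (0 : ℝ) ∈ Set.Icc 0 L := ⟨le_rfl, hL.le⟩
  have h1 : L ∈ Set.Icc 0 L := ⟨hL.le, le_rfl⟩
  have b0 := eq_of_eq_nonneg ht h.left (hs.hasDerivAt_fst t 0)
    (hs.hasDerivAt_volterra_zero hL.le hk t)
  have bL := eq_of_eq_nonneg ht h.right (hs.hasDerivAt_fst t L) (hasDerivAt_const t 0)
  have bL1 := eq_of_eq_nonneg ht h.right' (hs.snd.hasDerivAt_fst t L) (hasDerivAt_const t 0)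
  rw [hs.comm] at bL1
  have he := h.kdv t ht.le
  obtain ⟨d₁, d₃⟩ := hs.kdv_derivs hp hL he
  have e₁ : pdSnd (kdvOp v) = fun t x => pdSnd (pdSnd v) t x
      + pdSnd (pdSnd (pdSnd (pdSnd v))) t x := hs.pdSnd_kdvOp
  have e₃ : pdSnd (pdSnd (pdSnd (kdvOp v))) = kdvOp (pdSnd (pdSnd (pdSnd v))) := by
    rw [hs.pdSnd_kdvOp, hs.snd.pdSnd_kdvOp, hs.snd.snd.pdSnd_kdvOp]
  refine ⟨?_, ?_, ?_, fun x hx => ?_⟩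
  · have := he L h1
    rw [bL, hp.diag L h1] at this
    rw [kdvOp]
    linarith
  · have := d₁ L h1
    rw [bL1] at this
    rw [e₁]
    linarith
  · have h2 := he 0 h0
    rw [hp0 L h1, b0] at h2
    have hc : volterra L k (pdFst v t) 0 = -volterra L k (kdvOp v t) 0
        + -pdSnd (pdSnd e) t L * volterra L k (fun y => p y L) 0 := by
      rw [← volterra_neg_add hk (hs.kdvOp.continuous_snd t) (hp.derivChain_slice L).c₀]
      exact volterra_congr he h0
    have : kdvOp v t 0 = pdSnd v t 0 + pdSnd (pdSnd (pdSnd v)) t 0 := rfl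
    linarith
  · rw [hs.pdFst_kdvOp, e₃, e₁]
    simp only [kdvOp]
    rw [d₁ x hx, d₃ x hx]
    ring

/-- The observer state in target variables, corrected so as to vanish at both end points, is
dissipated up to the output error. -/
lemma exists_dissipation (hk : BackstepKernel L (-lam) (lam * L / 3) k)
    (hkL : ∀ x ∈ Set.Icc 0 L, k x L = 0) (hp : BackstepKernel L lam 0 p)
    (hp0 : ∀ y ∈ Set.Icc 0 L, p 0 y = 0) (hL : 0 < L) {ε c : ℝ} (hε : 0 < ε)
    (hc : c = volterra L k (fun y => p y L) 0) :
    ∃ C : ℝ, 0 ≤ C ∧ ∀ e v, ErrorSystem L p e → ObserverSystem L k p e v → ∀ t > 0,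
      ∫ x in (0 : ℝ)..L, 2 * ((1 + ε * x) * (kdvOp v t x - volterra L k (kdvOp v t) x
          - c * pdSnd (pdSnd (corrector L e)) t (L - x))
        * (pdFst (kdvOp v) t x - volterra L k (pdFst (kdvOp v) t) x
          - c * pdFst (pdSnd (pdSnd (corrector L e))) t (L - x)))
      ≤ -(2 * (lam - ε)) * (∫ x in (0 : ℝ)..L, (1 + ε * x) * (kdvOp v t x
          - volterra L k (kdvOp v t) x - c * pdSnd (pdSnd (corrector L e)) t (L - x)) ^ 2)
        + C * (pdSnd (pdSnd e) t L ^ 2 + sqInt L (correctorPotential L lam e t)) := by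
  obtain ⟨C, hC, hdis⟩ := _root_.exists_dissipation hL hε lam
  have hq := hp.derivChain_slice L
  set q : ℝ → ℝ := fun x => pdFst p x L + pdFst (pdFst (pdFst p)) x L with hqdef
  have cq : Continuous q := hq.c₁.add hq.c₃
  have ckL : Continuous fun x => pdSnd k x L := by
    have : ContDiff ℝ 2 (Function.uncurry (pdSnd k)) := hk.smooth₂
    exact this.continuous.comp (by fun_prop : Continuous fun x : ℝ => (x, L))
  set F : ℝ → ℝ := fun x => pdSnd k x L * pdFst p L L - (q x - volterra L k q x) with hF
  have cF : Continuous F :=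
    (ckL.mul continuous_const).sub (cq.sub (continuous_volterra hk.smooth.continuous cq))
  have nF := sqInt_nonneg (f := F) hL.le
  refine ⟨C * (pdFst p L L ^ 2 + sqInt L F + c ^ 2 + 1), by positivity, fun e v he hv t ht => ?_⟩
  obtain ⟨bL, bL1, b0, eqn⟩ := hv.boundary hp hk.smooth.continuous hL hp0 ht
  rw [← hc] at b0
  set g := pdSnd (pdSnd e) t L with hg
  have hs := hv.smooth.kdvOp
  have hB := he.smooth.corrector (L := L)
  have hn := hs.derivChain L t
  have hv' := hn.sub (hk.derivChain_volterra hn.c₀ hn.c₁ hn.d₀)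
  have hR := ((hB.snd.snd.derivChain L t).reflect).const_mul c
  have hch := hv'.sub hR
  have h0 : (0 : ℝ) ∈ Set.Icc 0 L := ⟨le_rfl, hL.le⟩
  have h1 : L ∈ Set.Icc 0 L := ⟨hL.le, le_rfl⟩
  have B2L : pdSnd (pdSnd (corrector L e)) t L = g := by
    rw [he.smooth.pdSnd₂_corrector]
    beta_reduce
    rw [he.right t ht.le, he.right' t ht.le]
    field_simp
    ring
  have B20 : pdSnd (pdSnd (corrector L e)) t 0 = 0 := by
    rw [he.smooth.pdSnd₂_corrector]
    simp
  have B30 : pdSnd (pdSnd (pdSnd (corrector L e))) t 0 = 0 := by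
    rw [he.smooth.pdSnd₃_corrector]
    simp [he.left t ht.le]
  have cv : ∀ f : ℝ → ℝ, Continuous f → Continuous (volterra L k f) := fun f hf =>
    continuous_volterra hk.smooth.continuous hf
  have cd : Continuous fun x => pdFst (kdvOp v) t x - volterra L k (pdFst (kdvOp v) t) x
      - c * pdFst (pdSnd (pdSnd (corrector L e))) t (L - x) := by
    have := hs.fst.continuous_snd t
    have := cv _ this
    have := hB.snd.snd.fst.continuous_snd t
    fun_prop
  have cH := he.smooth.continuous_correctorPotential (L := L) lam t
  have cB3 := hB.snd.snd.snd.continuous_snd t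
  have cB5 := hB.snd.snd.snd.snd.snd.continuous_snd t
  have cB2 := hB.snd.snd.continuous_snd t
  have cBt := hB.snd.snd.fst.continuous_snd t
  have key := hdis _ _ _ _ (fun x => g * F x)
    (fun x => -c * correctorPotential L lam e t (L - x))
    (fun x => -c * -(pdSnd (pdSnd (pdSnd (corrector L e))) t (L - x)
        + pdSnd (pdSnd (pdSnd (pdSnd (pdSnd (corrector L e))))) t (L - x)
        - lam * pdSnd (pdSnd (corrector L e)) t (L - x)
        - pdFst (pdSnd (pdSnd (corrector L e))) t (L - x)))
    _ hch (continuous_const.mul cF) (by fun_prop) (by fun_prop) cd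
    (fun x _ => ((he.smooth.hasDerivAt_correctorPotential lam t (L - x)).comp_const_sub L
      x).const_mul (-c))
    (by rw [sub_zero, b0, B2L, sub_self])
    (by rw [sub_self, bL, B20, volterra_self]; ring)
    (fun x hx => by
      have hdt := hk.direct_transform hkL hL hn bL x hx
      have hvt : volterra L k (pdFst (kdvOp v) t) x
          = -volterra L k (fun y => pdSnd (kdvOp v) t y + pdSnd (pdSnd (pdSnd (kdvOp v))) t y) x
            + -g * volterra L k q x := by
        exact (volterra_congr (fun y hy => by
          rw [eqn y hy, sub_eq_add_neg, ← neg_mul]; rfl) hx).trans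
          (volterra_neg_add hk.smooth.continuous (hn.c₁.add hn.c₃) cq (-g) x)
      rw [hvt, eqn x hx, hF]
      rw [bL1] at hdt
      beta_reduce
      linear_combination (-1) * hdt)
  beta_reduce at key
  rw [sub_self, B30, bL1, volterra_self] at key
  rw [sqInt_const_mul, sqInt_const_mul,
    sqInt_reflect (f := correctorPotential L lam e t)] at key
  have nH := sqInt_nonneg (f := correctorPotential L lam e t) hL.le
  refine key.trans ?_
  have n₀ := sqInt_nonneg (f := fun x => kdvOp v t x - volterra L k (kdvOp v t) x
    - c * pdSnd (pdSnd (corrector L e)) t (L - x)) hL.le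
  have n₁ := sqInt_nonneg (f := fun x => pdSnd (kdvOp v) t x - volterra L (pdFst k) (kdvOp v t) x
    - c * -pdSnd (pdSnd (pdSnd (corrector L e))) t (L - x)) hL.le
  have n₂ := mul_nonneg hε.le (add_nonneg n₀ n₁)
  generalize sqInt L (correctorPotential L lam e t) = H at nH ⊢
  have m₁ : 0 ≤ C * ((pdFst p L L ^ 2 + sqInt L F + 1) * H + (c ^ 2 + 1) * g ^ 2) := by positivity
  nlinarith

end ObserverSystem

lemma sqInt_le_weighted {L ε : ℝ} (hL : 0 ≤ L) (hε : 0 ≤ ε) {f : ℝ → ℝ} (hf : Continuous f) :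
    sqInt L f ≤ ∫ x in (0 : ℝ)..L, (1 + ε * x) * f x ^ 2 := by
  refine intervalIntegral.integral_mono_on hL (Continuous.intervalIntegrable (by fun_prop) _ _)
    (Continuous.intervalIntegrable (by fun_prop) _ _) fun x hx => ?_
  nlinarith [mul_nonneg (mul_nonneg hε hx.1) (sq_nonneg (f x))]

lemma weighted_le_sqInt {L ε : ℝ} (hL : 0 ≤ L) (hε : 0 ≤ ε) {f : ℝ → ℝ} (hf : Continuous f) :
    ∫ x in (0 : ℝ)..L, (1 + ε * x) * f x ^ 2 ≤ (1 + ε * L) * sqInt L f := by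
  rw [sqInt, ← intervalIntegral.integral_const_mul]
  refine intervalIntegral.integral_mono_on hL (Continuous.intervalIntegrable (by fun_prop) _ _)
    (Continuous.intervalIntegrable (by fun_prop) _ _) fun x hx => ?_
  have := mul_le_mul_of_nonneg_left hx.2 hε
  gcongr

namespace ErrorSystem

variable {L lam : ℝ} {p : ℝ → ℝ → ℝ}
  {S : C(Set.Icc (0 : ℝ) L, ℝ) →L[ℝ] C(Set.Icc (0 : ℝ) L, ℝ)}

/-- The error dissipates its weighted energy, and the dissipation controls its effect on the
observer. -/
lemma exists_dissipation (hp : BackstepKernel L lam 0 p) (hp0 : ∀ y ∈ Set.Icc 0 L, p 0 y = 0)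
    (hL : 0 < L) (hlam : 0 < lam) (hS : IsResolvent hL.le p S) {ε : ℝ} (hε : 0 < ε) :
    ∃ C : ℝ, 0 ≤ C ∧ ∀ e (h : ErrorSystem L p e), ∀ t > 0, ∃ Y : ℝ, 0 ≤ Y ∧
      (∫ x in (0 : ℝ)..L, 2 * ((1 + ε * x) * extendIcc hL.le (S (h.smooth.fst.curve L t)) x
          * extendIcc hL.le (S (h.smooth.fst.fst.curve L t)) x)
        ≤ -(2 * (lam - ε)) * (∫ x in (0 : ℝ)..L, (1 + ε * x)
          * extendIcc hL.le (S (h.smooth.fst.curve L t)) x ^ 2) - ε / 2 * Y)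
      ∧ pdSnd (pdSnd e) t L ^ 2 + sqInt L (correctorPotential L lam e t) ≤ C * Y := by
  obtain ⟨C₁, -, hdis⟩ := _root_.exists_dissipation hL hε lam
  obtain ⟨C₂, m₂, h₂⟩ := exists_chainSq_le hp hp0 hL hlam hS
  obtain ⟨C₃, m₃, h₃⟩ := exists_sqInt_correctorPotential_le hp hL
  obtain ⟨C₄, m₄, h₄⟩ := exists_sqInt_volterra_le hL.le hp.smooth.continuous
  obtain ⟨C₅, m₅, h₅⟩ := exists_sqInt_volterra_le hL.le hp.smooth₁.continuous
  refine ⟨C₂ + C₃ * (C₂ + (2 + 2 * C₄) + (2 + 2 * C₅) + C₂), by positivity,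
    fun e h t ht => ?_⟩
  obtain ⟨z₁, z₂, z₃, hz, z0, zL, z1L, e₁, er⟩ := h.target hp hp0 hL hS ht
  obtain ⟨a₂, g₂⟩ := h₂ e h t ht.le
  have a₃ := h₃ e h t ht.le
  have ez := resolvent_curve hL.le hS h.smooth.fst t
  have cz := hz.c₀
  have cz₁ := hz.c₁
  have cd := continuous_extendIcc hL.le (S (h.smooth.fst.fst.curve L t))
  have key := hdis _ _ _ _ (fun _ => 0) (fun _ => 0) (fun _ => 0) _ hz continuous_const
    continuous_const continuous_const cd (fun x _ => hasDerivAt_const x 0) z0 zL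
    (fun x hx => by rw [er x hx]; ring)
  set z := extendIcc hL.le (S (h.smooth.fst.curve L t)) with hz'
  have v₄ := h₄ z cz
  have v₅ := h₅ z cz
  have s₄ := sqInt_sub_le hL.le cz (continuous_volterra (L := L) hp.smooth.continuous cz)
  have s₅ := sqInt_sub_le hL.le cz₁
    (continuous_volterra (L := L) hp.smooth₁.continuous cz)
  rw [sqInt_congr hL.le ez] at s₄
  rw [sqInt_congr hL.le e₁] at s₅
  have n₀ := sqInt_nonneg (f := z) hL.le
  have n₁ := sqInt_nonneg (f := z₁) hL.le
  refine ⟨sqInt L z + sqInt L z₁, add_nonneg n₀ n₁, ?_, ?_⟩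
  · have : sqInt L (fun _ : ℝ => (0 : ℝ)) = 0 := by simp [sqInt]
    rw [z1L, this] at key
    linarith
  · change sqInt L (pdFst e t) ≤ _ at s₄
    have b : chainSq L (e t) (pdSnd e t) (pdSnd (pdSnd e) t) (pdSnd (pdSnd (pdSnd e)) t)
          + sqInt L (pdFst e t) + sqInt L (pdSnd (pdFst e) t) + pdSnd (pdSnd e) t L ^ 2
        ≤ (C₂ + (2 + 2 * C₄) + (2 + 2 * C₅) + C₂) * (sqInt L z + sqInt L z₁) := by
      have : 0 ≤ (C₂ + (2 + 2 * C₄) + 2 * C₅ + C₂) * sqInt L z₁ + 2 * sqInt L z := by positivity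
      linarith
    have b' := mul_le_mul_of_nonneg_left b m₃
    have : 0 ≤ C₂ * sqInt L z₁ := by positivity
    linarith

/-- The transformed time derivative of the error is controlled in `L²` by the `H³` norm. -/
lemma exists_sqInt_le (hp : BackstepKernel L lam 0 p) (hL : 0 < L) (hS : IsResolvent hL.le p S) :
    ∃ C : ℝ, 0 ≤ C ∧ ∀ e (h : ErrorSystem L p e), ∀ t ≥ 0,
      sqInt L (extendIcc hL.le (S (h.smooth.fst.curve L t))) ≤ C * chainSq L (e t) (pdSnd e t)
        (pdSnd (pdSnd e) t) (pdSnd (pdSnd (pdSnd e)) t) := by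
  obtain ⟨C₁, m₁, h₁⟩ := exists_sqInt_le_of_volterra hL.le hp.smooth.continuous
  obtain ⟨C₂, m₂, h₂⟩ := exists_trace_sq_le hL
  have cp := (hp.derivChain_slice L).c₀
  have np := sqInt_nonneg (f := fun x => p x L) hL.le
  refine ⟨C₁ * (8 + 2 * C₂ * sqInt L fun x => p x L), by positivity, fun e h t ht => ?_⟩
  have hs := h.smooth
  have a₁ := h₁ _ _ (hs.fst.continuous_snd t) (continuous_extendIcc hL.le (S (hs.fst.curve L t)))
    (resolvent_curve hL.le hS hs.fst t)
  have hc := hs.derivChain L t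
  have a₂ := h₂ _ _ _ _ hc
  obtain ⟨-, b₁, -, b₃⟩ := sqInt_le_chainSq (f₀ := e t) (f₁ := pdSnd e t)
    (f₂ := pdSnd (pdSnd e) t) (f₃ := pdSnd (pdSnd (pdSnd e)) t) hL.le
  have c1 := hc.c₁
  have c3 := hc.c₃
  have s₁ := sqInt_add_le hL.le c1 c3
  have s₂ := sqInt_add_le hL.le (f := fun x => -(pdSnd e t x + pdSnd (pdSnd (pdSnd e)) t x))
    (g := fun x => pdSnd (pdSnd e) t L * p x L) (by fun_prop) (by fun_prop)
  rw [sqInt_const_mul, sqInt_neg (f := fun x => pdSnd e t x + pdSnd (pdSnd (pdSnd e)) t x),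
    ← sqInt_congr hL.le (h.kdv t ht)] at s₂
  have := mul_le_mul_of_nonneg_right a₂ np
  rw [mul_assoc]
  refine a₁.trans (mul_le_mul_of_nonneg_left (s₂.trans ?_) m₁)
  linarith

end ErrorSystem

/-- Exponential decay of the error and of the observer in `H³`. -/
lemma ObserverSystem.exists_decay {L lam ε : ℝ} {k p : ℝ → ℝ → ℝ}
    (hk : BackstepKernel L (-lam) (lam * L / 3) k) (hkL : ∀ x ∈ Set.Icc 0 L, k x L = 0)
    (hp : BackstepKernel L lam 0 p) (hp0 : ∀ y ∈ Set.Icc 0 L, p 0 y = 0) (hL : 0 < L)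
    (hlam : 0 < lam) (hε : 0 < ε) :
    ∃ C : ℝ, 0 ≤ C ∧ ∀ e v, ErrorSystem L p e → ObserverSystem L k p e v →
      (∀ x ∈ Set.Icc 0 L, v 0 x = 0) → ∀ t ≥ 0,
      chainSq L (e t) (pdSnd e t) (pdSnd (pdSnd e) t) (pdSnd (pdSnd (pdSnd e)) t)
        + chainSq L (v t) (pdSnd v t) (pdSnd (pdSnd v) t) (pdSnd (pdSnd (pdSnd v)) t)
      ≤ C * (Real.exp (-(2 * (lam - ε)) * t)
        * chainSq L (e 0) (pdSnd e 0) (pdSnd (pdSnd e) 0) (pdSnd (pdSnd (pdSnd e)) 0)) := by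
  obtain ⟨S, hS⟩ := exists_resolvent hL.le hp.smooth.continuous
  change IsResolvent hL.le p S at hS
  set c := volterra L k (fun y => p y L) 0 with hc
  obtain ⟨C₁, m₁, h₁⟩ := ErrorSystem.exists_dissipation hp hp0 hL hlam hS hε
  obtain ⟨C₂, m₂, h₂⟩ := ObserverSystem.exists_dissipation hk hkL hp hp0 hL hε hc
  obtain ⟨C₃, m₃, h₃⟩ := ErrorSystem.exists_chainSq_le hp hp0 hL hlam hS
  obtain ⟨C₄, m₄, h₄⟩ := hk.exists_chainSq_le hkL hL hlam
  obtain ⟨C₅, m₅, h₅⟩ := exists_sqInt_corrector_le hL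
  obtain ⟨C₆, m₆, h₆⟩ := ErrorSystem.exists_sqInt_le hp hL hS
  set M := 2 * C₂ * C₁ / ε + 1 with hM
  have pM : 0 < M := by positivity
  refine ⟨(C₃ + C₄ * (2 + 2 * c ^ 2 * C₅ * C₃))
    * (M * ((1 + ε * L) * C₆) + (1 + ε * L) * (c ^ 2 * C₅)), by positivity,
    fun e v he hv hv0 t ht => ?_⟩
  have hs := hv.smooth.kdvOp
  have hB := he.smooth.corrector (L := L)
  have hR := hB.snd.snd.reflect_snd (L := L)
  have hw : Continuous fun x : ℝ => 1 + ε * x := by fun_prop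
  set E : ℝ → ℝ := fun t => ∫ x in (0 : ℝ)..L, (1 + ε * x)
    * extendIcc hL.le (S (he.smooth.fst.curve L t)) x ^ 2 with hE
  set W : ℝ → ℝ := fun t => ∫ x in (0 : ℝ)..L, (1 + ε * x) * (kdvOp v t x
    - volterra L k (kdvOp v t) x - c * pdSnd (pdSnd (corrector L e)) t (L - x)) ^ 2 with hW
  have dE : ∀ t, HasDerivAt E (∫ x in (0 : ℝ)..L, 2 * ((1 + ε * x)
      * extendIcc hL.le (S (he.smooth.fst.curve L t)) x
      * extendIcc hL.le (S (he.smooth.fst.fst.curve L t)) x)) t := fun t => hasDerivAt_energy hL.le hw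
    (S.hasFDerivAt.comp_hasDerivAt t (he.smooth.fst.hasDerivAt_curve L t))
  have dW : ∀ t, HasDerivAt W (∫ x in (0 : ℝ)..L, 2 * ((1 + ε * x) * (kdvOp v t x
      - volterra L k (kdvOp v t) x - c * pdSnd (pdSnd (corrector L e)) t (L - x))
      * (pdFst (kdvOp v) t x - volterra L k (pdFst (kdvOp v) t) x
        - c * pdFst (pdSnd (pdSnd (corrector L e))) t (L - x)))) t := fun t =>
    hs.hasDerivAt_energy_volterra hR hL.le hk.smooth.continuous hw c t
  have dV : ∀ t, HasDerivAt (fun t => M * E t + W t) _ t := fun t =>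
    ((dE t).const_mul M).add (dW t)
  have cz : ∀ t, Continuous (extendIcc hL.le (S (he.smooth.fst.curve L t))) := fun t =>
    continuous_extendIcc hL.le _
  have cR : ∀ t, Continuous fun x => pdSnd (pdSnd (corrector L e)) t (L - x) := fun t =>
    hR.continuous_snd t
  have cn : ∀ t, Continuous fun x => kdvOp v t x - volterra L k (kdvOp v t) x := fun t =>
    (hs.continuous_snd t).sub (continuous_volterra hk.smooth.continuous (hs.continuous_snd t))
  have cf : ∀ t, Continuous fun x => kdvOp v t x - volterra L k (kdvOp v t) x
      - c * pdSnd (pdSnd (corrector L e)) t (L - x) := fun t =>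
    (cn t).sub (continuous_const.mul (cR t))
  have decay := le_exp_mul_of_deriv_le (c := 2 * (lam - ε))
    (fun t _ => (dV t).continuousAt.continuousWithinAt) (fun t _ => dV t) (fun t ht => by
      obtain ⟨Y, y₀, y₁, y₂⟩ := h₁ e he t ht
      have w₁ := h₂ e v he hv t ht
      have y₁' := mul_le_mul_of_nonneg_left y₁ pM.le
      have y₂' := mul_le_mul_of_nonneg_left y₂ m₂
      have hMε : M * (ε / 2) = C₂ * C₁ + ε / 2 := by
        rw [hM]
        field_simp
      have hMY : M * (ε / 2 * Y) = C₂ * (C₁ * Y) + ε / 2 * Y := by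
        rw [← mul_assoc, hMε]
        ring
      have := mul_nonneg (half_pos hε).le y₀
      change _ ≤ -(2 * (lam - ε)) * E t - ε / 2 * Y at y₁
      change _ ≤ M * (-(2 * (lam - ε)) * E t - ε / 2 * Y) at y₁'
      change _ ≤ -(2 * (lam - ε)) * W t + _ at w₁
      have : -(2 * (lam - ε)) * (M * E t + W t)
        = M * (-(2 * (lam - ε)) * E t) + -(2 * (lam - ε)) * W t := by ring
      linarith) t ht
  have nR : ∀ t ≥ 0, sqInt L (fun x => c * pdSnd (pdSnd (corrector L e)) t (L - x))
      ≤ c ^ 2 * C₅ * chainSq L (e t) (pdSnd e t) (pdSnd (pdSnd e) t)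
        (pdSnd (pdSnd (pdSnd e)) t) := fun t ht => by
    rw [sqInt_const_mul, sqInt_reflect (f := pdSnd (pdSnd (corrector L e)) t), mul_assoc]
    exact mul_le_mul_of_nonneg_left (h₅ e he.smooth t) (sq_nonneg c)
  have ezt := sqInt_le_weighted hL.le hε.le (cz t)
  have ewt := sqInt_le_weighted hL.le hε.le (cf t)
  have upper : chainSq L (e t) (pdSnd e t) (pdSnd (pdSnd e) t) (pdSnd (pdSnd (pdSnd e)) t)
      + chainSq L (v t) (pdSnd v t) (pdSnd (pdSnd v) t) (pdSnd (pdSnd (pdSnd v)) t)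
      ≤ (C₃ + C₄ * (2 + 2 * c ^ 2 * C₅ * C₃)) * (M * E t + W t) := by
    obtain ⟨u₁, -⟩ := h₃ e he t ht
    have u₂ := h₄ _ _ _ _ (hv.smooth.derivChain L t) (hv.left t ht) (hv.right t ht)
      (hv.right' t ht)
    change _ ≤ C₄ * sqInt L (fun x => kdvOp v t x - volterra L k (kdvOp v t) x) at u₂
    have u₃ := sqInt_add_le hL.le (cf t)
      (g := fun x => c * pdSnd (pdSnd (corrector L e)) t (L - x)) (continuous_const.mul (cR t))
    simp only [sub_add_cancel] at u₃
    have u₄ := (nR t ht).trans (mul_le_mul_of_nonneg_left u₁ (by positivity))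
    have hE0 := (sqInt_nonneg hL.le).trans ezt
    have hW0 := (sqInt_nonneg hL.le).trans ewt
    change _ ≤ E t at ezt hE0
    change _ ≤ W t at ewt hW0
    set n := sqInt L (extendIcc hL.le (S (he.smooth.fst.curve L t)))
    have hn : n ≤ M * E t := ezt.trans (by
      have : 0 ≤ 2 * C₂ * C₁ / ε * E t := by positivity
      rw [hM]
      linarith)
    have hV : 0 ≤ M * E t + W t := by positivity
    have q : 0 ≤ c ^ 2 * C₅ * C₃ := by positivity
    have u₅ : sqInt L (fun x => kdvOp v t x - volterra L k (kdvOp v t) x)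
        ≤ (2 + 2 * c ^ 2 * C₅ * C₃) * (M * E t + W t) := by
      have := mul_le_mul_of_nonneg_left (hn.trans (le_add_of_nonneg_right hW0)) q
      have : 0 ≤ M * E t := by positivity
      linarith
    have u₆ := mul_le_mul_of_nonneg_left u₅ m₄
    have u₇ := mul_le_mul_of_nonneg_left (hn.trans (le_add_of_nonneg_right hW0)) m₃
    linarith
  have initial : M * E 0 + W 0 ≤ (M * ((1 + ε * L) * C₆) + (1 + ε * L) * (c ^ 2 * C₅))
      * chainSq L (e 0) (pdSnd e 0) (pdSnd (pdSnd e) 0) (pdSnd (pdSnd (pdSnd e)) 0) := by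
    have a₁ := (weighted_le_sqInt hL.le hε.le (cz 0)).trans
      (mul_le_mul_of_nonneg_left (h₆ e he 0 le_rfl) (by positivity))
    have a₂ := weighted_le_sqInt hL.le hε.le (cf 0)
    obtain ⟨v₁, -, v₃⟩ := (hv.smooth.derivChain L 0).eq_of_eq hL (g₀ := fun _ => 0)
      (g₁ := fun _ => 0) (g₂ := fun _ => 0) (g₃ := fun _ => 0)
      ⟨continuous_const, continuous_const, continuous_const, continuous_const,
        fun x _ => hasDerivAt_const x 0, fun x _ => hasDerivAt_const x 0,
        fun x _ => hasDerivAt_const x 0⟩ hv0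
    have v₄ : ∀ x ∈ Set.Icc 0 L, kdvOp v 0 x = 0 := fun x hx => by
      rw [kdvOp, v₁ x hx, v₃ x hx, add_zero]
    have a₃ : sqInt L (fun x => kdvOp v 0 x - volterra L k (kdvOp v 0) x
        - c * pdSnd (pdSnd (corrector L e)) 0 (L - x))
        = sqInt L (fun x => c * pdSnd (pdSnd (corrector L e)) 0 (L - x)) := by
      rw [← sqInt_neg (f := fun x => c * pdSnd (pdSnd (corrector L e)) 0 (L - x))]
      refine sqInt_congr hL.le fun x hx => ?_
      rw [v₄ x hx, volterra_congr (g := fun _ => 0) v₄ hx]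
      simp [volterra]
    rw [a₃] at a₂
    have a₄ := a₂.trans (mul_le_mul_of_nonneg_left (nR 0 le_rfl) (by positivity))
    have a₅ := mul_le_mul_of_nonneg_left a₁ pM.le
    change M * E 0 ≤ _ at a₅
    change W 0 ≤ _ at a₄
    linarith
  refine upper.trans ((mul_le_mul_of_nonneg_left (decay.trans (mul_le_mul_of_nonneg_left initial
    (Real.exp_nonneg _))) (by positivity)).trans_eq (by ring))

lemma Smooth₂.pdSnd_sub {U V : ℝ → ℝ → ℝ} (h : Smooth₂ U) (h' : Smooth₂ V) :
    pdSnd (fun t x => U t x - V t x) = fun t x => pdSnd U t x - pdSnd V t x := by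
  funext t x
  exact ((h.hasDerivAt_snd t x).sub (h'.hasDerivAt_snd t x)).deriv

lemma Smooth₂.pdFst_sub {U V : ℝ → ℝ → ℝ} (h : Smooth₂ U) (h' : Smooth₂ V) :
    pdFst (fun t x => U t x - V t x) = fun t x => pdFst U t x - pdFst V t x := by
  funext t x
  exact ((h.hasDerivAt_fst t x).sub (h'.hasDerivAt_fst t x)).deriv

lemma sum_integral_iteratedDeriv_sq (U : ℝ → ℝ → ℝ) (L t : ℝ) :
    ∑ j ∈ Finset.range 4, ∫ x in (0 : ℝ)..L, (iteratedDeriv j (fun y => U t y) x) ^ 2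
      = chainSq L (U t) (pdSnd U t) (pdSnd (pdSnd U) t) (pdSnd (pdSnd (pdSnd U)) t) := by
  simp only [Finset.sum_range_succ, Finset.sum_range_zero, zero_add, iteratedDeriv_slice_snd]
  rfl



/-- Main theorem: output feedback stabilization of the linear KdV equation.  Given the
state-feedback kernel `k` and the observer kernel `p` (with observer gain `p₁(x) = p(x,L)`),
for every `0 < ε < λ` there is `C > 0` such that for every solution `(u, û)` of the
closed-loop plant–observer system with output feedback `κ(t) = ∫₀ᴸ k(0,y) û(t,y) dy`,
measurement `y(t) = u_xx(t,L)` and observer initial data `û(0,·) = 0`, one has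
`‖u(t,·)‖_{H³(0,L)} + ‖û(t,·)‖_{L²(0,L)} ≤ C e^{-(λ-ε)t} ‖u(0,·)‖_{H³(0,L)}`. -/
theorem output_feedback_stabilization_linear_KdV
    (L lam : ℝ) (hL : 0 < L) (hlam : 0 < lam)
    (k : ℝ → ℝ → ℝ) (hk : ContDiff ℝ 3 (Function.uncurry k))
    (hkpde : ∀ x y : ℝ, (x, y) ∈ {q : ℝ × ℝ | 0 ≤ q.1 ∧ q.1 ≤ L ∧ q.1 ≤ q.2 ∧ q.2 ≤ L} →
      iteratedDeriv 3 (fun s => k s y) x + iteratedDeriv 3 (fun r => k x r) y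
        + deriv (fun s => k s y) x + deriv (fun r => k x r) y = -lam * k x y)
    (hkL : ∀ x ∈ Set.Icc (0:ℝ) L, k x L = 0)
    (hkdiag : ∀ x ∈ Set.Icc (0:ℝ) L, k x x = 0)
    (hkxdiag : ∀ x ∈ Set.Icc (0:ℝ) L, deriv (fun s => k s x) x = lam / 3 * (L - x))
    (p : ℝ → ℝ → ℝ) (hp : ContDiff ℝ 3 (Function.uncurry p))
    (hppde : ∀ x y : ℝ, (x, y) ∈ {q : ℝ × ℝ | 0 ≤ q.1 ∧ q.1 ≤ L ∧ q.1 ≤ q.2 ∧ q.2 ≤ L} →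
      iteratedDeriv 3 (fun s => p s y) x + iteratedDeriv 3 (fun r => p x r) y
        + deriv (fun s => p s y) x + deriv (fun r => p x r) y = lam * p x y)
    (hpdiag : ∀ x ∈ Set.Icc (0:ℝ) L, p x x = 0)
    (hpxdiag : ∀ x ∈ Set.Icc (0:ℝ) L, deriv (fun s => p s x) x = lam / 3 * x)
    (hp0 : ∀ y ∈ Set.Icc (0:ℝ) L, p 0 y = 0) :
    ∀ ε : ℝ, 0 < ε → ε < lam → ∃ C > (0:ℝ),
      ∀ u uh : ℝ → ℝ → ℝ,
        ContDiff ℝ (⊤ : ℕ∞) (Function.uncurry u) → ContDiff ℝ (⊤ : ℕ∞) (Function.uncurry uh) →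
        (∀ t ≥ (0:ℝ), ∀ x ∈ Set.Icc (0:ℝ) L,
          deriv (fun s => u s x) t + deriv (fun y => u t y) x
            + iteratedDeriv 3 (fun y => u t y) x = 0) →
        (∀ t ≥ (0:ℝ), ∀ x ∈ Set.Icc (0:ℝ) L,
          deriv (fun s => uh s x) t + deriv (fun y => uh t y) x
            + iteratedDeriv 3 (fun y => uh t y) x
            + p x L * (iteratedDeriv 2 (fun y => u t y) L
                - iteratedDeriv 2 (fun y => uh t y) L) = 0) →
        (∀ t ≥ (0:ℝ), u t 0 = ∫ y in (0:ℝ)..L, k 0 y * uh t y) →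
        (∀ t ≥ (0:ℝ), uh t 0 = ∫ y in (0:ℝ)..L, k 0 y * uh t y) →
        (∀ t ≥ (0:ℝ), u t L = 0) →
        (∀ t ≥ (0:ℝ), deriv (fun y => u t y) L = 0) →
        (∀ t ≥ (0:ℝ), uh t L = 0) →
        (∀ t ≥ (0:ℝ), deriv (fun y => uh t y) L = 0) →
        (∀ x ∈ Set.Icc (0:ℝ) L, uh 0 x = 0) →
        ∀ t ≥ (0:ℝ),
          Real.sqrt (∑ j ∈ Finset.range 4,
              ∫ x in (0:ℝ)..L, (iteratedDeriv j (fun y => u t y) x) ^ 2)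
            + Real.sqrt (∫ x in (0:ℝ)..L, (uh t x) ^ 2)
          ≤ C * Real.exp (-(lam - ε) * t)
            * Real.sqrt (∑ j ∈ Finset.range 4,
                ∫ x in (0:ℝ)..L, (iteratedDeriv j (fun y => u 0 y) x) ^ 2) := by
  intro ε hε hεlam
  have hk' : BackstepKernel L (-lam) (lam * L / 3) k := by
    refine ⟨hk, fun x y hx hxy hy => ?_, hkdiag, fun x hx => ?_⟩
    · have := hkpde x y ⟨hx, hxy.trans hy, hxy, hy⟩
      rwa [iteratedDeriv_slice_fst, iteratedDeriv_slice_snd] at this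
    · exact (hkxdiag x hx).trans (by ring)
  have hp' : BackstepKernel L lam 0 p := by
    refine ⟨hp, fun x y hx hxy hy => ?_, hpdiag, fun x hx => ?_⟩
    · have := hppde x y ⟨hx, hxy.trans hy, hxy, hy⟩
      rwa [iteratedDeriv_slice_fst, iteratedDeriv_slice_snd] at this
    · exact (hpxdiag x hx).trans (by ring)
  obtain ⟨C, hC, hdecay⟩ := ObserverSystem.exists_decay hk' hkL hp' hp0 hL hlam hε
  refine ⟨2 * Real.sqrt (2 * C) + 1, by positivity, ?_⟩
  intro u v hu hv hukdv hvkdv hu0 hv0 huL huL' hvL hvL' hinit t ht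
  replace hu : Smooth₂ u := hu
  replace hv : Smooth₂ v := hv
  have f₁ := hu.pdFst_sub hv
  have s₁ := hu.pdSnd_sub hv
  have s₂ := hu.snd.pdSnd_sub hv.snd
  have s₃ := hu.snd.snd.pdSnd_sub hv.snd.snd
  rw [← s₁] at s₂
  rw [← s₂] at s₃
  simp only [iteratedDeriv_slice_snd] at hukdv hvkdv
  have he : ErrorSystem L p (fun t x => u t x - v t x) := by
    refine ⟨hu.sub hv, fun t ht x hx => ?_, fun t ht => ?_, fun t ht => ?_, fun t ht => ?_⟩
    · have a := hukdv t ht x hx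
      have b := hvkdv t ht x hx
      change pdFst u t x + pdSnd u t x + pdSnd (pdSnd (pdSnd u)) t x = 0 at a
      change pdFst v t x + pdSnd v t x + pdSnd (pdSnd (pdSnd v)) t x
        + p x L * (pdSnd (pdSnd u) t L - pdSnd (pdSnd v) t L) = 0 at b
      rw [s₃, s₂, s₁, f₁]
      linarith
    · rw [hu0 t ht, hv0 t ht, sub_self]
    · rw [huL t ht, hvL t ht, sub_self]
    · rw [s₁]
      exact (congrArg₂ (· - ·) (huL' t ht) (hvL' t ht)).trans (sub_self 0)
  have hobs : ObserverSystem L k p (fun t x => u t x - v t x) v := by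
    refine ⟨hv, fun t ht x hx => ?_, hv0, hvL, hvL'⟩
    have b := hvkdv t ht x hx
    change pdFst v t x + pdSnd v t x + pdSnd (pdSnd (pdSnd v)) t x
      + p x L * (pdSnd (pdSnd u) t L - pdSnd (pdSnd v) t L) = 0 at b
    rw [s₂]
    linarith
  have main := hdecay _ v he hobs hinit t ht
  have sum := DerivChain.chainSq_add_le hL.le (he.smooth.derivChain L t) (hv.derivChain L t)
  have initial : ∀ x ∈ Set.Icc 0 L, u 0 x - v 0 x = u 0 x := fun x hx => by
    rw [hinit x hx, sub_zero]
  obtain ⟨i₁, i₂, i₃⟩ := (he.smooth.derivChain L 0).eq_of_eq hL (hu.derivChain L 0) initial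
  rw [chainSq_congr hL.le initial i₁ i₂ i₃] at main
  rw [s₃, s₂, s₁] at sum main
  simp only [sub_add_cancel] at sum
  have hvle := (sqInt_le_chainSq (f₀ := v t) (f₁ := pdSnd v t) (f₂ := pdSnd (pdSnd v) t)
    (f₃ := pdSnd (pdSnd (pdSnd v)) t) hL.le).1
  have hnn := chainSq_nonneg (f₀ := fun x => u t x - v t x)
    (f₁ := fun x => pdSnd u t x - pdSnd v t x)
    (f₂ := fun x => pdSnd (pdSnd u) t x - pdSnd (pdSnd v) t x)
    (f₃ := fun x => pdSnd (pdSnd (pdSnd u)) t x - pdSnd (pdSnd (pdSnd v)) t x) hL.le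
  rw [sum_integral_iteratedDeriv_sq, sum_integral_iteratedDeriv_sq]
  set N := chainSq L (u 0) (pdSnd u 0) (pdSnd (pdSnd u) 0) (pdSnd (pdSnd (pdSnd u)) 0)
  have hN : 0 ≤ N := chainSq_nonneg hL.le
  have hexp : Real.sqrt (Real.exp (-(2 * (lam - ε)) * t)) = Real.exp (-(lam - ε) * t) := by
    rw [← Real.exp_half]
    ring_nf
  have bound : ∀ a, a ≤ 2 * C * (Real.exp (-(2 * (lam - ε)) * t) * N) →
      Real.sqrt a ≤ Real.sqrt (2 * C) * Real.exp (-(lam - ε) * t) * Real.sqrt N := fun a ha => by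
    refine (Real.sqrt_le_sqrt ha).trans_eq ?_
    rw [Real.sqrt_mul (by positivity), Real.sqrt_mul (Real.exp_nonneg _), hexp, mul_assoc]
  have b₁ := bound (chainSq L (u t) (pdSnd u t) (pdSnd (pdSnd u) t) (pdSnd (pdSnd (pdSnd u)) t))
    (by linarith)
  have b₂ := bound (∫ x in (0 : ℝ)..L, (v t x) ^ 2) (by
    change sqInt L (v t) ≤ _
    have := chainSq_nonneg (f₀ := v t) (f₁ := pdSnd v t) (f₂ := pdSnd (pdSnd v) t)
      (f₃ := pdSnd (pdSnd (pdSnd v)) t) hL.le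
    linarith)
  have : 0 ≤ Real.exp (-(lam - ε) * t) * Real.sqrt N := by positivity
  linarith
end
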